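/- arXiv:1007.1489 — 2 statements merged into one kernel-verified Lean document; each statement's English description precedes it below -/
import Mathlib

section
/- For every prime p there exists a finitely generated hereditarily just-infinite group Δ with the following property: if ω denotes the augmentation ideal of the group algebra F_p[Δ] (the kernel of the F_p-algebra homomorphism F_p[Δ] → F_p sending every group element to 1), then each quotient ω^n/ω^{n+1} is a finite-dimensional F_p-vector space and there exists a real number c > 1 such that dim_{F_p}(ω^n/ω^{n+1}) ≥ c^n for all sufficiently large n; that is, the graded algebra gr F_p[Δ] = ⊕_{n≥0} ω^n/ω^{n+1} has exponential growth. -/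
/-- A group is residually finite if every nontrivial element avoids some
finite-index normal subgroup. -/
def ResiduallyFinite (G : Type*) [Group G] : Prop :=
  ∀ g : G, g ≠ 1 → ∃ N : Subgroup G, N.Normal ∧ N.FiniteIndex ∧ g ∉ N

/-- A group is just-infinite if it is infinite and every nontrivial normal
subgroup has finite index. -/
def JustInfinite (G : Type*) [Group G] : Prop :=
  Infinite G ∧ ∀ N : Subgroup G, N.Normal → N ≠ ⊥ → N.FiniteIndex

/-- A group is hereditarily just-infinite if it is residually finite and every
finite-index subgroup (including the group itself) is just-infinite. -/
def HereditarilyJustInfinite (G : Type*) [Group G] : Prop :=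
  ResiduallyFinite G ∧ ∀ H : Subgroup G, H.FiniteIndex → JustInfinite H




namespace HJI

/-- Next generation of blocks: the marker `s` followed by the other blocks in any order. -/
noncomputable def nextB (B : Finset (List (Fin 8))) (s : List (Fin 8)) : Finset (List (Fin 8)) :=
  (((B.erase s).toList.permutations).map (fun l => (s :: l).flatten)).toFinset

/-- Next marker. -/
noncomputable def nextS (B : Finset (List (Fin 8))) (s : List (Fin 8)) : List (Fin 8) :=
  (s :: (B.erase s).toList).flatten

/-- The pair (blocks, marker) at level `k`. -/
noncomputable def BS : ℕ → Finset (List (Fin 8)) × List (Fin 8)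
  | 0 => (Finset.univ.image (fun x => [x]), [0])
  | k + 1 => (nextB (BS k).1 (BS k).2, nextS (BS k).1 (BS k).2)

/-- Blocks of level `k`. -/
noncomputable def B (k : ℕ) : Finset (List (Fin 8)) := (BS k).1
/-- Marker of level `k`. -/
noncomputable def S (k : ℕ) : List (Fin 8) := (BS k).2
/-- Length of blocks of level `k`. -/
noncomputable def len (k : ℕ) : ℕ := (S k).length

theorem mem_B_succ {k : ℕ} {c : List (Fin 8)} :
    c ∈ B (k+1) ↔ ∃ l : List (List (Fin 8)), l.Perm ((B k).erase (S k)).toList ∧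
      (S k ++ l.flatten) = c := by
  simp [B, S, BS, nextB]

theorem S_succ (k : ℕ) : S (k+1) = S k ++ ((B k).erase (S k)).toList.flatten := by
  simp [B, S, BS, nextS]

theorem B_zero : B 0 = Finset.univ.image (fun x => [x]) := rfl
theorem S_zero : S 0 = [0] := rfl

theorem S_mem (k : ℕ) : S k ∈ B k := by
  cases k with
  | zero => simp [B_zero, S_zero]
  | succ k => exact mem_B_succ.2 ⟨_, List.Perm.refl _, (S_succ k).symm⟩

theorem mem_of_perm {k : ℕ} {l : List (List (Fin 8))}
    (h : l.Perm ((B k).erase (S k)).toList) {b} : b ∈ l ↔ b ∈ B k ∧ b ≠ S k := by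
  rw [h.mem_iff]; simp [and_comm]

theorem flatten_length_const {n : ℕ} (l : List (List (Fin 8))) (h : ∀ b ∈ l, b.length = n) :
    l.flatten.length = l.length * n := by
  induction l with
  | nil => simp
  | cons a t ih =>
    simp only [List.flatten_cons, List.length_append, List.length_cons]
    rw [ih (fun b hb => h b (by simp [hb])), h a (by simp)]; ring

theorem len_B (k : ℕ) : ∀ b ∈ B k, b.length = len k := by
  induction k with
  | zero => intro b hb; simp [B_zero] at hb; obtain ⟨x, rfl⟩ := hb; simp [len, S_zero]
  | succ k ih =>
    have key : ∀ b ∈ B (k+1), b.length = (B k).card * len k := by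
      intro b hb
      obtain ⟨l, hl, rfl⟩ := mem_B_succ.1 hb
      rw [List.length_append, flatten_length_const l (n := len k)
        (fun b hb => ih b ((mem_of_perm hl).1 hb).1), ih _ (S_mem k), hl.length_eq,
        Finset.length_toList, Finset.card_erase_of_mem (S_mem k)]
      have := Finset.card_pos.2 ⟨_, S_mem k⟩
      obtain ⟨m, hm⟩ : ∃ m, (B k).card = m + 1 := ⟨(B k).card - 1, by omega⟩
      rw [hm]; simp; ring
    intro b hb
    exact (key b hb).trans (key _ (S_mem (k+1))).symm

theorem len_succ (k : ℕ) : len (k+1) = (B k).card * len k := by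
  rw [len, S_succ]
  have hl := List.Perm.refl ((B k).erase (S k)).toList
  rw [List.length_append, flatten_length_const _ (n := len k)
        (fun b hb => len_B k b ((mem_of_perm hl).1 hb).1),
        Finset.length_toList, Finset.card_erase_of_mem (S_mem k)]
  have := Finset.card_pos.2 ⟨_, S_mem k⟩
  obtain ⟨m, hm⟩ : ∃ m, (B k).card = m + 1 := ⟨(B k).card - 1, by omega⟩
  rw [hm]; simp [len]; ring

theorem flatten_inj {n : ℕ} (hn : 0 < n) : ∀ (l l' : List (List (Fin 8))),
    (∀ b ∈ l, b.length = n) → (∀ b ∈ l', b.length = n) → l.flatten = l'.flatten → l = l' := by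
  intro l
  induction l with
  | nil =>
    intro l' _ h' e
    cases l' with
    | nil => rfl
    | cons a t =>
      have := h' a (by simp)
      have h2 := congrArg List.length e
      simp at h2; omega
  | cons a t ih =>
    intro l' h h' e
    cases l' with
    | nil =>
      have := h a (by simp)
      have h3 : a = [] := by simp at e; exact e.1
      subst h3; simp at this; omega
    | cons a' t' =>
      simp only [List.flatten_cons] at e
      have := List.append_inj e (by rw [h a (by simp), h' a' (by simp)])
      rw [this.1, ih t' (fun b hb => h b (by simp [hb])) (fun b hb => h' b (by simp [hb])) this.2]

theorem len_pos (k : ℕ) : 0 < len k := by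
  induction k with
  | zero => simp [len, S_zero]
  | succ k ih => rw [len_succ]; exact Nat.mul_pos (Finset.card_pos.2 ⟨_, S_mem k⟩) ih

theorem card_succ (k : ℕ) : (B (k+1)).card = ((B k).card - 1).factorial := by
  have : B (k+1) = (((B k).erase (S k)).toList.permutations.map
    (fun l => (S k :: l).flatten)).toFinset := rfl
  rw [this, List.toFinset_card_of_nodup, List.length_map, List.length_permutations,
    Finset.length_toList, Finset.card_erase_of_mem (S_mem k)]
  apply List.Nodup.map_on
  · intro l hl l' hl' e
    rw [List.mem_permutations] at hl hl'
    simp only [List.flatten_cons, List.append_cancel_left_eq] at e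
    exact flatten_inj (len_pos k) _ _ (fun b hb => len_B k b ((mem_of_perm hl).1 hb).1)
      (fun b hb => len_B k b ((mem_of_perm hl').1 hb).1) e
  · exact List.nodup_permutations _ (Finset.nodup_toList _)

theorem fact_aux (m : ℕ) (hm : 4 ≤ m) : 4 * m ^ m ≤ 4 ^ m * (m-1).factorial := by
  induction m, hm using Nat.le_induction with
  | base => decide
  | succ m hm ih =>
    have h1 : (m+1)^(m+1) ≤ 4 * m ^ (m+1) := by
      have hm' : (0:ℝ) < m := by positivity
      have h2 : (1 + 1/(m:ℝ))^(m+1) ≤ 4 := by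
        have h3 : (1 + 1/(m:ℝ)) ≤ Real.exp (1/(m:ℝ)) := by
          rw [add_comm]; exact Real.add_one_le_exp _
        calc (1 + 1/(m:ℝ))^(m+1) ≤ (Real.exp (1/(m:ℝ)))^(m+1) := by gcongr
          _ = Real.exp ((m+1)/m) := by
              rw [← Real.exp_nat_mul]; congr 1; push_cast; field_simp
          _ ≤ Real.exp (5/4) := by
              apply Real.exp_le_exp.2
              rw [div_le_div_iff₀ hm' (by norm_num)]
              have : (4:ℝ) ≤ m := by exact_mod_cast hm
              linarith
          _ ≤ 4 := by
              have h5 : Real.exp 1 < 2.7182818286 := Real.exp_one_lt_d9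
              have h6 : Real.exp (5/4) ^ 4 = Real.exp 1 ^ 5 := by
                rw [← Real.exp_nat_mul, ← Real.exp_nat_mul]; norm_num
              by_contra hcon
              push Not at hcon
              have h7 : (4:ℝ)^4 < Real.exp (5/4) ^ 4 := by gcongr
              rw [h6] at h7
              have h8 : Real.exp 1 ^ 5 ≤ 2.7182818286 ^ 5 := by gcongr
              norm_num at h8 h7; linarith
      have : ((m:ℝ)+1)^(m+1) ≤ 4 * (m:ℝ) ^ (m+1) := by
        have e : (m:ℝ)+1 = (1 + 1/(m:ℝ)) * m := by field_simp
        rw [e, mul_pow]; gcongr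
      exact_mod_cast this
    have h2 : (m + 1 - 1).factorial = m * (m-1).factorial := by
      simp; rw [Nat.mul_factorial_pred (by omega)]
    rw [h2]
    calc 4 * (m+1)^(m+1) ≤ 4 * (4 * m^(m+1)) := by gcongr
      _ = 4 * m * (4 * m ^ m) := by ring
      _ ≤ 4 * m * (4 ^ m * (m-1).factorial) := by gcongr
      _ = _ := by ring

theorem card_ge (k : ℕ) : 4 * 2 ^ (len k) ≤ (B k).card := by
  induction k with
  | zero =>
    rw [B_zero, Finset.card_image_of_injective _ (fun x y h => by simpa using h)]
    simp [len, S_zero]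
  | succ k ih =>
    rw [card_succ, len_succ]
    set m := (B k).card
    have h4 : 4 ≤ m := by
      have : 0 < 2 ^ len k := by positivity
      omega
    have h := fact_aux m h4
    have h2 : 4 * (4 * 2 ^ len k) ^ m ≤ 4 ^ m * (m-1).factorial := le_trans (by gcongr) h
    rw [mul_pow, ← pow_mul] at h2
    have h3 : 4 ^ m * (4 * 2 ^ (m * len k)) ≤ 4 ^ m * (m-1).factorial := by
      rw [mul_comm m]; linarith
    exact Nat.le_of_mul_le_mul_left h3 (by positivity)

theorem four_le_card (k : ℕ) : 4 ≤ (B k).card := by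
  have := card_ge k
  have : 0 < 2 ^ len k := by positivity
  omega

theorem len_lt_succ (k : ℕ) : len k < len (k+1) := by
  rw [len_succ]; have := len_pos k; have := four_le_card k; nlinarith

theorem len_ge (k : ℕ) : k < len k := by
  induction k with
  | zero => exact len_pos 0
  | succ k ih => have := len_lt_succ k; omega

/-- The language: all factors of blocks. -/
def Lang : Set (List (Fin 8)) := {w | ∃ k, ∃ b ∈ B k, w <:+: b}

theorem infix_flatten {b : List (Fin 8)} {l : List (List (Fin 8))} (h : b ∈ l) : b <:+: l.flatten := by
  obtain ⟨s, t, rfl⟩ := List.append_of_mem h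
  exact ⟨s.flatten, t.flatten, by simp⟩

theorem infix_succ {k : ℕ} {b c : List (Fin 8)} (hb : b ∈ B k) (hc : c ∈ B (k+1)) : b <:+: c := by
  obtain ⟨l, hl, rfl⟩ := mem_B_succ.1 hc
  by_cases h : b = S k
  · subst h; exact (List.prefix_append _ _).isInfix
  · exact (infix_flatten ((mem_of_perm hl).2 ⟨hb, h⟩)).trans (List.suffix_append _ _).isInfix

theorem infix_add {k : ℕ} {b : List (Fin 8)} (hb : b ∈ B k) (n : ℕ) {c} (hc : c ∈ B (k+n+1)) : b <:+: c := by
  induction n generalizing c with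
  | zero => exact infix_succ hb hc
  | succ n ih => exact (ih (S_mem _)).trans (infix_succ (S_mem _) hc)

theorem Lang_level {w : List (Fin 8)} (hw : w ∈ Lang) : ∃ k, ∀ K ≥ k, ∀ c ∈ B K, w <:+: c := by
  obtain ⟨k, b, hb, h⟩ := hw
  refine ⟨k+1, fun K hK c hc => ?_⟩
  obtain ⟨n, rfl⟩ := Nat.exists_eq_add_of_le hK
  exact h.trans (infix_add hb n (by convert hc using 2; ring))

theorem Lang_factor {w w' : List (Fin 8)} (h : w' ∈ Lang) (hw : w <:+: w') : w ∈ Lang := by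
  obtain ⟨k, b, hb, h⟩ := h
  exact ⟨k, b, hb, hw.trans h⟩

/-- Higher blocks are concatenations of lower ones. -/
theorem decomp (j n : ℕ) : ∀ c ∈ B (j+n), ∃ l : List (List (Fin 8)), (∀ b ∈ l, b ∈ B j) ∧ c = l.flatten := by
  induction n with
  | zero => intro c hc; exact ⟨[c], by simpa using hc, by simp⟩
  | succ n ih =>
    intro c hc
    obtain ⟨l, hl, rfl⟩ := mem_B_succ.1 (show c ∈ B (j+n+1) from hc)
    have hall : ∀ b ∈ S (j+n) :: l, b ∈ B (j+n) := by
      intro b hb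
      rcases List.mem_cons.1 hb with rfl | hb
      · exact S_mem _
      · exact ((mem_of_perm hl).1 hb).1
    have : (S (j+n) ++ l.flatten) = (S (j+n) :: l).flatten := by simp
    rw [this]
    generalize S (j+n) :: l = L at hall
    clear hc this hl
    induction L with
    | nil => exact ⟨[], by simp, by simp⟩
    | cons a t iht =>
      obtain ⟨l1, h1, rfl⟩ := ih a (hall a (by simp))
      obtain ⟨l2, h2, e2⟩ := iht (fun b hb => hall b (by simp [hb]))
      refine ⟨l1 ++ l2, ?_, by simp [e2]⟩
      intro b hb
      rcases List.mem_append.1 hb with hb | hb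
      exacts [h1 b hb, h2 b hb]

/-- A long factor of a concatenation contains a whole block. -/
theorem contains_block {n : ℕ} : ∀ (l : List (List (Fin 8))) (u w v : List (Fin 8)),
    (∀ b ∈ l, b.length = n) → l.flatten = u ++ w ++ v → 2 * n ≤ w.length → 0 < n →
      ∃ b ∈ l, b <:+: w := by
  intro l
  induction l with
  | nil =>
    intro u w v _ h hw hn
    have := congrArg List.length h
    simp at this; omega
  | cons a t ih =>
    intro u w v hl h hw hn
    have ha := hl a (by simp)
    simp only [List.flatten_cons] at h
    by_cases hu : n ≤ u.length
    · obtain ⟨u', rfl⟩ : a <+: u := by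
        rw [List.append_assoc] at h
        exact List.prefix_of_prefix_length_le ⟨_, h⟩ ⟨_, rfl⟩ (by omega)
      obtain ⟨b, hb, hbw⟩ := ih u' w v (fun b hb => hl b (by simp [hb]))
        (by simpa [List.append_assoc] using h) hw hn
      exact ⟨b, by simp [hb], hbw⟩
    · push Not at hu
      obtain ⟨q, hq⟩ : u <+: a := by
        rw [List.append_assoc] at h
        exact List.prefix_of_prefix_length_le ⟨_, rfl⟩ ⟨_, h⟩ (by omega)
      subst hq
      simp only [List.append_assoc, List.append_cancel_left_eq] at h
      simp at ha
      obtain ⟨r, rfl⟩ : q <+: w := List.prefix_of_prefix_length_le ⟨_, h⟩ ⟨_, rfl⟩ (by omega)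
      simp only [List.append_assoc, List.append_cancel_left_eq] at h
      simp at hw
      cases t with
      | nil =>
        have := congrArg List.length h
        simp at this; omega
      | cons a' t' =>
        have ha' := hl a' (by simp)
        refine ⟨a', by simp, ?_⟩
        simp only [List.flatten_cons] at h
        have : a' <+: r := List.prefix_of_prefix_length_le ⟨_, h⟩ ⟨_, rfl⟩ (by omega)
        exact this.isInfix.trans (List.suffix_append _ _).isInfix

theorem Lang_minimal {w : List (Fin 8)} (hw : w ∈ Lang) :
    ∃ k, ∀ w' ∈ Lang, k ≤ w'.length → w <:+: w' := by
  obtain ⟨k, hk⟩ := Lang_level hw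
  refine ⟨2 * len k, fun w' hw' hlen => ?_⟩
  obtain ⟨k', hk'⟩ := Lang_level hw'
  obtain ⟨u, v, huv⟩ := hk' (k + k') (by omega) _ (S_mem _)
  obtain ⟨l, hl, e⟩ := decomp k k' _ (S_mem _)
  obtain ⟨b, hb, hbw⟩ := contains_block l u w' v (fun b hb => len_B k b (hl b hb)) (by rw [← e, huv])
    hlen (len_pos k)
  exact (hk k le_rfl b (hl b hb)).trans hbw

theorem Lang_long (n : ℕ) : ∃ w ∈ Lang, n ≤ w.length :=
  ⟨S n, ⟨n, S n, S_mem n, List.infix_rfl⟩, (len_ge n).le⟩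

theorem nil_mem_Lang : [] ∈ Lang := ⟨0, S 0, S_mem 0, List.nil_infix⟩

theorem align {n : ℕ} (hn : 0 < n) : ∀ (l : List (List (Fin 8))) (u v : List (Fin 8)),
    (∀ b ∈ l, b.length = n) → l.flatten = u ++ v → n ∣ u.length →
      ∃ l1 l2, l = l1 ++ l2 ∧ u = l1.flatten ∧ v = l2.flatten := by
  intro l
  induction l with
  | nil =>
    intro u v _ h _
    simp at h
    exact ⟨[], [], by simp, by simp [h.1], by simp [h.2]⟩
  | cons a t ih =>
    intro u v hl h hd
    have ha := hl a (by simp)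
    by_cases hu : u = []
    · subst hu
      exact ⟨[], a :: t, by simp, by simp, by simpa using h.symm⟩
    · have hpos : 0 < u.length := List.length_pos_iff.2 hu
      have hle : n ≤ u.length := Nat.le_of_dvd hpos hd
      simp only [List.flatten_cons] at h
      obtain ⟨u', rfl⟩ : a <+: u :=
        List.prefix_of_prefix_length_le ⟨_, h⟩ ⟨_, rfl⟩ (by omega)
      simp only [List.append_assoc, List.append_cancel_left_eq] at h
      obtain ⟨l1, l2, rfl, rfl, rfl⟩ := ih u' v (fun b hb => hl b (by simp [hb])) h (by
        rw [List.length_append, ha] at hd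
        exact (Nat.dvd_add_right (dvd_refl n)).1 hd)
      exact ⟨a :: l1, l2, by simp, by simp, rfl⟩

/-- In a concatenation of blocks of level `k+1`, an aligned marker starts a block. -/
theorem recog_aux (k : ℕ) : ∀ (l : List (List (Fin 8))) (u v : List (Fin 8)),
    (∀ b ∈ l, b ∈ B (k+1)) → l.flatten = u ++ (S k ++ v) → len k ∣ u.length →
      len (k+1) ∣ u.length := by
  intro l
  induction l with
  | nil =>
    intro u v _ h _
    simp at h
    have := len_pos k
    rw [len, h.2.1] at this; simp at this
  | cons a t ih =>
    intro u v hl h hd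
    have ha := hl a (by simp)
    have hal := len_B _ a ha
    simp only [List.flatten_cons] at h
    by_cases hu : len (k+1) ≤ u.length
    · obtain ⟨u', rfl⟩ : a <+: u :=
        List.prefix_of_prefix_length_le ⟨_, h⟩ ⟨_, rfl⟩ (by omega)
      simp only [List.append_assoc, List.append_cancel_left_eq] at h
      have hdd : len k ∣ a.length := by rw [hal, len_succ]; exact dvd_mul_left _ _
      have := ih u' v (fun b hb => hl b (by simp [hb])) h (by
        rw [List.length_append] at hd
        exact (Nat.dvd_add_right hdd).1 hd)
      rw [List.length_append, hal]
      exact (Nat.dvd_add_right (dvd_refl _)).2 this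
    · push Not at hu
      obtain ⟨q, hq⟩ : u <+: a :=
        List.prefix_of_prefix_length_le ⟨_, rfl⟩ ⟨_, h⟩ (by omega)
      obtain ⟨l', hl', e'⟩ := mem_B_succ.1 ha
      have e2 : (S k :: l').flatten = u ++ q := by simp [e', hq]
      have hblk : ∀ b ∈ S k :: l', b.length = len k := by
        intro b hb
        rcases List.mem_cons.1 hb with rfl | hb
        · rfl
        · exact len_B k b ((mem_of_perm hl').1 hb).1
      obtain ⟨l1, l2, e3, rfl, rfl⟩ := align (len_pos k) _ _ _ hblk e2 hd
      cases l1 with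
      | nil => simp
      | cons x l1' =>
        exfalso
        simp at e3
        obtain ⟨rfl, rfl⟩ := e3
        cases l2 with
        | nil =>
          rw [← hal, ← hq] at hu
          simp at hu
        | cons y l2' =>
          rw [← hq] at h
          simp only [List.append_assoc, List.append_cancel_left_eq, List.flatten_cons] at h
          have := (List.append_inj h (by
            rw [hblk y (by simp)]; rfl)).1
          have h2 := (mem_of_perm hl').1 (show S k ∈ l1' ++ y :: l2' by simp [this])
          exact h2.2 rfl

theorem recog (k : ℕ) : ∀ (n : ℕ) (c u v : List (Fin 8)), c ∈ B (k+1+n) → c = u ++ (S k ++ v) →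
    len (k+1) ∣ u.length := by
  induction k with
  | zero =>
    intro n c u v hc h
    obtain ⟨l, hl, e⟩ := decomp 1 n c (by simpa using hc)
    exact recog_aux 0 l u v hl (e.symm.trans h) (by simp [len, S_zero])
  | succ k ih =>
    intro n c u v hc h
    obtain ⟨l, hl, e⟩ := decomp (k+1+1) n c hc
    refine recog_aux (k+1) l u v hl (e.symm.trans h) ?_
    refine ih (1+n) c u _ (by convert hc using 2; ring) (by rw [h, S_succ, List.append_assoc])

theorem S_pre_exists (k : ℕ) {c : List (Fin 8)} (hc : c ∈ B (k+1)) : S k <+: c := by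
  obtain ⟨l, _, rfl⟩ := mem_B_succ.1 hc
  exact List.prefix_append _ _

theorem perm_of_erase {T : Finset (List (Fin 8))} {b : List (Fin 8)} (hb : b ∈ T) :
    (b :: (T.erase b).toList).Perm T.toList := by
  rw [List.perm_ext_iff_of_nodup]
  · intro a; by_cases h : a = b <;> simp [h, hb]
  · simp [Finset.nodup_toList]
  · exact Finset.nodup_toList _

theorem block_marker (k : ℕ) {c : List (Fin 8)} (hc : c ∈ B (k+1)) : c ++ S k ∈ Lang := by
  have hcard := four_le_card (k+1)
  by_cases h : c = S (k+1)
  · have h1 : S (k+1+1) ∈ B (k+1+1) := S_mem _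
    have : ((B (k+1)).erase (S (k+1))).Nonempty := by
      rw [← Finset.card_pos, Finset.card_erase_of_mem (S_mem _)]; omega
    obtain ⟨d, hd⟩ := this
    obtain ⟨t, ht⟩ := S_pre_exists k (Finset.mem_of_mem_erase hd)
    refine ⟨k+2, _, mem_B_succ.2 ⟨_, perm_of_erase hd, rfl⟩, ?_⟩
    subst h
    refine ⟨[], t ++ (((B (k+1)).erase (S (k+1))).erase d).toList.flatten, ?_⟩
    simp [← ht]
  · have hc' : c ∈ (B (k+1)).erase (S (k+1)) := by simp [h, hc]
    have : (((B (k+1)).erase (S (k+1))).erase c).Nonempty := by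
      rw [← Finset.card_pos, Finset.card_erase_of_mem hc', Finset.card_erase_of_mem (S_mem _)]; omega
    obtain ⟨d, hd⟩ := this
    obtain ⟨t, ht⟩ := S_pre_exists k (Finset.mem_of_mem_erase (Finset.mem_of_mem_erase hd))
    refine ⟨k+2, _, mem_B_succ.2 ⟨_, ((perm_of_erase hd).cons c).trans (perm_of_erase hc'), rfl⟩, ?_⟩
    refine ⟨S (k+1), t ++ ((((B (k+1)).erase (S (k+1))).erase c).erase d).toList.flatten, ?_⟩
    simp [← ht]

theorem Lang_isolate {w0 : List (Fin 8)} (hw0 : w0 ∈ Lang) (D : ℕ) :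
    ∃ u v, u ++ w0 ++ v ∈ Lang ∧ ∀ w, w.length ≤ D → u ++ w ++ v ∈ Lang → w = w0 := by
  obtain ⟨k0, hk0⟩ := Lang_level hw0
  set K := k0 + D + w0.length + 1 with hK
  have hlenK : K < len K := len_ge K
  have hlt := len_lt_succ K
  obtain ⟨b, hb⟩ : ((B K).erase (S K)).Nonempty := by
    have := four_le_card K
    rw [← Finset.card_pos, Finset.card_erase_of_mem (S_mem _)]; omega
  have hbB := Finset.mem_of_mem_erase hb
  obtain ⟨u0, v0, hb0⟩ := hk0 K (by omega) b hbB
  have hblen := len_B K b hbB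
  set l := (((B K).erase (S K)).erase b).toList with hl
  have hlB : ∀ a ∈ l, a ∈ B K := by
    intro a ha; simp [hl] at ha; exact ha.2.2
  have hβ : S K ++ (b :: l).flatten ∈ B (K+1) := mem_B_succ.2 ⟨_, perm_of_erase hb, rfl⟩
  have hβlen := len_B _ _ hβ
  refine ⟨S K ++ u0, v0 ++ l.flatten ++ S K, ?_, ?_⟩
  · have := block_marker K hβ
    rw [← hb0] at this
    simpa [List.append_assoc] using this
  · intro w hw hmem
    obtain ⟨k1, hk1⟩ := Lang_level hmem
    obtain ⟨x, y, hxy⟩ := hk1 (K+1+k1) (by omega) _ (S_mem _)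
    have h1 := recog K k1 _ x (u0 ++ w ++ v0 ++ l.flatten ++ S K ++ y) (S_mem _)
      (by rw [← hxy]; simp [List.append_assoc])
    have h2 := recog K k1 _ (x ++ (S K ++ (u0 ++ w ++ v0) ++ l.flatten)) y (S_mem _)
      (by rw [← hxy]; simp [List.append_assoc])
    rw [List.length_append] at h2
    have h3 := (Nat.dvd_add_right h1).1 h2
    have hSl : (S K).length = len K := rfl
    have hm : (S K ++ (u0 ++ w ++ v0) ++ l.flatten).length + w0.length = len (K+1) + w.length := by
      rw [← hβlen, ← hb0]; simp; ring
    have hwl : w.length = w0.length := by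
      obtain ⟨q, hq⟩ := h3
      rw [hq] at hm
      have : q = 1 := by
        rcases Nat.lt_or_ge q 1 with h | h
        · have : q = 0 := by omega
          subst this; simp at hm; omega
        · rcases Nat.lt_or_ge 1 q with h' | h'
          · exfalso
            have : len (K+1) * 2 ≤ len (K+1) * q := Nat.mul_le_mul_left _ h'
            omega
          · omega
      subst this; simp at hm; omega
    have hm' : (S K ++ (u0 ++ w ++ v0) ++ l.flatten).length = len (K+1) := by omega
    obtain ⟨L, hL, eL⟩ := decomp (K+1) k1 _ (S_mem _)
    obtain ⟨L1, L2, rfl, rfl, e2⟩ := align (len_pos (K+1)) L x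
      ((S K ++ (u0 ++ w ++ v0) ++ l.flatten) ++ (S K ++ y)) (fun b hb => len_B _ _ (hL b hb))
      (by rw [← eL, ← hxy]; simp [List.append_assoc]) h1
    cases L2 with
    | nil =>
      have := congrArg List.length e2
      rw [List.length_append, hm'] at this
      simp at this; omega
    | cons a t =>
      have haB : a ∈ B (K+1) := hL a (by simp)
      rw [List.flatten_cons] at e2
      have ea := (List.append_inj e2 (by rw [hm', len_B _ _ haB])).1
      rw [← ea] at haB
      obtain ⟨l', hl', el'⟩ := mem_B_succ.1 haB
      rw [List.append_assoc, List.append_cancel_left_eq] at el'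
      have hbl : (u0 ++ w ++ v0).length = len K := by
        rw [← hblen, ← hb0]; simp [hwl]
      have e3 : l' = (u0 ++ w ++ v0) :: l := by
        apply flatten_inj (len_pos K)
        · intro c hc; exact len_B K c ((mem_of_perm hl').1 hc).1
        · intro c hc
          rcases List.mem_cons.1 hc with rfl | hc
          · exact hbl
          · exact len_B K c (hlB c hc)
        · rw [el', List.flatten_cons]
      have hnd : l'.Nodup := hl'.nodup_iff.2 (Finset.nodup_toList _)
      have hin := (mem_of_perm hl').1 (show (u0 ++ w ++ v0) ∈ l' by simp [e3])
      rw [e3, List.nodup_cons] at hnd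
      have heq : u0 ++ w ++ v0 = b := by
        by_contra hne
        exact hnd.1 (by rw [hl]; simp only [Finset.mem_toList, Finset.mem_erase]; exact ⟨hne, hin.2, hin.1⟩)
      rw [← hb0] at heq
      simpa using heq

/-- Number of words of length `n`. -/
noncomputable def NL (n : ℕ) : ℕ := {w ∈ Lang | w.length = n}.ncard

theorem NL_fin (n : ℕ) : {w ∈ Lang | w.length = n}.Finite :=
  (List.finite_length_eq (Fin 8) n).subset (fun _ h => h.2)

theorem NL_add (a b : ℕ) : NL (a+b) ≤ NL a * NL b := by
  rw [NL, NL, NL, ← Set.ncard_prod]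
  refine Set.ncard_le_ncard_of_injOn (fun w => (w.take a, w.drop a)) ?_ ?_ ((NL_fin a).prod (NL_fin b))
  · rintro w ⟨hw, hl⟩
    refine ⟨⟨Lang_factor hw (List.take_prefix _ _).isInfix, by simp [hl]⟩,
      ⟨Lang_factor hw (List.drop_suffix _ _).isInfix, by simp [hl]⟩⟩
  · rintro w _ w' _ h
    simp only [Prod.mk.injEq] at h
    rw [← List.take_append_drop a w, ← List.take_append_drop a w', h.1, h.2]

theorem Lang_extend {w : List (Fin 8)} (hw : w ∈ Lang) (n : ℕ) : ∃ y, y.length = n ∧ w ++ y ∈ Lang := by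
  obtain ⟨k, hk⟩ := Lang_minimal hw
  obtain ⟨W, hW, hWl⟩ := Lang_long (k + n)
  have h1 : W.take k ∈ Lang := Lang_factor hW (List.take_prefix _ _).isInfix
  obtain ⟨s, t, e⟩ := hk _ h1 (by simp; omega)
  have e2 : W = s ++ w ++ (t ++ W.drop k) := by
    rw [← List.append_assoc, e, List.take_append_drop]
  have hl : n ≤ (t ++ W.drop k).length := by simp; omega
  refine ⟨(t ++ W.drop k).take n, by rw [List.length_take]; omega, Lang_factor hW ?_⟩
  refine ⟨s, (t ++ W.drop k).drop n, ?_⟩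
  conv_rhs => rw [e2]
  simp only [List.append_assoc, List.take_append_drop]

theorem NL_mono {a b : ℕ} (h : a ≤ b) : NL a ≤ NL b := by
  have : {w ∈ Lang | w.length = a} ⊆ (List.take a) '' {w ∈ Lang | w.length = b} := by
    rintro w ⟨hw, rfl⟩
    obtain ⟨y, hy, hwy⟩ := Lang_extend hw (b - w.length)
    exact ⟨w ++ y, ⟨hwy, by simp; omega⟩, by simp⟩
  exact (Set.ncard_le_ncard this ((NL_fin b).image _)).trans (Set.ncard_image_le (NL_fin b))

theorem NL_mul (n q : ℕ) : NL (n * q) ≤ NL n ^ q := by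
  induction q with
  | zero =>
    simp only [mul_zero, pow_zero, NL]
    refine (Set.ncard_le_ncard (t := {[]}) ?_).trans (by simp)
    rintro w ⟨_, h⟩; simpa using h
  | succ q ih =>
    rw [mul_add, mul_one, pow_succ]
    exact (NL_add _ _).trans (Nat.mul_le_mul_right _ ih)

theorem NL_len (k : ℕ) : 2 ^ len k ≤ NL (len k) := by
  have h1 : (B k).card ≤ NL (len k) := by
    rw [← Set.ncard_coe_finset, NL]
    exact Set.ncard_le_ncard (fun b hb => ⟨⟨k, b, hb, List.infix_rfl⟩, len_B k b hb⟩) (NL_fin _)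
  have := card_ge k
  omega

theorem NL_growth (n : ℕ) : 2 ^ n ≤ NL n ^ 2 := by
  rcases Nat.eq_zero_or_pos n with rfl | hn
  · have : 0 < NL 0 := (Set.ncard_pos (NL_fin 0)).2 ⟨[], nil_mem_Lang, rfl⟩
    simp only [pow_zero]; exact Nat.one_le_pow _ _ this
  · set q := len n / n with hq
    have hge := len_ge n
    have hq1 : 1 ≤ q := (Nat.one_le_div_iff hn).2 hge.le
    have h1 : n * q ≤ len n := Nat.mul_div_le _ _
    have h2 : len n ≤ n * (2 * q) := by
      have := Nat.lt_mul_div_succ (len n) hn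
      rw [← hq] at this
      nlinarith
    have h3 : 2 ^ (n * q) ≤ NL n ^ (2 * q) :=
      calc 2 ^ (n * q) ≤ 2 ^ len n := Nat.pow_le_pow_right (by norm_num) h1
        _ ≤ NL (len n) := NL_len n
        _ ≤ NL (n * (2 * q)) := NL_mono h2
        _ ≤ _ := NL_mul _ _
    rw [pow_mul, pow_mul] at h3
    exact (Nat.pow_le_pow_iff_left (by omega)).1 h3

end HJI


namespace HJI

/-- Word algebra of the language `Lang` over `ZMod p`, given by abstract data. -/
structure WordAlg (p : ℕ) (R : Type) [Ring R] [Module (ZMod p) R] where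
  mon : List (Fin 8) → R
  coeff : R →ₗ[ZMod p] (List (Fin 8) →₀ ZMod p)
  mon_nil : mon [] = 1
  mon_append : ∀ u v, mon (u ++ v) = mon u * mon v
  coeff_mon : ∀ w ∈ Lang, coeff (mon w) = Finsupp.single w 1
  mon_not_mem : ∀ w, w ∉ Lang → mon w = 0
  repr : ∀ r, r = (coeff r).sum (fun w c => c • mon w)

section model
variable (p : ℕ) [Fact p.Prime]

open Classical in
/-- Letter operator. -/
noncomputable def T (x : Fin 8) : Module.End (ZMod p) (List (Fin 8) →₀ ZMod p) :=
  Finsupp.lsum (ZMod p) (fun w =>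
    if x :: w ∈ Lang then Finsupp.lsingle (x :: w) else 0)

open Classical in
theorem T_single (x : Fin 8) (w : List (Fin 8)) :
    T p x (Finsupp.single w 1) = if x :: w ∈ Lang then Finsupp.single (x :: w) 1 else 0 := by
  simp only [T, Finsupp.lsum_single]
  split_ifs <;> simp

/-- The model algebra. -/
noncomputable def RR : Subalgebra (ZMod p) (Module.End (ZMod p) (List (Fin 8) →₀ ZMod p)) :=
  Algebra.adjoin (ZMod p) (Set.range (T p))

/-- Monomials in the model. -/
noncomputable def monE (w : List (Fin 8)) : Module.End (ZMod p) (List (Fin 8) →₀ ZMod p) :=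
  (w.map (T p)).prod

theorem monE_append (u v) : monE p (u ++ v) = monE p u * monE p v := by simp [monE]

open Classical in
theorem monE_single (x : Fin 8) (w u : List (Fin 8)) :
    monE p (x :: w) (Finsupp.single u 1) =
      if x :: w ++ u ∈ Lang then Finsupp.single (x :: w ++ u) 1 else 0 := by
  induction w generalizing x with
  | nil => simp [monE, T_single]
  | cons y w ih =>
    have : monE p (x :: y :: w) = T p x * monE p (y :: w) := by simp [monE]
    rw [this, Module.End.mul_apply, ih]
    split_ifs with h1 h2 h2
    · rw [T_single, if_pos]; · simp
      simpa using h2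
    · rw [T_single, if_neg]; simpa using h2
    · exact absurd (Lang_factor h2 (by exact (List.suffix_cons _ _).isInfix)) h1
    · simp

theorem monE_mem (w) : monE p w ∈ RR p := by
  apply list_prod_mem
  intro x hx
  simp at hx
  obtain ⟨a, _, rfl⟩ := hx
  exact Algebra.subset_adjoin ⟨a, rfl⟩

theorem RR_span : ∀ r ∈ RR p, r ∈ Submodule.span (ZMod p) (Set.range (monE p)) := by
  intro r hr
  rw [RR, ← Subalgebra.mem_toSubmodule, Algebra.adjoin_eq_span] at hr
  refine Submodule.span_mono ?_ hr
  intro m hm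
  induction hm using Submonoid.closure_induction with
  | mem x hx => obtain ⟨a, rfl⟩ := hx; exact ⟨[a], by simp [monE]⟩
  | one => exact ⟨[], by simp [monE]⟩
  | mul x y _ _ hx hy =>
    obtain ⟨a, rfl⟩ := hx
    obtain ⟨b, rfl⟩ := hy
    exact ⟨a ++ b, monE_append p a b⟩

theorem monE_coeff {w} (hw : w ∈ Lang) : monE p w (Finsupp.single [] 1) = Finsupp.single w 1 := by
  cases w with
  | nil => simp [monE]
  | cons x w => rw [monE_single]; simp [hw]

theorem monE_zero {w} (hw : w ∉ Lang) : monE p w = 0 := by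
  cases w with
  | nil => exact absurd nil_mem_Lang hw
  | cons x w =>
    apply Finsupp.lhom_ext'
    intro u
    ext1
    simp only [LinearMap.comp_apply, Finsupp.lsingle_apply]
    rw [monE_single, if_neg]
    · simp
    · exact fun h => hw (Lang_factor h (List.prefix_append _ _).isInfix)

noncomputable instance : Ring (RR p) := Algebra.semiringToRing (ZMod p)

/-- The model satisfies the axioms. -/
noncomputable def model : WordAlg p (RR p) where
  mon w := ⟨monE p w, monE_mem p w⟩
  coeff := (LinearMap.applyₗ (Finsupp.single [] 1)) ∘ₗ (RR p).val.toLinearMap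
  mon_nil := by ext1; simp [monE]
  mon_append u v := by ext1; simp [monE_append]
  coeff_mon w hw := by simpa using monE_coeff p hw
  mon_not_mem w hw := by ext1; simpa using monE_zero p hw
  repr r := by
    obtain ⟨r, hr⟩ := r
    ext1
    have h := RR_span p r hr
    simp only [Finsupp.sum, AddSubmonoidClass.coe_finsetSum, SetLike.val_smul, LinearMap.comp_apply]
    change r = (r (Finsupp.single [] 1)).sum fun w c => c • monE p w
    clear hr
    induction h using Submodule.span_induction with
    | mem x hx =>
      obtain ⟨w, rfl⟩ := hx
      by_cases hw : w ∈ Lang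
      · rw [monE_coeff p hw]; simp
      · rw [monE_zero p hw]; simp
    | zero => simp
    | add x y _ _ hx hy =>
      rw [LinearMap.add_apply, Finsupp.sum_add_index' (by simp) (by simp [add_smul])]
      rw [← hx, ← hy]
    | smul a x _ hx =>
      rw [LinearMap.smul_apply, Finsupp.sum_smul_index' (by simp)]
      conv_lhs => rw [hx]
      simp [Finsupp.sum, Finset.smul_sum, mul_smul]

end model

namespace WordAlg
variable {p : ℕ} [Fact p.Prime] {R : Type} [Ring R] [Algebra (ZMod p) R] (A : WordAlg p R)
include A

theorem ext_coeff {r : R} (h : A.coeff r = 0) : r = 0 := by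
  rw [A.repr r, h]; simp

theorem coeff_not_mem (r : R) {w} (hw : w ∉ Lang) : A.coeff r w = 0 := by
  rw [A.repr r]
  simp only [Finsupp.sum, map_sum, map_smul, Finsupp.finsetSum_apply, Finsupp.smul_apply]
  apply Finset.sum_eq_zero
  intro v _
  by_cases hv : v ∈ Lang
  · rw [A.coeff_mon v hv, Finsupp.single_apply, if_neg (by rintro rfl; exact hw hv)]; simp
  · rw [A.mon_not_mem v hv]; simp

theorem mon_ne_zero {w} (hw : w ∈ Lang) : A.mon w ≠ 0 := by
  intro h
  have := A.coeff_mon w hw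
  rw [h, map_zero] at this
  have h2 := DFunLike.congr_fun this w
  simp at h2

/-- Bound on the lengths of words in the support. -/
theorem exists_bound (r : R) : ∃ D : ℕ, ∀ w, A.coeff r w ≠ 0 → w.length ≤ D := by
  refine ⟨(A.coeff r).support.sup List.length, fun w hw => ?_⟩
  exact Finset.le_sup (f := List.length) (by simpa using hw)

theorem sandwich (r : R) (u v : List (Fin 8)) :
    A.mon u * r * A.mon v = (A.coeff r).sum (fun w c => c • A.mon (u ++ w ++ v)) := by
  conv_lhs => rw [A.repr r]
  simp [Finsupp.sum, Finset.mul_sum, Finset.sum_mul, A.mon_append, mul_assoc]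

theorem sandwich_single (r : R) (u v w0 : List (Fin 8))
    (h : ∀ w, A.coeff r w ≠ 0 → u ++ w ++ v ∈ Lang → w = w0) :
    A.mon u * r * A.mon v = A.coeff r w0 • A.mon (u ++ w0 ++ v) := by
  rw [A.sandwich, Finsupp.sum, Finset.sum_eq_single w0]
  · intro w hw hne
    rw [A.mon_not_mem, smul_zero]
    exact fun h' => hne (h w (by simpa using hw) h')
  · intro h0
    rw [Finsupp.notMem_support_iff.1 h0, zero_smul]

theorem isolate {r : R} (hr : r ≠ 0) : ∃ u v w0, u ++ w0 ++ v ∈ Lang ∧ A.coeff r w0 ≠ 0 ∧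
    A.mon u * r * A.mon v = A.coeff r w0 • A.mon (u ++ w0 ++ v) := by
  have : A.coeff r ≠ 0 := fun h => hr (A.ext_coeff h)
  obtain ⟨w0, hw0⟩ := Finsupp.ne_iff.1 this
  have hw0 : A.coeff r w0 ≠ 0 := by simpa using hw0
  have hL : w0 ∈ Lang := by by_contra h; exact hw0 (A.coeff_not_mem r h)
  obtain ⟨D, hD⟩ := A.exists_bound r
  obtain ⟨u, v, h1, h2⟩ := Lang_isolate hL D
  exact ⟨u, v, w0, h1, hw0, A.sandwich_single r u v w0 (fun w hw h => h2 w (hD w hw) h)⟩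

omit A in
theorem Lang_irred {u v : List (Fin 8)} (hu : u ∈ Lang) (hv : v ∈ Lang) (n : ℕ) :
    ∃ w, n ≤ w.length ∧ u ++ w ++ v ∈ Lang := by
  obtain ⟨k1, h1⟩ := Lang_minimal hu
  obtain ⟨k2, h2⟩ := Lang_minimal hv
  obtain ⟨W, hW, hl⟩ := Lang_long (k1 + n + k2)
  obtain ⟨a, b, e1⟩ := h1 (W.take k1) (Lang_factor hW (List.take_prefix _ _).isInfix) (by simp; omega)
  obtain ⟨c, d, e2⟩ := h2 ((W.drop k1).drop n) (Lang_factor hW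
    ((List.drop_suffix _ _).trans (List.drop_suffix _ _)).isInfix) (by simp; omega)
  have e : W = a ++ (u ++ (b ++ (W.drop k1).take n ++ c) ++ v) ++ d := by
    conv_lhs => rw [← List.take_append_drop k1 W, ← List.take_append_drop n (W.drop k1), ← e1, ← e2]
    simp only [List.append_assoc]
  refine ⟨b ++ (W.drop k1).take n ++ c, ?_, Lang_factor hW ⟨a, d, e.symm⟩⟩
  simp; omega

theorem prime {f g : R} (hf : f ≠ 0) (hg : g ≠ 0) (n : ℕ) :
    ∃ y, n ≤ y.length ∧ f * A.mon y * g ≠ 0 := by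
  obtain ⟨u, v, w0, h1, h2, h3⟩ := A.isolate hf
  obtain ⟨u', v', w0', h1', h2', h3'⟩ := A.isolate hg
  obtain ⟨y, hy, hL⟩ := Lang_irred h1 h1' n
  refine ⟨v ++ y ++ u', by simp; omega, fun h => ?_⟩
  have : (A.mon u * f * A.mon v) * A.mon y * (A.mon u' * g * A.mon v') = 0 := by
    have : (A.mon u * f * A.mon v) * A.mon y * (A.mon u' * g * A.mon v')
      = A.mon u * (f * A.mon (v ++ y ++ u') * g) * A.mon v' := by
      simp only [A.mon_append, mul_assoc]
    rw [this, h]; simp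
  rw [h3, h3', smul_mul_assoc, ← A.mon_append, smul_mul_smul_comm, ← A.mon_append] at this
  exact smul_ne_zero (mul_ne_zero h2 h2') (A.mon_ne_zero hL) this

theorem zdiv (r : R) : ∃ s t, s ∈ Lang ∧ t ∈ Lang ∧ A.mon t * r * A.mon s = 0 := by
  obtain ⟨D, hD⟩ := A.exists_bound r
  obtain ⟨w0, hw0, hl⟩ := Lang_long (D+1)
  obtain ⟨u, v, h1, h2⟩ := Lang_isolate hw0 D
  refine ⟨v, u, Lang_factor h1 (List.suffix_append _ _).isInfix,
    Lang_factor h1 (by rw [List.append_assoc]; exact (List.prefix_append _ _).isInfix), ?_⟩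
  rw [A.sandwich_single r u v w0 (fun w hw h => h2 w (hD w hw) h)]
  have : A.coeff r w0 = 0 := by
    by_contra h; have := hD w0 h; omega
  rw [this, zero_smul]

/-- The pair of elements needed for the commutator trick. -/
theorem pair (x : R) {y : R} (hy : y ≠ 0) (k : ℕ) : ∃ a b, k ≤ a.length ∧ k ≤ b.length ∧
    A.mon b * x * A.mon a = 0 ∧ A.mon a * y * A.mon b ≠ 0 := by
  obtain ⟨s, t, hs, ht, h⟩ := A.zdiv x
  obtain ⟨a0, ha0, h1⟩ := A.prime (A.mon_ne_zero hs) hy k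
  obtain ⟨b0, hb0, h2⟩ := A.prime h1 (A.mon_ne_zero ht) k
  refine ⟨s ++ a0, b0 ++ t, by simp; omega, by simp; omega, ?_, ?_⟩
  · have : A.mon (b0 ++ t) * x * A.mon (s ++ a0) = A.mon b0 * (A.mon t * x * A.mon s) * A.mon a0 := by
      simp only [A.mon_append, mul_assoc]
    rw [this, h]; simp
  · convert h2 using 1
    simp only [A.mon_append, mul_assoc]

omit A in
/-- Powers of nonempty words eventually leave the language. -/
theorem Lang_power {w : List (Fin 8)} (hw : w ≠ []) : ∃ m, (List.replicate m w).flatten ∉ Lang := by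
  by_contra hcon
  push Not at hcon
  have hpos : 0 < w.length := List.length_pos_iff.2 hw
  obtain ⟨w0, hw0, hl0⟩ := Lang_long 0
  obtain ⟨u, v, h1, h2⟩ := Lang_isolate hw0 (w0.length + w.length)
  obtain ⟨k, hk⟩ := Lang_minimal h1
  obtain ⟨a, b, e⟩ := hk _ (hcon k) (by simp; nlinarith)
  set P := (List.replicate k w).flatten with hP
  have e1 : (List.replicate (k+1) w).flatten = P ++ w := by
    rw [List.replicate_succ']; simp [hP]
  have e2 : (List.replicate (k+1) w).flatten = w ++ P := by
    rw [List.replicate_succ]; simp [hP]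
  -- split `P = c ++ d` with `c = a ++ u`
  have e3 : P = (a ++ u) ++ (w0 ++ v ++ b) := by rw [← e]; simp
  obtain ⟨y, hy⟩ : (a ++ u) <+: w ++ P := by
    rw [← e2, e1, e3]; rw [List.append_assoc]; exact List.prefix_append _ _
  have hlen : y.length = w.length + (w0 ++ v ++ b).length := by
    have := congrArg List.length hy
    rw [e3] at this
    simp at this ⊢; omega
  obtain ⟨z, hz⟩ : (w0 ++ v ++ b) <:+ y := by
    apply List.suffix_of_suffix_length_le (l₃ := w ++ P)
    · rw [e3, ← List.append_assoc]; exact List.suffix_append _ _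
    · exact ⟨_, hy⟩
    · omega
  have hzl : z.length = w.length := by
    have := congrArg List.length hz
    rw [List.length_append] at this; omega
  have hmem : u ++ (z ++ w0) ++ v ∈ Lang := by
    refine Lang_factor (hcon (k+1)) ⟨a, b, ?_⟩
    rw [e2, ← hy, ← hz]; simp
  have h5 := h2 (z ++ w0) (by simp; omega) hmem
  have h6 := congrArg List.length h5
  rw [List.length_append] at h6; omega

theorem mon_replicate (m : ℕ) (w) : A.mon (List.replicate m w).flatten = A.mon w ^ m := by
  induction m with
  | zero => simp [A.mon_nil]
  | succ m ih => rw [List.replicate_succ, List.flatten_cons, A.mon_append, ih, pow_succ']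

theorem mon_nilp {w : List (Fin 8)} (hw : w ≠ []) : ∃ m, A.mon w ^ m = 0 := by
  obtain ⟨m, hm⟩ := Lang_power hw
  exact ⟨m, by rw [← A.mon_replicate, A.mon_not_mem _ hm]⟩

omit A in
theorem power_pre_eq {w w' : List (Fin 8)} (hl : w.length = w'.length) :
    ∀ (m : ℕ) (a : List (Fin 8)), w ++ a = a ++ w' → m * w.length ≤ a.length →
      (List.replicate m w).flatten <+: a := by
  intro m
  induction m with
  | zero => intro a _ _; simp
  | succ m ih =>
    intro a h hm
    rw [add_mul, one_mul] at hm
    obtain ⟨a', rfl⟩ : w <+: a :=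
      List.prefix_of_prefix_length_le ⟨_, h⟩ ⟨_, rfl⟩ (by omega)
    rw [List.append_assoc, List.append_cancel_left_eq] at h
    simp at hm
    obtain ⟨t, ht⟩ := ih a' h (by omega)
    rw [List.replicate_succ, List.flatten_cons]
    exact ⟨t, by simp [← ht]⟩

theorem mon_inj {u v : List (Fin 8)} (hu : u ∈ Lang) (h : A.coeff (A.mon v) u ≠ 0) : u = v := by
  by_cases hv : v ∈ Lang
  · rw [A.coeff_mon v hv, Finsupp.single_apply] at h
    by_contra hne
    simp [Ne.symm hne] at h
  · rw [A.mon_not_mem v hv] at h; simp at h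

/-- No intertwiners. -/
theorem no_center {x y : R} (k : ℕ) (hx : A.coeff x [] = 0)
    (h : ∀ a : List (Fin 8), k ≤ a.length → x * A.mon a = A.mon a * y) : x = 0 := by
  by_contra hne
  obtain ⟨u, v, w0, h1, h2, -⟩ := A.isolate hne
  have hw0L : w0 ∈ Lang := by by_contra h; exact h2 (A.coeff_not_mem x h)
  have hw0 : w0 ≠ [] := by rintro rfl; exact h2 hx
  obtain ⟨m, hm⟩ := Lang_power hw0
  obtain ⟨D, hD⟩ := A.exists_bound x
  obtain ⟨u, v, h1, h3⟩ := Lang_isolate hw0L D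
  obtain ⟨r, hr, hL⟩ := Lang_extend h1 (k + m * w0.length)
  have hL : u ++ w0 ++ (v ++ r) ∈ Lang := by simpa using hL
  have h4 := A.sandwich_single x u (v ++ r) w0 (fun w hw h => h3 w (hD w hw)
    (Lang_factor h ⟨[], r, by simp⟩))
  have h5 : A.mon u * x * A.mon (v ++ r) = (A.coeff y).sum (fun w c => c • A.mon (u ++ (v ++ r) ++ w)) := by
    rw [mul_assoc, h (v ++ r) (by simp; omega)]
    conv_lhs => rw [A.repr y]
    simp [Finsupp.sum, Finset.mul_sum, A.mon_append, mul_assoc]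
  rw [h4] at h5
  have h6 := congrArg (fun z => A.coeff z (u ++ w0 ++ (v ++ r))) h5
  simp only [map_smul, A.coeff_mon _ hL, Finsupp.smul_apply, Finsupp.single_eq_same, smul_eq_mul, mul_one,
    Finsupp.sum, map_sum, Finsupp.finsetSum_apply] at h6
  rw [h6] at h2
  obtain ⟨w, hw, hne⟩ := Finset.exists_ne_zero_of_sum_ne_zero h2
  have h7 := A.mon_inj hL (right_ne_zero_of_mul hne)
  simp only [List.append_assoc, List.append_cancel_left_eq] at h7
  have h8 : w0 ++ (v ++ r) = (v ++ r) ++ w := by simpa using h7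
  have hl : w0.length = w.length := by
    have := congrArg List.length h8
    simp at this; omega
  have h9 := power_pre_eq hl m _ h8 (by simp; omega)
  exact hm (Lang_factor hL (h9.isInfix.trans (List.suffix_append _ _).isInfix))

end WordAlg
end HJI


set_option linter.unusedSimpArgs false
set_option linter.unusedVariables false

namespace HJI
open scoped commutatorElement

section un
variable {M : Type} [Ring M]

open Classical in
/-- The unipotent unit `1 + P` when `P ^ 2 = 0` (and `1` otherwise). -/
noncomputable def un (P : M) : Mˣ :=
  if h : P * P = 0 then
    ⟨1 + P, 1 - P, by rw [add_mul, mul_sub, mul_sub, h]; simp,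
      by rw [sub_mul, mul_add, mul_add, h]; simp⟩
  else 1

theorem un_val {P : M} (h : P * P = 0) : (un P : M) = 1 + P := by
  rw [un, dif_pos h]

theorem un_inv_val {P : M} (h : P * P = 0) : ((un P)⁻¹ : Mˣ) = (1 - P : M) := by
  rw [un, dif_pos h]; rfl

theorem un_zero : un (0 : M) = 1 := by
  ext; rw [un_val (by simp)]; simp

theorem un_add {P Q : M} (hP : P * P = 0) (hQ : Q * Q = 0) (hPQ : P * Q = 0) (hQP : Q * P = 0) :
    un (P + Q) = un P * un Q := by
  ext
  rw [un_val, Units.val_mul, un_val hP, un_val hQ]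
  · rw [add_mul, mul_add, mul_add, hPQ]; simp; abel
  · simp [add_mul, mul_add, hP, hQ, hPQ, hQP]

theorem un_neg {P : M} (hP : P * P = 0) : un (-P) = (un P)⁻¹ := by
  ext
  rw [un_val (by simp [hP]), un_inv_val hP]; abel

theorem un_inj {P Q : M} (hP : P * P = 0) (hQ : Q * Q = 0) (h : un P = un Q) : P = Q := by
  have := congrArg Units.val h
  rw [un_val hP, un_val hQ] at this
  exact add_left_cancel this

theorem conj_un (g : Mˣ) {P : M} (hP : P * P = 0) :
    g * un P * g⁻¹ = un (g * P * (g⁻¹ : Mˣ)) := by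
  ext
  rw [un_val, Units.val_mul, Units.val_mul, un_val hP]
  · simp [mul_add, add_mul]
  · have : (g * P * (g⁻¹ : Mˣ) * (g * P * (g⁻¹ : Mˣ)) : M) =
      g * P * ((g⁻¹ : Mˣ) * g) * P * (g⁻¹ : Mˣ) := by simp only [mul_assoc]
    rw [this, Units.inv_mul, mul_one, mul_assoc (g : M), hP]; simp

theorem comm_un {P Q : M} (hP : P * P = 0) (hQ : Q * Q = 0) (hQP : Q * P = 0) :
    ⁅un P, un Q⁆ = un (P * Q) := by
  have hPPx : ∀ x, P * (P * x) = 0 := fun x => by rw [← mul_assoc, hP, zero_mul]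
  have hQPx : ∀ x, Q * (P * x) = 0 := fun x => by rw [← mul_assoc, hQP, zero_mul]
  ext
  rw [commutatorElement_def, un_val (by simp [mul_assoc, hQPx]), Units.val_mul, Units.val_mul,
    Units.val_mul, un_inv_val hP, un_inv_val hQ, un_val hP, un_val hQ]
  simp [add_mul, mul_add, sub_mul, mul_sub, mul_assoc, hP, hQ, hQP]
  abel

end un

section el
open Matrix
variable {R : Type} [Ring R]

/-- Elementary matrices. -/
noncomputable def el (i j : Fin 3) (r : R) : (Matrix (Fin 3) (Fin 3) R)ˣ := un (single i j r)

theorem sq0 {i j : Fin 3} (h : i ≠ j) (r s : R) : single i j r * single i j s = 0 :=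
  Matrix.single_mul_single_of_ne _ _ _ _ h.symm _

theorem el_val {i j : Fin 3} (h : i ≠ j) (r : R) : (el i j r).val = 1 + single i j r :=
  un_val (sq0 h r r)

theorem el_zero {i j : Fin 3} : el i j (0 : R) = 1 := by
  rw [el, single_zero, un_zero]

theorem el_add {i j : Fin 3} (h : i ≠ j) (r s : R) : el i j (r + s) = el i j r * el i j s := by
  rw [el, single_add, un_add (sq0 h _ _) (sq0 h _ _) (sq0 h _ _) (sq0 h _ _)]; rfl

theorem el_neg {i j : Fin 3} (h : i ≠ j) (r : R) : el i j (-r) = (el i j r)⁻¹ := by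
  rw [eq_inv_iff_mul_eq_one, ← el_add h]; simp [el_zero]

theorem el_nsmul {i j : Fin 3} (h : i ≠ j) (r : R) (n : ℕ) : el i j (n • r) = el i j r ^ n := by
  induction n with
  | zero => simp [el_zero]
  | succ n ih => rw [succ_nsmul, el_add h, ih, pow_succ]

theorem el_smul {p : ℕ} [NeZero p] [Algebra (ZMod p) R] {i j : Fin 3} (h : i ≠ j) (r : R) (c : ZMod p) :
    el i j (c • r) = el i j r ^ c.val := by
  rw [← el_nsmul h]
  congr 1
  conv_lhs => rw [← ZMod.natCast_zmod_val c]
  rw [Nat.cast_smul_eq_nsmul]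

theorem el_pow_p {p : ℕ} [Algebra (ZMod p) R] {i j : Fin 3} (h : i ≠ j) (r : R) :
    el i j r ^ p = 1 := by
  rw [← el_nsmul h, ← Nat.cast_smul_eq_nsmul (ZMod p)]
  simp [el_zero]

theorem el_inj {i j : Fin 3} (h : i ≠ j) {r s : R} (he : el i j r = el i j s) : r = s := by
  have := congrArg (fun m => m i j) (un_inj (sq0 h r r) (sq0 h s s) he)
  simpa using this

theorem el_comm {i j k : Fin 3} (hij : i ≠ j) (hik : i ≠ k) (hkj : k ≠ j) (a b : R) :
    ⁅el i k a, el k j b⁆ = el i j (a * b) := by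
  rw [el, el, comm_un (sq0 hik _ _) (sq0 hkj _ _) (single_mul_single_of_ne _ _ _ _ hij.symm _),
    single_mul_single_same]
  rfl

theorem el_comm_one {i j k l : Fin 3} (hij : i ≠ j) (hkl : k ≠ l) (hjk : j ≠ k) (hli : l ≠ i) (a b : R) :
    ⁅el i j a, el k l b⁆ = 1 := by
  rw [el, el, comm_un (sq0 hij _ _) (sq0 hkl _ _) (single_mul_single_of_ne _ _ _ _ hli _),
    single_mul_single_of_ne _ _ _ _ hjk, un_zero]

/-- Opposite commutator decomposition. -/
theorem el_opp {i j : Fin 3} (hij : i ≠ j) (w x a s : R)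
    (ha1 : (1 - w * x) * a = 1) (ha2 : a * (1 - w * x) = 1)
    (hs1 : (1 - x * w) * s = 1) (hs2 : s * (1 - x * w) = 1) :
    ∃ d : (Matrix (Fin 3) (Fin 3) R)ˣ,
      (d : Matrix (Fin 3) (Fin 3) R) = diagonal (Function.update (Function.update 1 i a) j (1 - x * w)) ∧
      ((d⁻¹ : (Matrix (Fin 3) (Fin 3) R)ˣ) : Matrix (Fin 3) (Fin 3) R) =
        diagonal (Function.update (Function.update 1 i (1 - w * x)) j s) ∧
      ⁅el i j w, el j i x⁆ = el i j (-(w * x * w * s)) * d * el j i (s * x * w * x) := by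
  have hd1 : diagonal (Function.update (Function.update (1 : Fin 3 → R) i a) j (1 - x * w)) *
      diagonal (Function.update (Function.update (1 : Fin 3 → R) i (1 - w * x)) j s) = 1 := by
    rw [diagonal_mul_diagonal, ← diagonal_one]
    congr 1
    ext k
    by_cases hj : k = j
    · subst hj; simp [hs1]
    · by_cases hi : k = i
      · subst hi; simp [hj, ha2]
      · simp [hi, hj]
  have hd2 : diagonal (Function.update (Function.update (1 : Fin 3 → R) i (1 - w * x)) j s) *
      diagonal (Function.update (Function.update (1 : Fin 3 → R) i a) j (1 - x * w)) = 1 := by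
    rw [diagonal_mul_diagonal, ← diagonal_one]
    congr 1
    ext k
    by_cases hj : k = j
    · subst hj; simp [hs2]
    · by_cases hi : k = i
      · subst hi; simp [hj, ha1]
      · simp [hi, hj]
  refine ⟨⟨_, _, hd1, hd2⟩, rfl, rfl, ?_⟩
  have hd : diagonal (Function.update (Function.update (1 : Fin 3 → R) i a) j (1 - x * w)) =
      1 + single i i (a - 1) - single j j (x * w) := by
    ext k l
    by_cases hkl : k = l
    · subst hkl
      by_cases hj : k = j
      · subst hj; simp [hij]
      · by_cases hi : k = i
        · subst hi; simp [hj, Ne.symm hj]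
        · simp [hi, hj, Ne.symm hj, Ne.symm hi]
    · rw [diagonal_apply_ne _ hkl]
      simp only [Matrix.sub_apply, Matrix.add_apply, Matrix.one_apply_ne hkl, Matrix.single_apply]
      have h1 : ¬ (i = k ∧ i = l) := fun h => hkl (h.1.symm.trans h.2)
      have h2 : ¬ (j = k ∧ j = l) := fun h => hkl (h.1.symm.trans h.2)
      simp [h1, h2]
  have hji := hij.symm
  rw [commutatorElement_def, ← el_neg hij, ← el_neg hji]
  ext1
  simp only [Units.val_mul, el_val hij, el_val hji, hd]
  have hws : w * s = a * w := by
    have : (1 - w * x) * w = w * (1 - x * w) := by noncomm_ring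
    calc w * s = a * (1 - w * x) * w * s := by rw [ha2, one_mul]
      _ = a * w * ((1 - x * w) * s) := by rw [mul_assoc a, this]; simp only [mul_assoc]
      _ = a * w := by rw [hs1, mul_one]
  have e1 : s = 1 + x * w * s := by
    have := hs1; rw [sub_mul, one_mul, sub_eq_iff_eq_add] at this; exact this
  have e2 : s = 1 + s * (x * w) := by
    have := hs2; rw [mul_sub, mul_one, sub_eq_iff_eq_add] at this; exact this
  have e3 : a = 1 + w * x * a := by
    have := ha1; rw [sub_mul, one_mul, sub_eq_iff_eq_add] at this; exact this
  have e4 : a = 1 + a * (w * x) := by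
    have := ha2; rw [mul_sub, mul_one, sub_eq_iff_eq_add] at this; exact this
  have key1 : -(w * x * w * s) + w * x * w * s * (x * w) = -(w * x * w) := by
    have : -(w * x * w * s) + w * x * w * s * (x * w) = - (w * x * w * (s * (1 - x * w))) := by
      noncomm_ring
    rw [this, hs2, mul_one]
  have key2 : s * x * w * x - x * w * (s * x * w * x) = x * w * x := by
    have : s * x * w * x - x * w * (s * x * w * x) = ((1 - x * w) * s) * (x * w * x) := by noncomm_ring
    rw [this, hs1, one_mul]
  have key3 : (a - 1) - w * x * w * s * (s * x * w * x) + w * x * w * s * (x * w) * (s * x * w * x)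
      = w * x + w * x * w * x := by
    have : (a - 1) - w * x * w * s * (s * x * w * x) + w * x * w * s * (x * w) * (s * x * w * x)
      = (a - 1) - w * x * w * (s * (1 - x * w)) * (s * x * w * x) := by noncomm_ring
    rw [this, hs2, mul_one]
    have : w * x * w * (s * x * w * x) = w * x * (a * (w * x)) * (w * x) := by
      rw [show w * x * w * (s * x * w * x) = w * x * (w * s) * x * w * x by simp only [mul_assoc], hws]
      simp only [mul_assoc]
    rw [this]
    have h5 : a * (w * x) = a - 1 := by rw [eq_sub_iff_add_eq, add_comm]; exact e4.symm
    rw [h5]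
    have h6 : w * x * a = a - 1 := by rw [eq_sub_iff_add_eq, add_comm]; exact e3.symm
    rw [mul_sub, h6, sub_mul, sub_mul, h5]
    noncomm_ring
  have z1 : ∀ y z : R, single i j y * single i j z = 0 := fun y z => sq0 hij y z
  have z2 : ∀ y z : R, single j i y * single j i z = 0 := fun y z => sq0 hji y z
  have z3 : ∀ y z : R, single i i y * single j j z = 0 := fun y z =>
    single_mul_single_of_ne _ _ _ _ hij _
  have z4 : ∀ y z : R, single j j y * single i i z = 0 := fun y z =>
    single_mul_single_of_ne _ _ _ _ hji _
  have z5 : ∀ y z : R, single i j y * single i i z = 0 := fun y z =>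
    single_mul_single_of_ne _ _ _ _ hji _
  have z6 : ∀ y z : R, single i i y * single j i z = 0 := fun y z =>
    single_mul_single_of_ne _ _ _ _ hij _
  have z7 : ∀ y z : R, single j i y * single j j z = 0 := fun y z =>
    single_mul_single_of_ne _ _ _ _ hij _
  have z8 : ∀ y z : R, single j j y * single i j z = 0 := fun y z =>
    single_mul_single_of_ne _ _ _ _ hji _
  have lhs : (1 + single i j w) * (1 + single j i x) * (1 + single i j (-w)) * (1 + single j i (-x)) =
      1 + single i i (w * x + w * x * w * x) + single i j (-(w * x * w)) + single j i (x * w * x)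
        + single j j (-(x * w)) := by
    simp only [mul_add, add_mul, single_mul_single_same, mul_one, one_mul, z1, z2, z3, z4, z5, z6, z7, z8,
      add_zero, zero_add, zero_mul, mul_neg, neg_mul, neg_neg, single_add, mul_assoc]
    simp only [← singleAddMonoidHom_apply, map_neg]
    abel
  have rhs : (1 + single i j (-(w * x * w * s))) * (1 + single i i (a - 1) - single j j (x * w)) *
      (1 + single j i (s * x * w * x)) =
      1 + single i i ((a - 1) - w * x * w * s * (s * x * w * x) + w * x * w * s * (x * w) * (s * x * w * x))
       + single i j (-(w * x * w * s) + w * x * w * s * (x * w))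
       + single j i (s * x * w * x - x * w * (s * x * w * x)) + single j j (-(x * w)) := by
    simp only [mul_add, add_mul, mul_sub, sub_mul, single_mul_single_same, mul_one, one_mul,
      z1, z2, z3, z4, z5, z6, z7, z8,
      add_zero, zero_add, zero_mul, sub_zero, mul_neg, neg_mul, neg_neg, single_add, mul_assoc]
    simp only [← singleAddMonoidHom_apply, map_neg, map_sub, map_add]
    abel
  rw [lhs, rhs, key1, key2, key3]

end el
end HJI


set_option linter.unusedSimpArgs false
set_option linter.unusedVariables false

namespace HJI
open scoped commutatorElement
namespace WordAlg
open Matrix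

/-- Shorthand for three by three matrices. -/
abbrev M3 (R : Type) := Matrix (Fin 3) (Fin 3) R

variable {p : ℕ} [Fact p.Prime] {R : Type} [Ring R] [Algebra (ZMod p) R] (A : WordAlg p R)

/-- The length filtration. -/
def I (n : ℕ) : Submodule (ZMod p) R := Submodule.span (ZMod p) (A.mon '' {w | n ≤ w.length})

theorem mon_mem_I {n : ℕ} {w} (h : n ≤ w.length) : A.mon w ∈ A.I n :=
  Submodule.subset_span ⟨w, h, rfl⟩

theorem I_anti {m n : ℕ} (h : m ≤ n) {r : R} (hr : r ∈ A.I n) : r ∈ A.I m :=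
  Submodule.span_mono (Set.image_mono (fun w hw => le_trans h hw)) hr

theorem I_mul {m n : ℕ} {r s : R} (hr : r ∈ A.I m) (hs : s ∈ A.I n) : r * s ∈ A.I (m + n) := by
  have := Submodule.mul_mem_mul hr hs
  rw [I, I, Submodule.span_mul_span] at this
  refine Submodule.span_mono ?_ this
  rintro _ ⟨_, ⟨u, hu, rfl⟩, _, ⟨v, hv, rfl⟩, rfl⟩
  refine ⟨u ++ v, ?_, A.mon_append u v⟩
  simp at hu hv ⊢; omega

theorem mem_I_zero (r : R) : r ∈ A.I 0 := by
  rw [A.repr r]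
  exact Submodule.sum_mem _ (fun w _ => Submodule.smul_mem _ _ (A.mon_mem_I (by simp)))

theorem I_mul_left {n : ℕ} (s : R) {r : R} (hr : r ∈ A.I n) : s * r ∈ A.I n := by
  simpa using A.I_mul (A.mem_I_zero s) hr

theorem I_mul_right {n : ℕ} (s : R) {r : R} (hr : r ∈ A.I n) : r * s ∈ A.I n := by
  simpa using A.I_mul hr (A.mem_I_zero s)

theorem I_coeff {n : ℕ} {r : R} (hr : r ∈ A.I n) {w} (hw : w.length < n) : A.coeff r w = 0 := by
  induction hr using Submodule.span_induction with
  | mem x hx =>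
    obtain ⟨v, hv, rfl⟩ := hx
    by_contra h
    by_cases hL : w ∈ Lang
    · have := A.mon_inj hL h
      subst this; simp at hv; omega
    · exact h (A.coeff_not_mem _ hL)
  | zero => simp
  | add x y _ _ hx hy => simp [hx, hy]
  | smul a x _ hx => simp [hx]

/-- Matrices with entries in the filtration. -/
def mI (n : ℕ) : Submodule (ZMod p) (M3 R) where
  carrier := {m | ∀ i j, m i j ∈ A.I n}
  add_mem' h1 h2 i j := (A.I n).add_mem (h1 i j) (h2 i j)
  zero_mem' i j := (A.I n).zero_mem
  smul_mem' c _ h i j := (A.I n).smul_mem c (h i j)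

theorem mI_mul {m n : ℕ} {x y : M3 R} (hx : x ∈ A.mI m) (hy : y ∈ A.mI n) : x * y ∈ A.mI (m + n) := by
  intro i j
  rw [mul_apply]
  exact Submodule.sum_mem _ (fun k _ => A.I_mul (hx i k) (hy k j))

theorem mem_mI_zero (x : M3 R) : x ∈ A.mI 0 := fun _ _ => A.mem_I_zero _

theorem mI_mul_left {n : ℕ} (x : M3 R) {y : M3 R} (hy : y ∈ A.mI n) : x * y ∈ A.mI n := by
  simpa using A.mI_mul (A.mem_mI_zero x) hy

theorem mI_mul_right {n : ℕ} (x : M3 R) {y : M3 R} (hy : y ∈ A.mI n) : y * x ∈ A.mI n := by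
  simpa using A.mI_mul hy (A.mem_mI_zero x)

theorem single_mem_mI {n : ℕ} {r : R} (hr : r ∈ A.I n) (i j : Fin 3) : single i j r ∈ A.mI n := by
  intro a b
  rw [Matrix.single_apply]
  split_ifs
  · exact hr
  · exact Submodule.zero_mem _

/-- Congruence subgroups. -/
def Gam (n : ℕ) : Subgroup (M3 R)ˣ where
  carrier := {g | (g : M3 R) - 1 ∈ A.mI n}
  mul_mem' {a b} ha hb := by
    simp only [Set.mem_setOf_eq] at *
    have : ((a * b : (M3 R)ˣ) : M3 R) - 1 = a * (b - 1 : M3 R) + (a - 1 : M3 R) := by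
      rw [Units.val_mul]; noncomm_ring
    rw [this]
    exact Submodule.add_mem _ (A.mI_mul_left _ hb) ha
  one_mem' := by simp
  inv_mem' {a} ha := by
    simp only [Set.mem_setOf_eq] at *
    have : ((a⁻¹ : (M3 R)ˣ) : M3 R) - 1 = - ((a⁻¹ : (M3 R)ˣ) * (a - 1 : M3 R)) := by
      rw [mul_sub, Units.inv_mul]; simp
    rw [this]
    exact Submodule.neg_mem _ (A.mI_mul_left _ ha)

theorem mem_Gam {n : ℕ} {g : (M3 R)ˣ} : g ∈ A.Gam n ↔ (g : M3 R) - 1 ∈ A.mI n := Iff.rfl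

instance Gam_normal (n : ℕ) : (A.Gam n).Normal where
  conj_mem a ha g := by
    rw [mem_Gam] at *
    have : ((g * a * g⁻¹ : (M3 R)ˣ) : M3 R) - 1 = g * (a - 1 : M3 R) * (g⁻¹ : (M3 R)ˣ) := by
      rw [Units.val_mul, Units.val_mul, mul_sub, sub_mul, mul_one, Units.mul_inv]
    rw [this]
    exact A.mI_mul_right _ (A.mI_mul_left _ ha)

theorem el_mem_Gam {n : ℕ} {r : R} (hr : r ∈ A.I n) {i j : Fin 3} (h : i ≠ j) : el i j r ∈ A.Gam n := by
  rw [mem_Gam, el_val h, add_sub_cancel_left]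
  exact A.single_mem_mI hr i j

/-- Generators. -/
def gens : Set (M3 R)ˣ := {g | ∃ i j x, i ≠ j ∧ g = el i j (A.mon [x])}

theorem gens_finite : A.gens.Finite := by
  have : A.gens ⊆ Set.range (fun t : Fin 3 × Fin 3 × Fin 8 => el t.1 t.2.1 (A.mon [t.2.2])) := by
    rintro _ ⟨i, j, x, _, rfl⟩
    exact ⟨(i, j, x), rfl⟩
  exact (Set.finite_range _).subset this

/-- The group. -/
def De : Subgroup (M3 R)ˣ := Subgroup.closure A.gens

theorem third (i j : Fin 3) : ∃ k : Fin 3, i ≠ k ∧ k ≠ j := by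
  revert i j; decide

theorem comm_mem {G : Type} [Group G] {N : Subgroup G} {a b : G} (ha : a ∈ N) (h : b * a⁻¹ * b⁻¹ ∈ N) :
    ⁅a, b⁆ ∈ N := by
  have : ⁅a, b⁆ = a * (b * a⁻¹ * b⁻¹) := by simp [commutatorElement_def, mul_assoc]
  rw [this]; exact N.mul_mem ha h

theorem comm_mem_N {G : Type} [Group G] {N : Subgroup G} {a b : G} (ha : a ∈ N)
    (h : ∀ n ∈ N, b * n * b⁻¹ ∈ N) : ⁅a, b⁆ ∈ N := comm_mem ha (h _ (N.inv_mem ha))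

theorem comm_mem_N' {G : Type} [Group G] {N : Subgroup G} {a b : G} (ha : a ∈ N)
    (h : ∀ n ∈ N, b * n * b⁻¹ ∈ N) : ⁅b, a⁆ ∈ N := by
  rw [commutatorElement_def]; exact N.mul_mem (h _ ha) (N.inv_mem ha)

theorem el_mem_De {i j : Fin 3} (h : i ≠ j) {w} (hw : w ≠ []) : el i j (A.mon w) ∈ A.De := by
  induction w generalizing i j with
  | nil => exact absurd rfl hw
  | cons x w ih =>
    cases w with
    | nil => exact Subgroup.subset_closure ⟨i, j, x, h, rfl⟩
    | cons y w =>
      obtain ⟨k, hik, hkj⟩ := third i j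
      have : A.mon (x :: y :: w) = A.mon [x] * A.mon (y :: w) := by rw [← A.mon_append]; rfl
      rw [this, ← el_comm h hik hkj]
      exact comm_mem (Subgroup.subset_closure ⟨i, k, x, hik, rfl⟩)
        (A.De.mul_mem (A.De.mul_mem (ih hkj (by simp)) (A.De.inv_mem
          (Subgroup.subset_closure ⟨i, k, x, hik, rfl⟩))) (A.De.inv_mem (ih hkj (by simp))))

theorem De_le_Gam : A.De ≤ A.Gam 1 := by
  rw [De, Subgroup.closure_le]
  rintro _ ⟨i, j, x, h, rfl⟩
  exact A.el_mem_Gam (A.mon_mem_I (by simp)) h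

theorem el_mem_of_I {N : Subgroup (M3 R)ˣ} {n : ℕ} {i j : Fin 3} (h : i ≠ j)
    (hN : ∀ w : List (Fin 8), n ≤ w.length → el i j (A.mon w) ∈ N) {r : R} (hr : r ∈ A.I n) : el i j r ∈ N := by
  have : NeZero p := ⟨(Fact.out : p.Prime).ne_zero⟩
  induction hr using Submodule.span_induction with
  | mem x hx => obtain ⟨w, hw, rfl⟩ := hx; exact hN w hw
  | zero => rw [el_zero]; exact N.one_mem
  | add x y _ _ hx hy => rw [el_add h]; exact N.mul_mem hx hy
  | smul a x _ hx => rw [el_smul h]; exact N.pow_mem hx _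

end WordAlg
end HJI


set_option linter.unusedSimpArgs false
set_option linter.unusedVariables false

namespace HJI
open scoped commutatorElement
namespace WordAlg
open Matrix

variable {p : ℕ} [Fact p.Prime] {R : Type} [Ring R] [Algebra (ZMod p) R] (A : WordAlg p R)

theorem nz (A : WordAlg p R) : (1 : R) ≠ 0 := by
  rw [← A.mon_nil]; exact A.mon_ne_zero nil_mem_Lang

/-- Off-diagonal case of the extraction of elementary matrices. -/
theorem extract_off {N : Subgroup (M3 R)ˣ} {k0 : ℕ}
    (hnorm : ∀ i j : Fin 3, i ≠ j → ∀ w : List (Fin 8), k0 ≤ w.length → ∀ n ∈ N,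
      el i j (A.mon w) * n * (el i j (A.mon w))⁻¹ ∈ N)
    {g : (M3 R)ˣ} (hg : g ∈ N) {j k : Fin 3} (hjk : j ≠ k)
    (hne : ((g⁻¹ : (M3 R)ˣ) : M3 R) j k ≠ 0) : ∃ i j : Fin 3, i ≠ j ∧ ∃ r : R, r ≠ 0 ∧ el i j r ∈ N := by
  have hkj := hjk.symm
  obtain ⟨a, b, ha, hb, hab1, hab2⟩ := A.pair ((g : M3 R) j k) hne k0
  set r := A.mon a * ((g⁻¹ : (M3 R)ˣ) : M3 R) j k * A.mon b with hr
  set P : M3 R := single k j (A.mon a) with hP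
  set Q : M3 R := single k j (A.mon b) with hQ
  have hPP : P * P = 0 := sq0 hkj _ _
  have hQQ : Q * Q = 0 := sq0 hkj _ _
  have hPQ : P * Q = 0 := sq0 hkj _ _
  have hQP : Q * P = 0 := sq0 hkj _ _
  set M' : M3 R := g * P * (g⁻¹ : (M3 R)ˣ) with hM'
  have hMM2 : M' * M' = 0 := by
    have : M' * M' = g * P * ((g⁻¹ : (M3 R)ˣ) * g) * P * (g⁻¹ : (M3 R)ˣ) := by
      simp only [hM', mul_assoc]
    rw [this, Units.inv_mul, mul_one, mul_assoc (g : M3 R), hPP]; simp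
  have hQM' : Q * M' = 0 := by
    have : Q * M' = (Q * g * P) * (g⁻¹ : (M3 R)ˣ) := by simp only [hM', mul_assoc]
    rw [this, hQ, hP, single_mul_mul_single, hab1]; simp
  have h1 : ⁅g, un P⁆ ∈ N := comm_mem_N hg (hnorm k j hkj a ha)
  have h1' : ⁅g, un P⁆ = un M' * (un P)⁻¹ := by
    rw [commutatorElement_def, conj_un g hPP]
  have hc : un P * un Q = un Q * un P := by
    rw [← un_add hPP hQQ hPQ hQP, ← un_add hQQ hPP hQP hPQ, add_comm]
  have h2 : ⁅⁅g, un P⁆, un Q⁆ ∈ N := comm_mem_N h1 (hnorm k j hkj b hb)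
  have h2' : ⁅⁅g, un P⁆, un Q⁆ = un (M' * Q) := by
    rw [← comm_un hMM2 hQQ hQM', h1']
    have : (un P)⁻¹ * un Q * un P = un Q := by rw [mul_assoc, ← hc]; simp
    calc ⁅un M' * (un P)⁻¹, un Q⁆ = un M' * ((un P)⁻¹ * un Q * un P) * (un M')⁻¹ * (un Q)⁻¹ := by
          simp [commutatorElement_def, mul_assoc]
      _ = _ := by rw [this]; rfl
  rw [h2'] at h2
  have hT : M' * Q = g * single k j r := by
    have : M' * Q = g * (P * (g⁻¹ : (M3 R)ˣ) * Q) := by simp only [hM', mul_assoc]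
    rw [this, hP, hQ, single_mul_mul_single]
  have hTT : (M' * Q) * (M' * Q) = 0 := by
    rw [mul_assoc, ← mul_assoc Q, hQM']; simp
  obtain ⟨l, hl⟩ : ∃ l, (g : M3 R) l k * r ≠ 0 := by
    by_contra hcon
    push Not at hcon
    apply hab2
    have h0 : (g : M3 R) * single k k r = 0 := by
      ext x y
      by_cases hy : y = k
      · subst hy; simp [hcon]
      · simp [hy]
    have h3 : single k k r = 0 := by
      have := congrArg (fun m => (g⁻¹ : (M3 R)ˣ).val * m) h0
      simpa [← mul_assoc] using this
    have := congrFun (congrFun h3 k) k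
    simpa using this
  obtain ⟨k', hk'l, hk'j⟩ := third l j
  obtain ⟨c, hc, hcne⟩ := A.prime A.nz hl k0
  rw [one_mul] at hcne
  set C : M3 R := single k' l (A.mon c) with hC
  have hCC : C * C = 0 := sq0 hk'l.symm _ _
  have hTC : (M' * Q) * C = 0 := by
    rw [hT, mul_assoc, hC, Matrix.single_mul_single_of_ne _ _ _ _ hk'j.symm, mul_zero]
  refine ⟨k', j, hk'j, _, hcne, ?_⟩
  have h3 : ⁅un C, un (M' * Q)⁆ ∈ N := comm_mem_N' h2 (hnorm k' l hk'l.symm c hc)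
  rw [comm_un hCC hTT hTC, hT, ← mul_assoc, hC, single_mul_mul_single] at h3
  rw [← mul_assoc]; exact h3

theorem extract {N : Subgroup (M3 R)ˣ} {k0 : ℕ} (hN : N ≤ A.De) (hbot : N ≠ ⊥)
    (hnorm : ∀ i j : Fin 3, i ≠ j → ∀ w : List (Fin 8), k0 ≤ w.length → ∀ n ∈ N,
      el i j (A.mon w) * n * (el i j (A.mon w))⁻¹ ∈ N) :
    ∃ i j : Fin 3, i ≠ j ∧ ∃ r : R, r ≠ 0 ∧ el i j r ∈ N := by
  obtain ⟨⟨h, hh⟩, hne'⟩ := Subgroup.ne_bot_iff_exists_ne_one.1 hbot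
  have hne : h ≠ 1 := fun h => hne' (Subtype.ext h)
  by_cases hoff : ∃ j k : Fin 3, j ≠ k ∧ (h : M3 R) j k ≠ 0
  · obtain ⟨j, k, hjk, hjk0⟩ := hoff
    exact A.extract_off hnorm (g := h⁻¹) (N.inv_mem hh) hjk (by simpa using hjk0)
  push Not at hoff
  have hdiag : (h : M3 R) = diagonal (fun i => (h : M3 R) i i) := by
    ext a b
    by_cases hab : a = b
    · subst hab; simp
    · rw [hoff a b hab, diagonal_apply_ne _ hab]
  set z : Fin 3 → R := fun i => (h : M3 R) i i with hz
  set y : M3 R := ((h⁻¹ : (M3 R)ˣ) : M3 R) with hy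
  have hyh : ∀ a b, y a b * z b = (1 : M3 R) a b := by
    intro a b
    have : y * h = 1 := by simp [hy]
    rw [← this, hdiag, mul_diagonal]
  have hhy : ∀ a b, z a * y a b = (1 : M3 R) a b := by
    intro a b
    have : (h : M3 R) * y = 1 := by simp [hy]
    rw [← this, hdiag, diagonal_mul]
  have hydiag : y = diagonal (fun i => y i i) := by
    ext a b
    by_cases hab : a = b
    · subst hab; simp
    · rw [diagonal_apply_ne _ hab]
      have h1 := hhy a b
      rw [one_apply_ne hab] at h1
      have h2 := hyh a a
      rw [one_apply_eq] at h2
      calc y a b = (y a a * z a) * y a b := by rw [h2, one_mul]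
        _ = 0 := by rw [mul_assoc, h1, mul_zero]
  by_cases hcom : ∀ i j : Fin 3, i ≠ j → ∀ w : List (Fin 8), k0 ≤ w.length →
      z i * A.mon w = A.mon w * z j
  · exfalso
    apply hne
    have hz1 : ∀ i, z i = 1 := by
      intro i
      obtain ⟨j, hij, -⟩ := third i i
      have hI := A.De_le_Gam (hN hh)
      rw [mem_Gam] at hI
      have h0 : A.coeff (z i - 1) [] = 0 := by
        apply A.I_coeff (n := 1) _ (by simp)
        have := hI i i
        simpa using this
      have := A.no_center (x := z i - 1) (y := z j - 1) k0 h0 (fun a ha => by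
        rw [sub_mul, mul_sub, hcom i j hij a ha]; simp)
      exact sub_eq_zero.1 this
    ext1
    rw [hdiag, Units.val_one, ← diagonal_one]
    congr 1; ext i; exact hz1 i
  · push Not at hcom
    obtain ⟨i, j, hij, w, hw, hcne⟩ := hcom
    refine ⟨i, j, hij, z i * A.mon w * y j j + - A.mon w, ?_, ?_⟩
    · intro h0
      apply hcne
      have h1 : z i * A.mon w * y j j = A.mon w := by
        rw [← sub_eq_add_neg, sub_eq_zero] at h0; exact h0
      have h2 := hyh j j
      rw [one_apply_eq] at h2
      calc z i * A.mon w = z i * A.mon w * (y j j * z j) := by rw [h2, mul_one]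
        _ = _ := by rw [← mul_assoc, h1]
    · have h1 : ⁅h, el i j (A.mon w)⁆ ∈ N := comm_mem_N hh (hnorm i j hij w hw)
      rw [commutatorElement_def, el, conj_un h (sq0 hij _ _)] at h1
      have h2 : (h : M3 R) * single i j (A.mon w) * y = single i j (z i * A.mon w * y j j) := by
        rw [hdiag, hydiag]
        ext a b
        rw [mul_diagonal, diagonal_mul, Matrix.single_apply, Matrix.single_apply]
        split_ifs with h
        · obtain ⟨rfl, rfl⟩ := h; simp
        · simp
      rw [← hy, h2] at h1
      rw [el_add hij, el_neg hij]; exact h1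

/-- Main extraction lemma. -/
theorem lemE {N : Subgroup (M3 R)ˣ} {k0 : ℕ} (hN : N ≤ A.De) (hbot : N ≠ ⊥)
    (hnorm : ∀ i j : Fin 3, i ≠ j → ∀ w : List (Fin 8), k0 ≤ w.length → ∀ n ∈ N,
      el i j (A.mon w) * n * (el i j (A.mon w))⁻¹ ∈ N) :
    ∃ K : ℕ, ∀ i j : Fin 3, i ≠ j → ∀ w : List (Fin 8), K ≤ w.length → el i j (A.mon w) ∈ N := by
  obtain ⟨i, j, hij, r, hr, hrN⟩ := A.extract hN hbot hnorm
  obtain ⟨k, hik, hkj⟩ := third i j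
  let Good : ℕ → Fin 3 → Fin 3 → Prop := fun K a b =>
    ∀ u v : List (Fin 8), K ≤ u.length → K ≤ v.length → el a b (A.mon u * r * A.mon v) ∈ N
  have s1 : ∀ K a b c, a ≠ b → b ≠ c → a ≠ c → Good K a b → Good (K + k0) a c := by
    intro K a b c hab hbc hac hG u v hu hv
    have h1 := hG u (v.take K) (by omega) (by simp; omega)
    have h2 := comm_mem_N h1 (hnorm b c hbc (v.drop K) (by simp; omega))
    rw [el_comm hac hab hbc, mul_assoc, ← A.mon_append, List.take_append_drop] at h2
    exact h2
  have s2 : ∀ K a b c, a ≠ b → b ≠ c → a ≠ c → Good K a b → Good (K + k0) c b := by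
    intro K a b c hab hbc hac hG u v hu hv
    have h1 := hG (u.drop k0) v (by simp; omega) (by omega)
    have h2 := comm_mem_N' h1 (hnorm c a hac.symm (u.take k0) (by simp; omega))
    rw [el_comm hbc.symm hac.symm hab, ← mul_assoc, ← mul_assoc, ← A.mon_append,
      List.take_append_drop] at h2
    exact h2
  have g0 : Good k0 j k := by
    intro u v hu hv
    have h1 := comm_mem_N hrN (hnorm j k hkj.symm v hv)
    rw [el_comm hik hij hkj.symm] at h1
    have h2 := comm_mem_N' h1 (hnorm j i hij.symm u hu)
    rw [el_comm hkj.symm hij.symm hik, ← mul_assoc] at h2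
    exact h2
  have gmono : ∀ K K' a b, K ≤ K' → Good K a b → Good K' a b := fun K K' a b h hG u v hu hv =>
    hG u v (h.trans hu) (h.trans hv)
  have g1 := s1 _ _ _ i hkj.symm hik.symm hij.symm g0
  have g2 := s2 _ _ _ k hij.symm hik hkj.symm g1
  have g3 := s1 _ _ _ j hik.symm hij hkj g2
  have g4 := s2 _ _ _ i hkj hij.symm hik.symm g3
  have g5 := s1 _ _ _ k hij hkj.symm hik g4
  set K := k0 + k0 + k0 + k0 + k0 + k0 with hK
  have hall : ∀ a b : Fin 3, a ≠ b → Good K a b := by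
    intro a b hab
    have hcov : (a = j ∧ b = k) ∨ (a = j ∧ b = i) ∨ (a = k ∧ b = i) ∨ (a = k ∧ b = j) ∨ (a = i ∧ b = j) ∨
        (a = i ∧ b = k) := by
      clear_value Good
      clear g0 g1 g2 g3 g4 g5 hrN gmono s1 s2 Good
      revert i j k a b; decide
    rcases hcov with ⟨rfl, rfl⟩ | ⟨rfl, rfl⟩ | ⟨rfl, rfl⟩ | ⟨rfl, rfl⟩ | ⟨rfl, rfl⟩ | ⟨rfl, rfl⟩
    · exact gmono _ _ _ _ (by omega) g0
    · exact gmono _ _ _ _ (by omega) g1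
    · exact gmono _ _ _ _ (by omega) g2
    · exact gmono _ _ _ _ (by omega) g3
    · exact gmono _ _ _ _ (by omega) g4
    · exact gmono _ _ _ _ (by omega) g5
  obtain ⟨u1, v1, w0, hL, hc, hiso⟩ := A.isolate hr
  obtain ⟨k1, hk1⟩ := Lang_minimal hL
  have : NeZero p := ⟨(Fact.out : p.Prime).ne_zero⟩
  refine ⟨K + k1 + K, fun a b hab w hw => ?_⟩
  by_cases hwL : w ∈ Lang
  · obtain ⟨s, t, e⟩ := hk1 ((w.drop K).take k1) (Lang_factor hwL
      ((List.take_prefix _ _).isInfix.trans (List.drop_suffix _ _).isInfix)) (by simp; omega)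
    have e2 : w = (w.take K ++ s) ++ (u1 ++ w0 ++ v1) ++ (t ++ (w.drop K).drop k1) := by
      conv_lhs => rw [← List.take_append_drop K w, ← List.take_append_drop k1 (w.drop K), ← e]
      simp only [List.append_assoc]
    have h1 := hall a b hab ((w.take K ++ s) ++ u1) (v1 ++ (t ++ (w.drop K).drop k1))
      (by simp; omega) (by simp; omega)
    have h2 : A.mon ((w.take K ++ s) ++ u1) * r * A.mon (v1 ++ (t ++ (w.drop K).drop k1)) =
        A.coeff r w0 • A.mon w := by
      rw [A.mon_append _ u1, A.mon_append v1]
      calc _ = A.mon (w.take K ++ s) * (A.mon u1 * r * A.mon v1) * A.mon (t ++ (w.drop K).drop k1) := by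
            simp only [mul_assoc]
        _ = _ := by
            rw [hiso]
            conv_rhs => rw [e2]
            rw [A.mon_append _ (t ++ (w.drop K).drop k1), A.mon_append _ (u1 ++ w0 ++ v1)]
            simp
    rw [h2] at h1
    have h3 : A.mon w = (A.coeff r w0)⁻¹ • (A.coeff r w0 • A.mon w) := by
      rw [smul_smul, inv_mul_cancel₀ hc, one_smul]
    rw [h3, el_smul hab]
    exact N.pow_mem h1 _
  · rw [A.mon_not_mem w hwL, el_zero]; exact N.one_mem

end WordAlg
end HJI


set_option linter.unusedSimpArgs false
set_option linter.unusedVariables false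

namespace HJI
open scoped commutatorElement

section central
variable {D : Type} [Group D] {N : Subgroup D} [N.Normal]

theorem mem_iff_mk (g : D) : g ∈ N ↔ QuotientGroup.mk' N g = 1 := by
  rw [QuotientGroup.mk'_apply, QuotientGroup.eq_one_iff]

theorem comm_closure {S : Set D} (hS : Subgroup.closure S = ⊤) {z : D} (h : ∀ s ∈ S, ⁅z, s⁆ ∈ N) (g : D) :
    ⁅z, g⁆ ∈ N := by
  have hg : g ∈ Subgroup.closure S := by rw [hS]; trivial
  simp only [mem_iff_mk, map_commutatorElement, commutatorElement_eq_one_iff_commute] at h ⊢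
  induction hg using Subgroup.closure_induction with
  | mem x hx => exact h x hx
  | one => simp
  | mul x y _ _ hx hy => rw [map_mul]; exact hx.mul_right hy
  | inv x _ hx => rw [map_inv]; exact hx.inv_right

theorem comm_perturb {n1 d n2 t : D} (h1 : n1 ∈ N) (h2 : n2 ∈ N) (h : ⁅d, t⁆ ∈ N) :
    ⁅n1 * d * n2, t⁆ ∈ N := by
  rw [mem_iff_mk] at *
  rw [map_commutatorElement] at *
  rw [map_mul, map_mul, h1, h2]; simpa using h

theorem comm_pow {z s : D} (h : ⁅z, ⁅z, s⁆⁆ ∈ N) {n : ℕ} (hz : z ^ n = 1) : ⁅z, s⁆ ^ n ∈ N := by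
  rw [mem_iff_mk] at *
  rw [map_commutatorElement, commutatorElement_eq_one_iff_commute, map_commutatorElement] at h
  rw [map_pow, map_commutatorElement]
  have hz' : (QuotientGroup.mk' N z) ^ n = 1 := by rw [← map_pow, hz, map_one]
  generalize QuotientGroup.mk' N z = a at *
  generalize QuotientGroup.mk' N s = b at *
  have : ∀ m : ℕ, ⁅a, b⁆ ^ m = ⁅a ^ m, b⁆ := by
    intro m
    induction m with
    | zero => simp
    | succ m ih =>
      have hc : a * ⁅a ^ m, b⁆ = ⁅a ^ m, b⁆ * a := by rw [← ih]; exact (h.pow_right m).eq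
      rw [pow_succ, ih]
      have : ⁅a ^ (m+1), b⁆ = (a * ⁅a ^ m, b⁆) * b * a⁻¹ * b⁻¹ := by
        rw [pow_succ']; simp [commutatorElement_def, mul_assoc]
      rw [this, hc]; simp [commutatorElement_def, mul_assoc]
  rw [this, hz']; simp

theorem lemC {Z : Set D} (hZ : Z.Finite) (hc : ∀ z ∈ Z, ∀ g, ⁅z, g⁆ ∈ N)
    (ht : ∀ z ∈ Z, ∃ n : ℕ, 0 < n ∧ z ^ n ∈ N) :
    (N ⊔ Subgroup.closure Z).Normal ∧ ((N ⊔ Subgroup.closure Z).FiniteIndex → N.FiniteIndex) := by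
  let π := QuotientGroup.mk' N
  have hπ : Function.Surjective π := QuotientGroup.mk'_surjective N
  set C : Subgroup (D ⧸ N) := Subgroup.closure (π '' Z) with hC
  have hcomap : C.comap π = N ⊔ Subgroup.closure Z := by
    rw [hC, ← MonoidHom.map_closure, Subgroup.comap_map_eq, QuotientGroup.ker_mk', sup_comm]
  have hcen : C ≤ Subgroup.center (D ⧸ N) := by
    rw [hC, Subgroup.closure_le]
    rintro _ ⟨z, hz, rfl⟩
    rw [SetLike.mem_coe, Subgroup.mem_center_iff]
    intro g
    obtain ⟨g, rfl⟩ := hπ g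
    have := hc z hz g
    rw [mem_iff_mk, map_commutatorElement, commutatorElement_eq_one_iff_commute] at this
    exact this.symm.eq
  have hCn : C.Normal := ⟨fun n hn g => by
    have := Subgroup.mem_center_iff.1 (hcen hn) g
    rw [this, mul_assoc, mul_inv_cancel, mul_one]; exact hn⟩
  refine ⟨by rw [← hcomap]; infer_instance, fun hf => ?_⟩
  have hcomm : ∀ a b : C, a * b = b * a := fun a b => by
    ext; exact (Subgroup.mem_center_iff.1 (hcen b.2) a)
  have : Finite (π '' Z) := hZ.image π
  have hfg : Group.FG C := Group.closure_finite_fg (π '' Z)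
  let _ : CommGroup C := { (inferInstance : Group C) with mul_comm := hcomm }
  have htor : IsMulTorsion C := by
    rintro ⟨c, hcC⟩
    rw [← Submonoid.isOfFinOrder_coe]
    show IsOfFinOrder c
    induction hcC using Subgroup.closure_induction with
    | mem x hx =>
      obtain ⟨z, hz, rfl⟩ := hx
      obtain ⟨n, hn, hzn⟩ := ht z hz
      rw [isOfFinOrder_iff_pow_eq_one]
      exact ⟨n, hn, by rw [← map_pow]; exact (mem_iff_mk _).1 hzn⟩
    | one => exact IsOfFinOrder.one
    | mul x y hx hy h1 h2 =>
      exact Commute.isOfFinOrder_mul (Subgroup.mem_center_iff.1 (hcen hy) x) h1 h2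
    | inv x _ h => exact h.inv
  have hfin : Finite C := CommGroup.finite_of_fg_isMulTorsion C htor
  have hidx : C.index ≠ 0 := by
    rw [← Subgroup.index_comap_of_surjective C hπ, hcomap]; exact hf.index_ne_zero
  constructor
  rw [Subgroup.index_eq_card, ← Subgroup.card_mul_index C]
  exact mul_ne_zero (Nat.card_pos).ne' hidx

end central

namespace WordAlg
open Matrix

variable {p : ℕ} [Fact p.Prime] {R : Type} [Ring R] [Algebra (ZMod p) R] (A : WordAlg p R)

/-- `N` contains all elementary matrices on long words. -/
def HN (N : Subgroup A.De) (k : ℕ) : Prop :=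
  ∀ d : A.De, ∀ i j : Fin 3, i ≠ j → ∀ w : List (Fin 8), k ≤ w.length → d.1 = el i j (A.mon w) → d ∈ N

theorem HN_I {N : Subgroup A.De} {k : ℕ} (hk : 1 ≤ k) (h : A.HN N k) {i j : Fin 3} (hij : i ≠ j)
    {r : R} (hr : r ∈ A.I k) : ∃ hm : el i j r ∈ A.De, (⟨el i j r, hm⟩ : A.De) ∈ N := by
  have : el i j r ∈ N.map A.De.subtype := by
    refine A.el_mem_of_I hij (fun w hw => ?_) hr
    have hne : w ≠ [] := by rintro rfl; simp at hw; omega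
    exact ⟨⟨_, A.el_mem_De hij hne⟩, h _ i j hij w hw rfl, rfl⟩
  obtain ⟨⟨d, hd⟩, hdN, he⟩ := this
  simp at he
  subst he
  exact ⟨hd, hdN⟩

theorem HN_I' {N : Subgroup A.De} {k : ℕ} (hk : 1 ≤ k) (h : A.HN N k) {i j : Fin 3} (hij : i ≠ j)
    {r : R} (hr : r ∈ A.I k) {d : A.De} (hd : d.1 = el i j r) : d ∈ N := by
  obtain ⟨hm, h1⟩ := A.HN_I hk h hij hr
  have : d = ⟨el i j r, hm⟩ := Subtype.ext hd
  rw [this]; exact h1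

/-- Inverse of `1 - mon`. -/
theorem geom {w : List (Fin 8)} (hw : w ≠ []) : ∃ a : R, (1 - A.mon w) * a = 1 ∧ a * (1 - A.mon w) = 1 ∧
    a - 1 = A.mon w * a := by
  obtain ⟨m, hm⟩ := A.mon_nilp hw
  refine ⟨∑ i ∈ Finset.range m, A.mon w ^ i, ?_, ?_, ?_⟩
  · rw [mul_neg_geom_sum, hm, sub_zero]
  · rw [geom_sum_mul_neg, hm, sub_zero]
  · have := mul_neg_geom_sum (A.mon w) m
    rw [hm, sub_zero, sub_mul, one_mul] at this
    rw [sub_eq_iff_eq_add] at this ⊢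
    rw [add_comm]; exact this

theorem double_comm_opp {N : Subgroup A.De} [N.Normal] {k : ℕ} (hk : 1 ≤ k) (h : A.HN N (k + 1))
    {i j : Fin 3} (hij : i ≠ j) {w : List (Fin 8)} (hw : w.length = k) (x : Fin 8) {z s t : A.De}
    (hz : z.1 = el i j (A.mon w)) (hs : s.1 = el j i (A.mon [x]))
    {a b : Fin 3} (hab : a ≠ b) {y : R} (ht : t.1 = el a b y) : ⁅⁅z, s⁆, t⁆ ∈ N := by
  have e1 : A.mon (w ++ [x]) = A.mon w * A.mon [x] := A.mon_append _ _
  have e2 : A.mon ([x] ++ w) = A.mon [x] * A.mon w := A.mon_append _ _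
  obtain ⟨α, ha1, ha2, ha3⟩ := A.geom (w := w ++ [x]) (by simp)
  obtain ⟨σ, hs1, hs2, hs3⟩ := A.geom (w := [x] ++ w) (by simp)
  have hu : A.mon (w ++ [x]) ∈ A.I (k+1) := A.mon_mem_I (by simp [hw])
  have hv : A.mon ([x] ++ w) ∈ A.I (k+1) := A.mon_mem_I (by simp [hw])
  rw [e1] at ha1 ha2 ha3 hu
  rw [e2] at hs1 hs2 hs3 hv
  obtain ⟨d, hd1, hd2, hd3⟩ := el_opp hij (A.mon w) (A.mon [x]) α σ ha1 ha2 hs1 hs2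
  obtain ⟨hm1, hN1⟩ := A.HN_I (by omega) h hij (r := -(A.mon w * A.mon [x] * A.mon w * σ))
    (Submodule.neg_mem _ (A.I_mul_right _ (A.I_mul_right _ hu)))
  obtain ⟨hm2, hN2⟩ := A.HN_I (by omega) h hij.symm (r := σ * A.mon [x] * A.mon w * A.mon [x])
    (A.I_mul_right _ (by rw [mul_assoc]; exact A.I_mul_left _ hv))
  have hcD : ⁅el i j (A.mon w), el j i (A.mon [x])⁆ ∈ A.De := by
    rw [← hz, ← hs]; exact (⁅z, s⁆ : A.De).2
  have hdD : d ∈ A.De := by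
    have : d = (el i j (-(A.mon w * A.mon [x] * A.mon w * σ)))⁻¹ * ⁅el i j (A.mon w), el j i (A.mon [x])⁆ *
      (el j i (σ * A.mon [x] * A.mon w * A.mon [x]))⁻¹ := by rw [hd3]; simp [mul_assoc]
    rw [this]
    exact A.De.mul_mem (A.De.mul_mem (A.De.inv_mem hm1) hcD) (A.De.inv_mem hm2)
  have heq : ⁅z, s⁆ = (⟨_, hm1⟩ : A.De) * ⟨d, hdD⟩ * ⟨_, hm2⟩ := by
    apply Subtype.ext
    show ⁅z.1, s.1⁆ = _
    rw [hz, hs, hd3]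
    rfl
  rw [heq]
  apply comm_perturb hN1 hN2
  set δ := Function.update (Function.update (1 : Fin 3 → R) i α) j (1 - A.mon [x] * A.mon w) with hδ
  set ε := Function.update (Function.update (1 : Fin 3 → R) i (1 - A.mon w * A.mon [x])) j σ with hε
  have hδI : δ a - 1 ∈ A.I (k+1) := by
    by_cases h1 : a = j
    · subst h1; simp [hδ]; exact hv
    · by_cases h2 : a = i
      · subst h2; simp [hδ, h1]; rw [ha3]; exact A.I_mul_right _ hu
      · simp [hδ, h1, h2]
  have hεI : ε b - 1 ∈ A.I (k+1) := by
    by_cases h1 : b = j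
    · subst h1; simp [hε]; rw [hs3]; exact A.I_mul_right _ hv
    · by_cases h2 : b = i
      · subst h2; simp [hε, h1]; exact hu
      · simp [hε, h1, h2]
  refine A.HN_I' (by omega) h hab (r := δ a * y * ε b + - y) ?_ ?_
  · have : δ a * y * ε b + - y = (δ a - 1) * (y * ε b) + y * (ε b - 1) := by noncomm_ring
    rw [this]
    exact Submodule.add_mem _ (A.I_mul_right _ hδI) (A.I_mul_left _ hεI)
  · show ⁅d, t.1⁆ = _
    rw [ht, commutatorElement_def, el, conj_un d (sq0 hab _ _), hd1, hd2]
    have h2 : diagonal δ * single a b y * diagonal ε = single a b (δ a * y * ε b) := by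
      ext i' j'
      rw [mul_diagonal, diagonal_mul, Matrix.single_apply, Matrix.single_apply]
      split_ifs with h
      · obtain ⟨rfl, rfl⟩ := h; simp
      · simp
    rw [h2, el_add hab, el_neg hab]; rfl

theorem double_comm {N : Subgroup A.De} [N.Normal] {k : ℕ} (hk : 1 ≤ k) (h : A.HN N (k + 1))
    {i j : Fin 3} (hij : i ≠ j) {w : List (Fin 8)} (hw : w.length = k) {z s t : A.De}
    (hz : z.1 = el i j (A.mon w)) (hs : s.1 ∈ A.gens) (ht : t.1 ∈ A.gens) : ⁅⁅z, s⁆, t⁆ ∈ N := by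
  obtain ⟨a, b, y, hab, ht⟩ := ht
  obtain ⟨c, d, x, hcd, hs⟩ := hs
  by_cases h1 : j = c
  · subst h1
    by_cases h2 : i = d
    · subst h2
      exact A.double_comm_opp hk h hij hw x hz hs hab ht
    · apply comm_mem_N _ (fun n hn => Subgroup.Normal.conj_mem inferInstance n hn t)
      refine h _ i d h2 (w ++ [x]) (by simp [hw]) ?_
      show ⁅z.1, s.1⁆ = _
      rw [hz, hs, el_comm h2 hij hcd, A.mon_append]
  · apply comm_mem_N _ (fun n hn => Subgroup.Normal.conj_mem inferInstance n hn t)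
    by_cases h2 : d = i
    · subst h2
      rw [← inv_mem_iff, commutatorElement_inv]
      refine h _ c j (Ne.symm h1) ([x] ++ w) (by simp [hw]) ?_
      show ⁅s.1, z.1⁆ = _
      rw [hz, hs, el_comm (Ne.symm h1) hcd hij, A.mon_append]
    · have : ⁅z, s⁆ = 1 := by
        apply Subtype.ext
        show ⁅z.1, s.1⁆ = 1
        rw [hz, hs, el_comm_one hij hcd h1 h2]
      rw [this]; exact N.one_mem

theorem De_gen : Subgroup.closure {d : A.De | d.1 ∈ A.gens} = ⊤ :=
  Subgroup.closure_closure_coe_preimage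

theorem lemF (k : ℕ) : ∀ (N : Subgroup A.De), N.Normal → A.HN N (k + 1) → N.FiniteIndex := by
  induction k with
  | zero =>
    intro N _ h
    have : N = ⊤ := by
      rw [eq_top_iff, ← A.De_gen, Subgroup.closure_le]
      rintro d ⟨i, j, x, hij, hd⟩
      exact h d i j hij [x] (by simp) hd
    rw [this]; infer_instance
  | succ k ih =>
    intro N hN h
    set Z2 : Set A.De := {d | ∃ i j : Fin 3, i ≠ j ∧ ∃ w : List (Fin 8), w.length = k + 1 ∧ d.1 = el i j (A.mon w)}
      with hZ2
    set S : Set A.De := {d : A.De | d.1 ∈ A.gens} with hS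
    set Z1 : Set A.De := Set.image2 (fun z s => ⁅z, s⁆) Z2 S with hZ1
    have fS : S.Finite := A.gens_finite.preimage (Subtype.val_injective.injOn)
    have fZ2 : Z2.Finite := by
      have f1 : (Set.image (fun t : (Fin 3 × Fin 3) × List (Fin 8) => (el t.1.1 t.1.2 (A.mon t.2) : (M3 R)ˣ))
        (Set.univ ×ˢ {l | l.length = k + 1})).Finite :=
        (Set.finite_univ.prod (List.finite_length_eq (Fin 8) (k+1))).image _
      refine (f1.preimage (Subtype.val_injective.injOn (s := _))).subset ?_
      rintro d ⟨i, j, hij, w, hw, hd⟩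
      exact ⟨((i, j), w), ⟨trivial, hw⟩, hd.symm⟩
    have fZ1 : Z1.Finite := fZ2.image2 _ fS
    have hp0 : 0 < p := (Fact.out : p.Prime).pos
    have zpow : ∀ z ∈ Z2, z ^ p = 1 := by
      rintro z ⟨i, j, hij, w, hw, hz⟩
      apply Subtype.ext
      rw [SubgroupClass.coe_pow, hz, el_pow_p hij]; rfl
    have c1 : ∀ z ∈ Z1, ∀ g, ⁅z, g⁆ ∈ N := by
      rintro _ ⟨z, ⟨i, j, hij, w, hw, hz⟩, s, hs, rfl⟩ g
      exact comm_closure A.De_gen (fun t ht => A.double_comm (by omega) h hij hw hz hs ht) g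
    obtain ⟨n1, f1⟩ := lemC fZ1 c1 (by
      rintro _ ⟨z, hz, s, hs, rfl⟩
      refine ⟨p, hp0, comm_pow ?_ (zpow z hz)⟩
      rw [← inv_mem_iff, commutatorElement_inv]
      exact c1 ⁅z, s⁆ (Set.mem_image2_of_mem hz hs) z)
    obtain ⟨n2, f2⟩ := lemC (N := N ⊔ Subgroup.closure Z1) fZ2 (by
      intro z hz g
      exact comm_closure A.De_gen (fun s hs => Subgroup.mem_sup_right
        (Subgroup.subset_closure (Set.mem_image2_of_mem hz hs))) g) (by
      intro z hz
      exact ⟨p, hp0, by rw [zpow z hz]; exact Subgroup.one_mem _⟩)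
    apply f1
    apply f2
    apply ih _ n2
    intro d i j hij w hw hd
    by_cases hw' : w.length = k + 1
    · exact Subgroup.mem_sup_right (Subgroup.subset_closure ⟨i, j, hij, w, hw', hd⟩)
    · exact Subgroup.mem_sup_left (Subgroup.mem_sup_left (h d i j hij w (by omega) hd))

end WordAlg
end HJI


set_option linter.unusedSimpArgs false
set_option linter.unusedVariables false

namespace HJI
open scoped commutatorElement
namespace WordAlg
open Matrix

variable {p : ℕ} [Fact p.Prime] {R : Type} [Ring R] [Algebra (ZMod p) R] (A : WordAlg p R)

theorem De_fg : Group.FG A.De := by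
  have : Finite A.gens := A.gens_finite
  exact Group.closure_finite_fg A.gens

theorem De_infinite : Infinite A.De := by
  have hw : ∀ n : ℕ, ∃ w ∈ Lang, w.length = n + 1 := by
    intro n
    obtain ⟨w, hw, hl⟩ := Lang_long (n+1)
    exact ⟨w.take (n+1), Lang_factor hw (List.take_prefix _ _).isInfix, by simp; omega⟩
  choose f hf hl using hw
  have h01 : (0 : Fin 3) ≠ 1 := by decide
  refine Infinite.of_injective (fun n : ℕ => (⟨el 0 1 (A.mon (f n)), A.el_mem_De h01 (by
    intro h; have := hl n; rw [h] at this; simp at this)⟩ : A.De)) ?_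
  intro m n hmn
  have h1 := el_inj h01 (congrArg Subtype.val hmn)
  have h2 := A.mon_inj (u := f m) (v := f n) (hf m) (by rw [← h1, A.coeff_mon _ (hf m)]; simp)
  have h3 := hl m
  rw [h2, hl n] at h3
  omega

theorem De_rf : ResiduallyFinite A.De := by
  intro g hg
  have h1 : (g.1 : M3 R) - 1 ≠ 0 := by
    intro h
    apply hg
    apply Subtype.ext
    ext1
    exact sub_eq_zero.1 h
  obtain ⟨i, j, hij⟩ : ∃ i j, ((g.1 : M3 R) - 1) i j ≠ 0 := by
    by_contra hcon
    push Not at hcon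
    exact h1 (by ext i j; exact hcon i j)
  have h2 : A.coeff (((g.1 : M3 R) - 1) i j) ≠ 0 := fun h => hij (A.ext_coeff h)
  obtain ⟨w, hw⟩ := Finsupp.ne_iff.1 h2
  refine ⟨(A.Gam (w.length + 1)).subgroupOf A.De, inferInstance, ?_, ?_⟩
  · apply A.lemF w.length _ inferInstance
    intro d i j hij v hv hd
    rw [Subgroup.mem_subgroupOf, hd]
    exact A.el_mem_Gam (A.mon_mem_I hv) hij
  · intro h
    rw [Subgroup.mem_subgroupOf, mem_Gam] at h
    exact hw (A.I_coeff (h i j) (by omega))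

/-- Extraction inside `De`. -/
theorem lemE' {N : Subgroup A.De} (hbot : N ≠ ⊥) {k0 : ℕ}
    (hnorm : ∀ d : A.De, ∀ i j : Fin 3, i ≠ j → ∀ w : List (Fin 8), k0 ≤ w.length → d.1 = el i j (A.mon w) →
      ∀ n ∈ N, d * n * d⁻¹ ∈ N) : ∃ K, A.HN N K := by
  obtain ⟨K, hK⟩ := A.lemE (N := N.map A.De.subtype) (k0 := k0 + 1) (by
      rintro _ ⟨d, _, rfl⟩; exact d.2) (by
      intro h
      exact hbot ((Subgroup.map_eq_bot_iff_of_injective N A.De.subtype_injective).1 h)) (by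
      rintro i j hij w hw _ ⟨d, hd, rfl⟩
      have hne : w ≠ [] := by rintro rfl; simp at hw
      exact ⟨_, hnorm ⟨_, A.el_mem_De hij hne⟩ i j hij w (by omega) rfl d hd, rfl⟩)
  refine ⟨K, fun d i j hij w hw hd => ?_⟩
  obtain ⟨d', hd', he⟩ := hK i j hij w hw
  have : d = d' := Subtype.ext (by rw [hd, ← he]; rfl)
  rw [this]; exact hd'

theorem HN_mono {N : Subgroup A.De} {k l : ℕ} (h : k ≤ l) (hN : A.HN N k) : A.HN N l :=
  fun d i j hij w hw hd => hN d i j hij w (h.trans hw) hd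

theorem De_hji : HereditarilyJustInfinite A.De := by
  refine ⟨A.De_rf, fun H hH => ?_⟩
  have hinf := A.De_infinite
  have hHinf : ∀ L : Subgroup A.De, L.FiniteIndex → Infinite L := by
    intro L hL
    by_contra hcon
    rw [not_infinite_iff_finite] at hcon
    have h1 := Subgroup.card_mul_index L
    rw [Nat.card_eq_zero_of_infinite (α := A.De)] at h1
    rcases Nat.mul_eq_zero.1 h1 with h | h
    · exact Nat.card_pos.ne' h
    · exact hL.index_ne_zero h
  refine ⟨hHinf H hH, fun N hN hbot => ?_⟩
  set C := H.normalCore with hC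
  have hCf : C.FiniteIndex := inferInstance
  have hCbot : C ≠ ⊥ := by
    intro h
    have := hHinf C hCf
    rw [h] at this
    exact not_finite (⊥ : Subgroup A.De)
  obtain ⟨k, hk⟩ := A.lemE' hCbot (k0 := 0) (fun d i j _ w _ _ n hn => Subgroup.Normal.conj_mem inferInstance n hn d)
  set N' : Subgroup A.De := N.map H.subtype with hN'
  have hN'H : ∀ h ∈ H, ∀ n ∈ N', h * n * h⁻¹ ∈ N' := by
    rintro h hh _ ⟨n, hn, rfl⟩
    exact ⟨_, hN.conj_mem n hn ⟨h, hh⟩, rfl⟩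
  have hN'bot : N' ≠ ⊥ := by
    intro h
    exact hbot ((Subgroup.map_eq_bot_iff_of_injective N H.subtype_injective).1 h)
  have key : ∀ g : A.De, ∃ K, A.HN (N'.map (MulAut.conj g).toMonoidHom) K := by
    intro g
    apply A.lemE' (k0 := k)
    · intro h
      exact hN'bot ((Subgroup.map_eq_bot_iff_of_injective N' (MulAut.conj g).injective).1 h)
    · rintro d i j hij w hw hd _ ⟨n, hn, rfl⟩
      have hdC : d ∈ C := hk d i j hij w hw hd
      have hdC' : g⁻¹ * d * g ∈ C := by
        have := Subgroup.Normal.conj_mem (inferInstance : C.Normal) d hdC g⁻¹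
        simpa using this
      refine ⟨(g⁻¹ * d * g) * n * (g⁻¹ * d * g)⁻¹, hN'H _ (H.normalCore_le hdC') n hn, ?_⟩
      simp [mul_assoc]
  choose K hK using key
  have hfq : Finite (A.De ⧸ H) := Subgroup.finite_quotient_of_finiteIndex
  obtain ⟨B, hB⟩ := Finite.exists_le (fun q : A.De ⧸ H => K q.out)
  have hcore : A.HN N'.normalCore (B + 1) := by
    intro d i j hij w hw hd b
    set q : A.De ⧸ H := QuotientGroup.mk b⁻¹ with hq
    have h1 : d ∈ N'.map (MulAut.conj q.out).toMonoidHom :=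
      hK q.out d i j hij w (by have := hB q; omega) hd
    obtain ⟨n, hn, he⟩ := h1
    have h2 : b * q.out ∈ H := by
      have : (QuotientGroup.mk b⁻¹ : A.De ⧸ H) = QuotientGroup.mk q.out := by
        rw [QuotientGroup.out_eq']
      rw [QuotientGroup.eq] at this
      simpa using this
    have h3 := hN'H _ h2 n hn
    have he' : q.out * n * q.out⁻¹ = d := by simpa using he
    rw [← he']
    convert h3 using 1
    simp [mul_assoc]
  have hf := A.lemF B _ inferInstance hcore
  have hf' : N'.FiniteIndex := Subgroup.finiteIndex_of_le N'.normalCore_le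
  have hNe : N = N'.subgroupOf H := by
    rw [hN', Subgroup.subgroupOf, Subgroup.comap_map_eq_self_of_injective H.subtype_injective]
  rw [hNe]; infer_instance

end WordAlg
end HJI


set_option linter.unusedSimpArgs false
set_option linter.unusedVariables false

namespace HJI

theorem ipow_zero {R : Type} [Ring R] (I : Ideal R) : I ^ 0 = ⊤ := by simp
theorem ipow_succ {R : Type} [Ring R] (I : Ideal R) (n : ℕ) : I ^ (n + 1) = I ^ n * I := rfl
theorem ipow_one {R : Type} [Ring R] (I : Ideal R) : I ^ 1 = I := Submodule.pow_one I
theorem ipow_two {R : Type} [Ring R] (I : Ideal R) : I ^ 2 = I * I := by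
  rw [ipow_succ, ipow_one]
theorem ipow_add_two {R : Type} [Ring R] (I : Ideal R) (n : ℕ) {a b : R} (ha : a ∈ I ^ n)
    (hb : b ∈ I ^ 2) : a * b ∈ I ^ (n + 1 + 1) := by
  rw [ipow_two] at hb
  induction hb using Submodule.mul_induction_on' with
  | mem_mul_mem c hc d hd =>
    rw [← mul_assoc, ipow_succ, ipow_succ]
    exact Ideal.mul_mem_mul (Ideal.mul_mem_mul ha hc) hd
  | add x y _ _ hx hy => rw [mul_add]; exact Submodule.add_mem _ hx hy

theorem lower_gen {k B V : Type} [Field k] [Ring B] [Algebra k B] [AddCommGroup V] [Module k V]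
    (P Q : Ideal B) (F : B →ₗ[k] V) (hF0 : ∀ x ∈ Q, F x = 0)
    (hF : ∀ v : V, ∃ x ∈ P, F x = v)
    [Module.Finite k (↥P ⧸ (Submodule.comap P.subtype Q))] :
    Module.finrank k V ≤ Module.finrank k (↥P ⧸ (Submodule.comap P.subtype Q)) := by
  let F1 : ↥P →ₗ[k] V :=
    { toFun := fun x => F x.1
      map_add' := fun a b => F.map_add _ _
      map_smul' := fun c a => F.map_smul _ _ }
  let F2 : (↥P ⧸ (Submodule.comap P.subtype Q)) →ₗ[k] V :=
    { toFun := fun q => Quotient.liftOn' q F1 (fun a b hab => by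
        rw [Submodule.quotientRel_def] at hab
        have := hF0 _ hab
        have h2 : F a.1 - F b.1 = 0 := by rw [← map_sub]; exact this
        exact sub_eq_zero.1 h2)
      map_add' := fun a b => by
        obtain ⟨a, rfl⟩ := Submodule.Quotient.mk_surjective _ a
        obtain ⟨b, rfl⟩ := Submodule.Quotient.mk_surjective _ b
        exact F1.map_add a b
      map_smul' := fun c a => by
        obtain ⟨a, rfl⟩ := Submodule.Quotient.mk_surjective _ a
        exact F1.map_smul c a }
  have hsurj : Function.Surjective F2 := by
    intro v
    obtain ⟨x, hx, h⟩ := hF v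
    exact ⟨Submodule.Quotient.mk ⟨x, hx⟩, h⟩
  exact LinearMap.finrank_le_finrank_of_surjective hsurj

section aug
variable {k : Type} [Field k] {G : Type} [Group G]

/-- The augmentation map. -/
noncomputable def aug (k G : Type) [Field k] [Group G] : MonoidAlgebra k G →ₐ[k] k :=
  (MonoidAlgebra.lift k k G) 1

/-- `g - 1` in the group algebra. -/
noncomputable def dif (k : Type) [Field k] {G : Type} [Group G] (g : G) : MonoidAlgebra k G :=
  MonoidAlgebra.of k G g - 1

theorem aug_of (g : G) : aug k G (MonoidAlgebra.of k G g) = 1 := by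
  simp [aug]

variable {ω : Ideal (MonoidAlgebra k G)} (hω : ∀ x, x ∈ ω ↔ aug k G x = 0)
include hω

theorem dif_mem (g : G) : dif k g ∈ ω := by
  rw [hω, dif, map_sub, aug_of, map_one, sub_self]

omit hω in
theorem sub_aug_mem (x : MonoidAlgebra k G) :
    x - algebraMap k _ (aug k G x) ∈ Submodule.span k (Set.range (dif k (G := G))) := by
  induction x using MonoidAlgebra.induction_on with
  | of g =>
    apply Submodule.subset_span
    exact ⟨g, by rw [dif, aug_of, map_one]⟩
  | add x y hx hy =>
    rw [map_add, map_add, add_sub_add_comm]; exact Submodule.add_mem _ hx hy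
  | smul r x hx =>
    rw [map_smul, smul_eq_mul, map_mul, ← Algebra.smul_def, ← smul_sub]
    exact Submodule.smul_mem _ _ hx

theorem mem_span {x : MonoidAlgebra k G} (hx : x ∈ ω) :
    x ∈ Submodule.span k (Set.range (dif k (G := G))) := by
  have := sub_aug_mem x
  rw [(hω x).1 hx] at this
  simpa using this

/-- Span of generator differences. -/
noncomputable def VV (k : Type) [Field k] {G : Type} [Group G] (S : Set G) : Submodule k (MonoidAlgebra k G) :=
  Submodule.span k (dif k '' S)

theorem om_decomp {S : Set G} (hS : Subgroup.closure S = ⊤) {x : MonoidAlgebra k G} (hx : x ∈ ω) :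
    x ∈ VV k S ⊔ (ω ^ 2).restrictScalars k := by
  have hmul : ∀ g h : G, dif k g * dif k h ∈ (ω ^ 2).restrictScalars k := by
    intro g h
    rw [Submodule.restrictScalars_mem, ipow_two]
    exact Ideal.mul_mem_mul (dif_mem hω g) (dif_mem hω h)
  have hx := mem_span hω hx
  refine (Submodule.span_le.2 ?_) hx
  rintro _ ⟨g, rfl⟩
  have hg : g ∈ Subgroup.closure S := by rw [hS]; trivial
  rw [SetLike.mem_coe]
  induction hg using Subgroup.closure_induction with
  | mem g hg => exact Submodule.mem_sup_left (Submodule.subset_span ⟨g, hg, rfl⟩)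
  | one => simp [dif, MonoidAlgebra.one_def]
  | mul a b _ _ ha hb =>
    have : dif k (a * b) = dif k a * dif k b + (dif k a + dif k b) := by
      simp only [dif, map_mul]; noncomm_ring
    rw [this]
    exact Submodule.add_mem _ (Submodule.mem_sup_right (hmul a b)) (Submodule.add_mem _ ha hb)
  | inv a _ ha =>
    have : dif k a⁻¹ = - (dif k a⁻¹ * dif k a) - dif k a := by
      have h1 : MonoidAlgebra.of k G a⁻¹ * MonoidAlgebra.of k G a = 1 := by
        rw [← map_mul, inv_mul_cancel, map_one]
      have : dif k a⁻¹ * dif k a = MonoidAlgebra.of k G a⁻¹ * MonoidAlgebra.of k G a -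
        MonoidAlgebra.of k G a⁻¹ - MonoidAlgebra.of k G a + 1 := by
        simp only [dif]; noncomm_ring
      rw [this, h1]; simp only [dif]; noncomm_ring
    rw [this]
    exact Submodule.sub_mem _ (Submodule.neg_mem _ (Submodule.mem_sup_right (hmul _ _))) ha

theorem VV_pow_le (S : Set G) (n : ℕ) : VV k S ^ n ≤ (ω ^ n).restrictScalars k := by
  induction n with
  | zero => intro x _; rw [Submodule.restrictScalars_mem, ipow_zero]; trivial
  | succ n ih =>
    rw [pow_succ, Submodule.mul_le]
    intro a ha b hb
    rw [Submodule.restrictScalars_mem, ipow_succ]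
    refine Ideal.mul_mem_mul (ih ha) ?_
    have : VV k S ≤ ω.restrictScalars k := by
      rw [VV, Submodule.span_le]
      rintro _ ⟨g, _, rfl⟩
      exact dif_mem hω g
    exact this hb

theorem om_pow_decomp {S : Set G} (hS : Subgroup.closure S = ⊤) (n : ℕ) {x : MonoidAlgebra k G}
    (hx : x ∈ ω ^ n) : x ∈ VV k S ^ n ⊔ (ω ^ (n+1)).restrictScalars k := by
  induction n generalizing x with
  | zero =>
    have h1 : x = algebraMap k _ (aug k G x) + (x - algebraMap k _ (aug k G x)) := by abel
    rw [h1]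
    refine Submodule.add_mem _ (Submodule.mem_sup_left ?_) (Submodule.mem_sup_right ?_)
    · rw [pow_zero]; exact Submodule.algebraMap_mem _
    · rw [Submodule.restrictScalars_mem, zero_add, ipow_one, hω, map_sub, AlgHom.commutes]; exact sub_self _
  | succ n ih =>
    rw [ipow_succ] at hx
    induction hx using Submodule.mul_induction_on' with
    | mem_mul_mem a ha b hb =>
      obtain ⟨v, hv, a', ha', rfl⟩ := Submodule.mem_sup.1 (ih ha)
      obtain ⟨v', hv', b', hb', rfl⟩ := Submodule.mem_sup.1 (om_decomp hω hS hb)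
      rw [Submodule.restrictScalars_mem] at ha' hb'
      have : (v + a') * (v' + b') = v * v' + (v * b' + a' * (v' + b')) := by noncomm_ring
      rw [this]
      refine Submodule.add_mem _ (Submodule.mem_sup_left ?_) (Submodule.mem_sup_right ?_)
      · rw [pow_succ]; exact Submodule.mul_mem_mul hv hv'
      · rw [Submodule.restrictScalars_mem]
        refine Submodule.add_mem _ ?_ ?_
        · exact ipow_add_two ω n (VV_pow_le hω S n hv) hb'
        · rw [ipow_succ]; exact Ideal.mul_mem_mul ha' hb
    | add x y _ _ hx hy => exact Submodule.add_mem _ hx hy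

theorem gr_finite {S : Set G} (hfin : S.Finite) (hS : Subgroup.closure S = ⊤) (n : ℕ) :
    Module.Finite k (↥(ω ^ n) ⧸ (Submodule.comap (ω ^ n).subtype (ω ^ (n + 1)))) := by
  have hfg : (VV k S ^ n).FG := Submodule.FG.pow (Submodule.fg_span (hfin.image _)) n
  have : Module.Finite k ↥(VV k S ^ n) := Module.Finite.iff_fg.2 hfg
  let f : ↥(VV k S ^ n) →ₗ[k] (↥(ω ^ n) ⧸ (Submodule.comap (ω ^ n).subtype (ω ^ (n + 1)))) :=
    { toFun := fun v => Submodule.Quotient.mk ⟨v.1, VV_pow_le hω S n v.2⟩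
      map_add' := fun a b => rfl
      map_smul' := fun c a => rfl }
  apply Module.Finite.of_surjective f
  intro q
  obtain ⟨⟨x, hx⟩, rfl⟩ := Submodule.Quotient.mk_surjective _ q
  obtain ⟨v, hv, y, hy, rfl⟩ := Submodule.mem_sup.1 (om_pow_decomp hω hS n hx)
  refine ⟨⟨v, hv⟩, ?_⟩
  symm
  show Submodule.Quotient.mk _ = Submodule.Quotient.mk _
  rw [Submodule.Quotient.eq]
  rw [Submodule.mem_comap]
  simpa using hy

end aug

namespace WordAlg
open Matrix

variable {p : ℕ} [Fact p.Prime] {R : Type} [Ring R] [Algebra (ZMod p) R] (A : WordAlg p R)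

/-- The matrix representation of the group algebra. -/
noncomputable def phi : MonoidAlgebra (ZMod p) A.De →ₐ[ZMod p] M3 R :=
  MonoidAlgebra.lift (ZMod p) (M3 R) A.De ((Units.coeHom (M3 R)).comp A.De.subtype)

theorem phi_dif (g : A.De) : A.phi (dif (ZMod p) g) = (g.1 : M3 R) - 1 := by
  simp [phi, dif]

theorem phi_mem {ω : Ideal (MonoidAlgebra (ZMod p) A.De)} (hω : ∀ x, x ∈ ω ↔ aug (ZMod p) A.De x = 0)
    (n : ℕ) {x} (hx : x ∈ ω ^ n) : A.phi x ∈ A.mI n := by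
  have h1 : ∀ x ∈ ω, A.phi x ∈ A.mI 1 := by
    intro x hx
    have := mem_span hω hx
    clear hx
    induction this using Submodule.span_induction with
    | mem x h => obtain ⟨g, rfl⟩ := h; rw [phi_dif]; exact A.De_le_Gam g.2
    | zero => simp
    | add x y hx' hy' hx hy =>
      rw [map_add]; exact Submodule.add_mem _ hx hy
    | smul a x _ hx => rw [map_smul]; exact Submodule.smul_mem _ _ hx
  induction n generalizing x with
  | zero => exact A.mem_mI_zero _
  | succ n ih =>
    rw [ipow_succ] at hx
    induction hx using Submodule.mul_induction_on' with
    | mem_mul_mem a ha b hb => rw [map_mul]; exact A.mI_mul (ih ha) (h1 b hb)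
    | add x y _ _ hx hy => rw [map_add]; exact Submodule.add_mem _ hx hy

/-- Alternating column index. -/
def jj : ℕ → Fin 3
  | 0 => 0
  | n + 1 => 1 - jj n

theorem jj_ne (n : ℕ) : jj n ≠ jj (n + 1) := by
  show jj n ≠ 1 - jj n
  have : ∀ a : Fin 3, a = 0 ∨ a = 1 → a ≠ 1 - a ∧ (1 - a = 0 ∨ 1 - a = 1) := by decide
  have h : ∀ n, jj n = 0 ∨ jj n = 1 := by
    intro n
    induction n with
    | zero => exact Or.inl rfl
    | succ n ih => exact (this _ ih).2
  exact (this _ (h n)).1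

theorem phi_surj {ω : Ideal (MonoidAlgebra (ZMod p) A.De)} (hω : ∀ x, x ∈ ω ↔ aug (ZMod p) A.De x = 0)
    (n : ℕ) (w : List (Fin 8)) (hw : w.length = n) :
    ∃ x ∈ ω ^ n, A.phi x 0 (jj n) = A.mon w := by
  induction n generalizing w with
  | zero =>
    have : w = [] := List.length_eq_zero_iff.1 hw
    subst this
    exact ⟨1, by rw [ipow_zero]; trivial, by rw [map_one, A.mon_nil]; rfl⟩
  | succ n ih =>
    obtain ⟨v, a, rfl⟩ : ∃ v a, w = v ++ [a] := by
      have hne : w ≠ [] := by rintro rfl; simp at hw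
      exact ⟨w.dropLast, w.getLast hne, (List.dropLast_append_getLast hne).symm⟩
    obtain ⟨x, hx, hphi⟩ := ih v (by simpa using hw)
    refine ⟨x * dif (ZMod p) (⟨el (jj n) (jj (n+1)) (A.mon [a]), A.el_mem_De (jj_ne n) (by simp)⟩ : A.De), ?_, ?_⟩
    · rw [ipow_succ]; exact Ideal.mul_mem_mul hx (dif_mem hω _)
    · rw [map_mul, phi_dif, el_val (jj_ne n), add_sub_cancel_left, mul_single_apply_same, hphi, A.mon_append]

theorem gr_lower {ω : Ideal (MonoidAlgebra (ZMod p) A.De)} (hω : ∀ x, x ∈ ω ↔ aug (ZMod p) A.De x = 0)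
    (n : ℕ) : NL n ≤ Module.finrank (ZMod p) (↥(ω ^ n) ⧸ (Submodule.comap (ω ^ n).subtype (ω ^ (n + 1)))) := by
  have hfin := gr_finite hω (A.gens_finite.preimage Subtype.val_injective.injOn) A.De_gen n
  let W := {w : List (Fin 8) // w ∈ Lang ∧ w.length = n}
  have hWf : Finite W := NL_fin n
  have : Fintype W := Fintype.ofFinite W
  let F : MonoidAlgebra (ZMod p) A.De →ₗ[ZMod p] (W → ZMod p) :=
    { toFun := fun x w => A.coeff (A.phi x 0 (jj n)) w.1
      map_add' := fun a b => by ext w; simp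
      map_smul' := fun c a => by ext w; simp }
  have hF0 : ∀ x ∈ ω ^ (n+1), F x = 0 := by
    intro x hx
    ext w
    exact A.I_coeff (A.phi_mem hω (n+1) hx 0 (jj n)) (by have := w.2.2; omega)
  have hF : ∀ v : W → ZMod p, ∃ x ∈ ω ^ n, F x = v := by
    intro v
    have hv : v ∈ Submodule.map F ((ω ^ n).restrictScalars (ZMod p)) := by
      have hle : (⊤ : Submodule (ZMod p) (W → ZMod p)) ≤
          Submodule.map F ((ω ^ n).restrictScalars (ZMod p)) := by
        rw [← (Pi.basisFun (ZMod p) W).span_eq, Submodule.span_le]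
        rintro _ ⟨w, rfl⟩
        obtain ⟨x, hx, hphi⟩ := A.phi_surj hω n w.1 w.2.2
        refine ⟨x, hx, ?_⟩
        ext v
        show A.coeff (A.phi x 0 (jj n)) v.1 = _
        rw [hphi, A.coeff_mon _ w.2.1, Pi.basisFun_apply, Finsupp.single_apply, Pi.single_apply]
        congr 1
        rw [Subtype.ext_iff]; exact propext eq_comm
      exact hle trivial
    obtain ⟨x, hx, h⟩ := hv
    exact ⟨x, hx, h⟩
  have h1 := lower_gen (ω ^ n) (ω ^ (n + 1)) F hF0 hF
  rw [Module.finrank_fintype_fun_eq_card, ← Nat.card_eq_fintype_card] at h1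
  exact h1

end WordAlg
end HJI


/-- For every prime `p` there exists a finitely generated hereditarily just-infinite
group `Δ` such that, with `ω` the augmentation ideal of the group algebra `F_p[Δ]`
(the kernel of the `F_p`-algebra map sending every group element to `1`), each
quotient `ω^n/ω^{n+1}` is a finite-dimensional `F_p`-vector space and there is
`c > 1` with `dim (ω^n/ω^{n+1}) ≥ c^n` for all sufficiently large `n`. -/
theorem exists_hereditarily_just_infinite_gr_exponential_growth (p : ℕ) (hp : p.Prime) :
    ∃ (Δ : Type) (_ : Group Δ),
      Group.FG Δ ∧ HereditarilyJustInfinite Δ ∧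
      ∀ ω : Ideal (MonoidAlgebra (ZMod p) Δ),
        ω = RingHom.ker ((MonoidAlgebra.lift (ZMod p) (ZMod p) Δ) 1).toRingHom →
        (∀ n : ℕ, Module.Finite (ZMod p)
            (↥(ω ^ n) ⧸ (Submodule.comap (ω ^ n).subtype (ω ^ (n + 1))))) ∧
        ∃ c : ℝ, 1 < c ∧ ∃ N : ℕ, ∀ n ≥ N,
          c ^ n ≤ (Module.finrank (ZMod p)
            (↥(ω ^ n) ⧸ (Submodule.comap (ω ^ n).subtype (ω ^ (n + 1)))) : ℝ) := by
  have := Fact.mk hp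
  let A := HJI.model p
  refine ⟨A.De, inferInstance, A.De_fg, A.De_hji, fun ω hω => ?_⟩
  have hω' : ∀ x, x ∈ ω ↔ HJI.aug (ZMod p) A.De x = 0 := by
    intro x
    rw [hω]
    exact RingHom.mem_ker
  refine ⟨fun n => ?_, Real.sqrt 2, ?_, 0, fun n _ => ?_⟩
  · exact HJI.gr_finite hω' (A.gens_finite.preimage Subtype.val_injective.injOn) A.De_gen n
  · rw [Real.lt_sqrt] <;> norm_num
  · have h1 := A.gr_lower hω' n
    have h2 : (Real.sqrt 2) ^ n ≤ (HJI.NL n : ℝ) := by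
      have h3 : ((2 : ℝ) ^ n) ≤ (HJI.NL n : ℝ) ^ 2 := by exact_mod_cast HJI.NL_growth n
      refine abs_le_of_sq_le_sq' ?_ (Nat.cast_nonneg _) |>.2
      rw [← pow_mul, mul_comm, pow_mul, Real.sq_sqrt (by norm_num)]
      exact h3
    exact h2.trans (by exact_mod_cast h1)
end

section
/- Let G be a pro-p group, W a valuation on G, and H a closed subgroup of G such that the W-index [G:H]_W is finite and the W-rank rk_W(G) is finite. Then rk_W(H) is finite and rk_W(H) − 1 ≤ [G:H]_W · (rk_W(G) − 1) (the weighted Schreier index formula, inequality form). -/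
open scoped ENNReal

/-- A pro-`p` group: compact, Hausdorff, totally disconnected, and every open
normal subgroup has index a power of `p`.  (The ambient `TopologicalGroup`
structure is carried by instances.) -/
def IsProPGroup (p : ℕ) (G : Type*) [Group G] [TopologicalSpace G] : Prop :=
  CompactSpace G ∧ T2Space G ∧ TotallyDisconnectedSpace G ∧
    ∀ N : Subgroup G, N.Normal → IsOpen (N : Set G) → ∃ k : ℕ, N.index = p ^ k

/-- A valuation on a (topological) group `G`: a continuous function `W : G → ℝ`
with `0 ≤ W g < 1`, `W g = 0 ↔ g = 1`, `W (f*g) ≤ max (W f) (W g)`,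
`W [f,g] ≤ W f * W g` and `W (g^p) ≤ (W g)^p`. -/
structure GroupValuation (p : ℕ) (G : Type*) [Group G] [TopologicalSpace G] where
  toFun : G → ℝ
  continuous_toFun : Continuous toFun
  nonneg : ∀ g, 0 ≤ toFun g
  lt_one : ∀ g, toFun g < 1
  eq_zero_iff : ∀ g, toFun g = 0 ↔ g = 1
  mul_le : ∀ f g, toFun (f * g) ≤ max (toFun f) (toFun g)
  commutator_le : ∀ f g, toFun (f⁻¹ * g⁻¹ * f * g) ≤ toFun f * toFun g
  pow_le : ∀ g, toFun (g ^ p) ≤ toFun g ^ p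

variable {G : Type*} [Group G] [TopologicalSpace G]

/-- `G_α = {g : W g ≤ α}`, as a subgroup (it is one, for a valuation `W`). -/
def levelLE (W : G → ℝ) (α : ℝ) : Subgroup G := Subgroup.closure {g | W g ≤ α}

/-- `G_{<α} = {g : W g < α}`, as a subgroup (it is one, for a valuation `W`). -/
def levelLT (W : G → ℝ) (α : ℝ) : Subgroup G := Subgroup.closure {g | W g < α}

/-- `c_α(H) = log_p [H_α : H_{<α}]`, where `H_α = H ⊓ G_α`, `H_{<α} = H ⊓ G_{<α}`. -/
noncomputable def cval (p : ℕ) (W : G → ℝ) (H : Subgroup G) (α : ℝ) : ℕ :=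
  Nat.log p ((levelLT W α ⊓ H).relIndex (levelLE W α ⊓ H))

/-- The `W`-index `[G:H]_W = ∏_{α ∈ (0,1)} ((1-α^p)/(1-α))^(c_α(G) - c_α(H))`,
as an extended nonnegative real. -/
noncomputable def WIndex (p : ℕ) (W : G → ℝ) (H : Subgroup G) : ℝ≥0∞ :=
  ∏' α : Set.Ioo (0 : ℝ) 1,
    (ENNReal.ofReal ((1 - (α : ℝ) ^ p) / (1 - (α : ℝ)))) ^
      (cval p W ⊤ (α : ℝ) - cval p W H (α : ℝ))

/-- The Frattini-type subgroup `Φ(K)`: the topological closure of the subgroup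
generated by all commutators and all `p`-th powers of elements of `K`. -/
def FrattiniClosure (p : ℕ) [IsTopologicalGroup G] (K : Subgroup G) : Subgroup G :=
  (Subgroup.closure {x | (∃ a ∈ K, ∃ b ∈ K, x = a⁻¹ * b⁻¹ * a * b) ∨
      ∃ a ∈ K, x = a ^ p}).topologicalClosure

/-- The `W`-rank `rk_W(K) = Σ_{α ∈ (0,1)} α · log_p [K_α·Φ(K) : K_{<α}·Φ(K)]`,
as an extended nonnegative real. -/
noncomputable def WRank (p : ℕ) [IsTopologicalGroup G] (W : G → ℝ) (K : Subgroup G) : ℝ≥0∞ :=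
  ∑' α : Set.Ioo (0 : ℝ) 1,
    ENNReal.ofReal (α : ℝ) *
      (Nat.log p (((levelLT W (α : ℝ) ⊓ K) ⊔ FrattiniClosure p K).relIndex
        ((levelLE W (α : ℝ) ⊓ K) ⊔ FrattiniClosure p K)) : ℝ≥0∞)


namespace WS

/-- The abstract (non closed) Frattini-type subgroup. -/
def Phi (p : ℕ) {Q : Type*} [Group Q] (K : Subgroup Q) : Subgroup Q :=
  Subgroup.closure {x | (∃ a ∈ K, ∃ b ∈ K, x = a⁻¹ * b⁻¹ * a * b) ∨ ∃ a ∈ K, x = a ^ p}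

section basics
variable {Q : Type*} [Group Q] {p : ℕ}

lemma Phi_le (K : Subgroup Q) : Phi p K ≤ K := by
  refine (Subgroup.closure_le _).2 ?_
  rintro x (⟨a, ha, b, hb, rfl⟩ | ⟨a, ha, rfl⟩)
  · exact K.mul_mem (K.mul_mem (K.mul_mem (K.inv_mem ha) (K.inv_mem hb)) ha) hb
  · exact K.pow_mem ha p

lemma pow_mem_Phi {K : Subgroup Q} {a : Q} (ha : a ∈ K) : a ^ p ∈ Phi p K :=
  Subgroup.subset_closure (Or.inr ⟨a, ha, rfl⟩)

lemma comm_mem_Phi {K : Subgroup Q} {a b : Q} (ha : a ∈ K) (hb : b ∈ K) :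
    a⁻¹ * b⁻¹ * a * b ∈ Phi p K :=
  Subgroup.subset_closure (Or.inl ⟨a, ha, b, hb, rfl⟩)

lemma le_normalizer {K L : Subgroup Q} (hL : L ≤ K) (hP : Phi p K ≤ L) :
    (L.subgroupOf K).Normal := by
  rw [Subgroup.normal_subgroupOf_iff hL]
  intro h k hh hk
  have h1 := hP (comm_mem_Phi (p := p) (K.inv_mem hk) (K.inv_mem (hL hh)))
  have : k * h * k⁻¹ = ((k⁻¹)⁻¹ * (h⁻¹)⁻¹ * k⁻¹ * h⁻¹) * h := by group
  rw [this]
  exact L.mul_mem h1 hh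

lemma relIndex_zpowers_dvd {K L : Subgroup Q} (hL : L ≤ K) (hP : Phi p K ≤ L) {y : Q}
    (hy : y ∈ K) : L.relIndex (L ⊔ Subgroup.zpowers y) ∣ p := by
  have := le_normalizer hL hP
  have hz : Subgroup.zpowers y ≤ K := by simpa using hy
  rw [← Subgroup.relIndex_subgroupOf (sup_le hL hz), Subgroup.subgroupOf_sup hL hz,
    Subgroup.relIndex_sup_left]
  have h1 : (Subgroup.zpowers y).subgroupOf K = Subgroup.zpowers (⟨y, hy⟩ : K) := by
    ext z
    simp [Subgroup.mem_subgroupOf, Subgroup.mem_zpowers_iff, Subtype.ext_iff]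
  rw [h1]
  have h2 := Subgroup.relIndex_ker (K := Subgroup.zpowers (⟨y, hy⟩ : K))
    (QuotientGroup.mk' (L.subgroupOf K))
  rw [QuotientGroup.ker_mk'] at h2
  rw [h2, MonoidHom.map_zpowers, Nat.card_zpowers]
  apply orderOf_dvd_of_pow_eq_one
  rw [← map_pow]
  rw [QuotientGroup.mk'_apply, QuotientGroup.eq_one_iff]
  exact hP (pow_mem_Phi hy)

lemma relIndex_zpowers_eq (hp : p.Prime) {K L : Subgroup Q} (hL : L ≤ K) (hP : Phi p K ≤ L) {y : Q}
    (hy : y ∈ K) (hyL : y ∉ L) : L.relIndex (L ⊔ Subgroup.zpowers y) = p := by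
  rcases (Nat.dvd_prime hp).1 (relIndex_zpowers_dvd hL hP hy) with h | h
  · rw [Subgroup.relIndex_eq_one] at h
    exact absurd (h (Subgroup.mem_sup_right (Subgroup.mem_zpowers y))) hyL
  · exact h

lemma relIndex_closure_le (hp : p.Prime) {K L : Subgroup Q} (hL : L ≤ K) (hP : Phi p K ≤ L)
    (S : Finset Q) (hS : ∀ s ∈ S, s ∈ K) :
    L.relIndex (L ⊔ Subgroup.closure (S : Set Q)) ≤ p ^ S.card := by
  classical
  induction S using Finset.induction_on with
  | empty => simp
  | insert a s ha ih =>
    have ih' := ih (fun x hx => hS x (Finset.mem_insert_of_mem hx))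
    have hs : Subgroup.closure (s : Set Q) ≤ K :=
      (Subgroup.closure_le _).2 (fun x hx => hS x (Finset.mem_insert_of_mem hx))
    have e : L ⊔ Subgroup.closure ((insert a s : Finset Q) : Set Q) =
        (L ⊔ Subgroup.closure (s : Set Q)) ⊔ Subgroup.zpowers a := by
      rw [Finset.coe_insert, Set.insert_eq, Subgroup.closure_union, ← Subgroup.zpowers_eq_closure,
        sup_assoc, sup_comm (Subgroup.zpowers a)]
    have h1 := Subgroup.relIndex_mul_relIndex L (L ⊔ Subgroup.closure (s : Set Q))
      ((L ⊔ Subgroup.closure (s : Set Q)) ⊔ Subgroup.zpowers a) le_sup_left le_sup_left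
    rw [e, ← h1, Finset.card_insert_of_notMem ha, pow_succ]
    exact Nat.mul_le_mul ih' (Nat.le_of_dvd hp.pos (relIndex_zpowers_dvd (sup_le hL hs)
      (hP.trans le_sup_left) (hS a (Finset.mem_insert_self _ _))))

lemma relIndex_ne_zero' [Finite Q] (L K : Subgroup Q) : L.relIndex K ≠ 0 :=
  Subgroup.index_ne_zero_of_finite

/-- Greedy choice of generators. -/
lemma greedy [Finite Q] (hp : p.Prime) {K : Subgroup Q} (S : Set Q) (hS : S ⊆ K) :
    ∀ (n : ℕ) (L : Subgroup Q), L ≤ K → Phi p K ≤ L →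
      L.relIndex (L ⊔ Subgroup.closure S) ≤ n →
      ∃ X : Finset Q, (X : Set Q) ⊆ S ∧ L ⊔ Subgroup.closure (X : Set Q) = L ⊔ Subgroup.closure S ∧
        L.relIndex (L ⊔ Subgroup.closure S) = p ^ X.card := by
  classical
  intro n
  induction n with
  | zero =>
    intro L _ _ h
    exact absurd (Nat.le_zero.1 h) (relIndex_ne_zero' _ _)
  | succ n ih =>
    intro L hL hP h
    by_cases hSL : S ⊆ L
    · refine ⟨∅, by simp, ?_, ?_⟩
      · simp [hSL]
      · simp [hSL]
    · obtain ⟨s, hs, hsL⟩ := Set.not_subset.1 hSL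
      have hz : Subgroup.zpowers s ≤ K := by simpa using hS hs
      have hz' : Subgroup.zpowers s ≤ Subgroup.closure S := by
        simpa using Subgroup.subset_closure hs
      have e : (L ⊔ Subgroup.zpowers s) ⊔ Subgroup.closure S = L ⊔ Subgroup.closure S := by
        rw [sup_assoc, sup_eq_right.2 hz']
      have hm := Subgroup.relIndex_mul_relIndex L (L ⊔ Subgroup.zpowers s)
        (L ⊔ Subgroup.closure S) le_sup_left (sup_le_sup_left hz' _)
      rw [relIndex_zpowers_eq hp hL hP (hS hs) hsL] at hm
      have hpos : 0 < (L ⊔ Subgroup.zpowers s).relIndex (L ⊔ Subgroup.closure S) :=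
        Nat.pos_of_ne_zero (relIndex_ne_zero' _ _)
      have h2 := hp.two_le
      obtain ⟨X, hXS, hX1, hX2⟩ := ih (L ⊔ Subgroup.zpowers s) (sup_le hL hz)
        (hP.trans le_sup_left) (by rw [e]; nlinarith)
      rw [e] at hX1 hX2
      refine ⟨insert s X, ?_, ?_, ?_⟩
      · rw [Finset.coe_insert]
        exact Set.insert_subset hs hXS
      · rw [Finset.coe_insert, Set.insert_eq, Subgroup.closure_union, ← Subgroup.zpowers_eq_closure,
          ← sup_assoc, hX1]
      · have hsX : s ∉ X := by
          intro hsX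
          have h3 := relIndex_closure_le hp hL hP X (fun x hx => hS (hXS hx))
          have h4 : L ⊔ Subgroup.closure (X : Set Q) = L ⊔ Subgroup.closure S := by
            have h5 : Subgroup.zpowers s ≤ Subgroup.closure (X : Set Q) := by
              simpa using Subgroup.subset_closure (k := (X : Set Q)) hsX
            rw [← hX1, sup_assoc, sup_eq_right.2 h5]
          rw [h4, ← hm, hX2] at h3
          have : 0 < p ^ X.card := pow_pos hp.pos _
          nlinarith
        rw [Finset.card_insert_of_notMem hsX, ← hm, hX2, pow_succ, mul_comm]

lemma relIndex_pow [Finite Q] (hp : p.Prime) (hQ : ∃ n, Nat.card Q = p ^ n) (L K : Subgroup Q) :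
    L.relIndex K = p ^ Nat.log p (L.relIndex K) := by
  obtain ⟨n, hn⟩ := hQ
  have h : L.relIndex K ∣ p ^ n := by
    rw [← hn]
    exact (Subgroup.relIndex_dvd_card L K).trans (Subgroup.card_subgroup_dvd_card K)
  obtain ⟨k, _, hk⟩ := (Nat.dvd_prime_pow hp).1 h
  rw [hk, Nat.log_pow hp.one_lt]

lemma exists_index_p [Finite Q] (hp : p.Prime) (hQ : ∃ n, Nat.card Q = p ^ n) {H K : Subgroup Q}
    (h : H < K) : ∃ M : Subgroup Q, H ≤ M ∧ M ≤ K ∧ M.relIndex K = p := by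
  have := Fact.mk hp
  obtain ⟨n, hn⟩ := hQ
  obtain ⟨k, _, hk⟩ := (Nat.dvd_prime_pow hp).1 (hn ▸ Subgroup.card_subgroup_dvd_card K)
  obtain ⟨m, _, hm⟩ := (Nat.dvd_prime_pow hp).1 (hn ▸ Subgroup.card_subgroup_dvd_card H)
  have hlt : m < k := by
    have h1 : Nat.card H < Nat.card K := by
      have := Set.ncard_lt_ncard (SetLike.coe_ssubset_coe.2 h) (Set.toFinite _)
      simpa [← Nat.card_coe_set_eq] using this
    rw [hk, hm] at h1
    exact (Nat.pow_lt_pow_iff_right hp.one_lt).1 h1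
  have hcard : Nat.card (H.subgroupOf K) = p ^ m := by
    rw [← hm]
    exact Nat.card_congr (Subgroup.subgroupOfEquivOfLe h.le).toEquiv
  obtain ⟨M, hM1, hM2⟩ := Sylow.exists_subgroup_card_pow_prime_le (G := K) p (n := m) (m := k - 1)
    (by rw [hk]; exact pow_dvd_pow _ (by omega)) (H.subgroupOf K) hcard (by omega)
  refine ⟨M.map K.subtype, ?_, Subgroup.map_subtype_le M, ?_⟩
  · intro x hx
    exact ⟨⟨x, h.le hx⟩, hM2 (by simpa [Subgroup.mem_subgroupOf] using hx), rfl⟩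
  · have h1 := Subgroup.card_mul_index M
    rw [hM1, hk] at h1
    have h2 : (M.map K.subtype).relIndex K = M.index := by
      rw [Subgroup.relIndex, Subgroup.subgroupOf, Subgroup.comap_map_eq_self_of_injective
        K.subtype_injective]
    rw [h2]
    have h3 : p ^ k = p ^ (k - 1) * p := by rw [← pow_succ]; congr 1; omega
    rw [h3] at h1
    exact Nat.eq_of_mul_eq_mul_left (pow_pos hp.pos _) h1

lemma normal_index_p [Finite Q] (hp : p.Prime) (hQ : ∃ n, Nat.card Q = p ^ n) {M K : Subgroup Q}
    (hMK : M.relIndex K = p) : (M.subgroupOf K).Normal := by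
  obtain ⟨n, hn⟩ := hQ
  obtain ⟨k, _, hk⟩ := (Nat.dvd_prime_pow hp).1 (hn ▸ Subgroup.card_subgroup_dvd_card K)
  apply Subgroup.normal_of_index_eq_minFac_card
  have hk0 : k ≠ 0 := by
    rintro rfl
    have h1 := Subgroup.relIndex_dvd_card M K
    rw [hk, hMK, pow_zero, Nat.dvd_one] at h1
    exact hp.one_lt.ne' h1
  rw [hk, hp.pow_minFac hk0]
  exact hMK

lemma Phi_le_index_p [Finite Q] (hp : p.Prime) (hQ : ∃ n, Nat.card Q = p ^ n) {M K : Subgroup Q}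
    (hMK : M.relIndex K = p) : Phi p K ≤ M := by
  have := Fact.mk hp
  have := normal_index_p hp hQ hMK
  have hc : Nat.card (K ⧸ M.subgroupOf K) = p := hMK
  have hcyc : IsCyclic (K ⧸ M.subgroupOf K) := isCyclic_of_prime_card hc
  refine (Subgroup.closure_le _).2 ?_
  rintro x (⟨a, ha, b, hb, rfl⟩ | ⟨a, ha, rfl⟩)
  · have h1 : (⟨a, ha⟩ : K)⁻¹ * (⟨b, hb⟩ : K)⁻¹ * ⟨a, ha⟩ * ⟨b, hb⟩ ∈ M.subgroupOf K := by
      rw [← QuotientGroup.eq_one_iff]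
      have : ∀ x y : K ⧸ M.subgroupOf K, x⁻¹ * y⁻¹ * x * y = 1 := by
        intro x y
        rw [mul_assoc, mul_assoc, hcyc.isMulCommutative.is_comm.comm x y]
        group
      simpa only [QuotientGroup.mk_mul, QuotientGroup.mk_inv] using this _ _
    exact h1
  · have h1 : (⟨a, ha⟩ : K) ^ p ∈ M.subgroupOf K := by
      rw [← QuotientGroup.eq_one_iff, QuotientGroup.mk_pow, ← hc, pow_card_eq_one']
    exact h1

lemma frattini_gen [Finite Q] (hp : p.Prime) (hQ : ∃ n, Nat.card Q = p ^ n) {T K : Subgroup Q}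
    (hT : T ≤ K) (h : K ≤ T ⊔ Phi p K) : T = K := by
  by_contra hne
  obtain ⟨M, h1, h2, h3⟩ := exists_index_p hp hQ (lt_of_le_of_ne hT hne)
  have h4 : K ≤ M := h.trans (sup_le h1 (Phi_le_index_p hp hQ h3))
  rw [← Subgroup.relIndex_eq_one, h3] at h4
  exact hp.one_lt.ne' h4

lemma decomp_index_p [Finite Q] (hp : p.Prime) (hQ : ∃ n, Nat.card Q = p ^ n) {M K : Subgroup Q}
    (hMK : M.relIndex K = p) {g : Q} (hg : g ∈ K) (hgM : g ∉ M) {x : Q} (hx : x ∈ K) :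
    ∃ i : ℤ, x * g ^ i ∈ M := by
  have := Fact.mk hp
  have := normal_index_p hp hQ hMK
  have hc : Nat.card (K ⧸ M.subgroupOf K) = p := hMK
  have h1 : ((⟨g, hg⟩ : K) : K ⧸ M.subgroupOf K) ≠ 1 := by
    rw [Ne, QuotientGroup.eq_one_iff]
    exact hgM
  have h2 := zpowers_eq_top_of_prime_card hc h1
  have h3 : (((⟨x, hx⟩ : K)⁻¹ : K) : K ⧸ M.subgroupOf K) ∈
      Subgroup.zpowers ((⟨g, hg⟩ : K) : K ⧸ M.subgroupOf K) := by rw [h2]; trivial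
  obtain ⟨i, hi⟩ := Subgroup.mem_zpowers_iff.1 h3
  refine ⟨i, ?_⟩
  rw [← QuotientGroup.mk_zpow, eq_comm, QuotientGroup.eq, inv_inv] at hi
  exact hi

end basics
end WS

namespace WS

/-- Valuation axioms, without topology. -/
structure FVal (p : ℕ) {Q : Type*} [Group Q] (w : Q → ℝ) : Prop where
  nonneg : ∀ g, 0 ≤ w g
  lt_one : ∀ g, w g < 1
  one : w 1 = 0
  eq_one : ∀ g, w g = 0 → g = 1
  mul_le : ∀ f g, w (f * g) ≤ max (w f) (w g)
  inv_le : ∀ g, w g⁻¹ ≤ w g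
  comm_le : ∀ f g, w (f⁻¹ * g⁻¹ * f * g) ≤ w f * w g
  pow_le : ∀ g, w (g ^ p) ≤ w g ^ p

section levels
variable {Q : Type*} [Group Q] {p : ℕ} {w : Q → ℝ}

lemma mem_levelLE (h : FVal p w) {α : ℝ} (hα : 0 ≤ α) {g : Q} : g ∈ levelLE w α ↔ w g ≤ α := by
  let S : Subgroup Q :=
    { carrier := {g | w g ≤ α}
      one_mem' := by simpa [h.one] using hα
      mul_mem' := fun {a b} ha hb => (h.mul_le a b).trans (max_le ha hb)
      inv_mem' := fun {a} ha => (h.inv_le a).trans ha }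
  have : levelLE w α = S := Subgroup.closure_eq S
  rw [this]
  rfl

lemma mem_levelLT (h : FVal p w) {α : ℝ} (hα : 0 < α) {g : Q} : g ∈ levelLT w α ↔ w g < α := by
  let S : Subgroup Q :=
    { carrier := {g | w g < α}
      one_mem' := by simpa [h.one] using hα
      mul_mem' := fun {a b} ha hb => (h.mul_le a b).trans_lt (max_lt ha hb)
      inv_mem' := fun {a} ha => (h.inv_le a).trans_lt ha }
  have : levelLT w α = S := Subgroup.closure_eq S
  rw [this]
  rfl

lemma zpow_le (h : FVal p w) (g : Q) (i : ℤ) : w (g ^ i) ≤ w g :=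
  (mem_levelLE h (h.nonneg g)).1 (Subgroup.zpow_mem _ ((mem_levelLE h (h.nonneg g)).2 le_rfl) i)

/-- `K_α Φ(K)` -/
def FE (p : ℕ) (w : Q → ℝ) (K : Subgroup Q) (α : ℝ) : Subgroup Q := (levelLE w α ⊓ K) ⊔ Phi p K
/-- `K_{<α} Φ(K)` -/
def FL (p : ℕ) (w : Q → ℝ) (K : Subgroup Q) (α : ℝ) : Subgroup Q := (levelLT w α ⊓ K) ⊔ Phi p K
/-- dimension of the graded piece. -/
noncomputable def rr (p : ℕ) (w : Q → ℝ) (K : Subgroup Q) (α : ℝ) : ℕ :=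
  Nat.log p ((FL p w K α).relIndex (FE p w K α))

lemma levelLT_le (w : Q → ℝ) (α : ℝ) : levelLT w α ≤ levelLE w α :=
  Subgroup.closure_mono (fun x (hx : w x < α) => show w x ≤ α from hx.le)

lemma FL_le_FE (K : Subgroup Q) (α : ℝ) : FL p w K α ≤ FE p w K α :=
  sup_le_sup_right (inf_le_inf_right _ (levelLT_le w α)) _

lemma FE_le (K : Subgroup Q) (α : ℝ) : FE p w K α ≤ K := sup_le inf_le_right (Phi_le K)
lemma FL_le (K : Subgroup Q) (α : ℝ) : FL p w K α ≤ K := sup_le inf_le_right (Phi_le K)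
lemma Phi_le_FE (K : Subgroup Q) (α : ℝ) : Phi p K ≤ FE p w K α := le_sup_right
lemma Phi_le_FL (K : Subgroup Q) (α : ℝ) : Phi p K ≤ FL p w K α := le_sup_right

lemma rank_aux [Finite Q] (hp : p.Prime) (hQ : ∃ n, Nat.card Q = p ^ n) (h : FVal p w)
    {K : Subgroup Q} {Y : Finset Q} (hY : Subgroup.closure (Y : Set Q) = K) (A : Finset ℝ) :
    ∀ c : ℝ, 0 ≤ c → (∀ β ∈ A, c < β) → (∀ g ∈ K, c < w g → w g ∈ A) →
      p ^ (∑ β ∈ A, rr p w K β) = (FE p w K c).relIndex K ∧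
      ∑ β ∈ A, (β - c) * (rr p w K β : ℝ) ≤ ∑ y ∈ Y.filter (fun y => c < w y), (w y - c) := by
  classical
  have hYK : ∀ y ∈ Y, y ∈ K := fun y hy => hY ▸ Subgroup.subset_closure hy
  induction A using Finset.induction_on_min with
  | empty =>
    intro c hc _ hK
    have e : FE p w K c = K := by
      refine le_antisymm (FE_le K c) (fun x hx => Subgroup.mem_sup_left ⟨?_, hx⟩)
      by_contra hh
      exact absurd (hK x hx (not_le.1 (fun h' => hh ((mem_levelLE h hc).2 h')))) (by simp)
    refine ⟨by simp [e], ?_⟩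
    rw [Finset.sum_empty]
    exact Finset.sum_nonneg (fun y hy => sub_nonneg.2 (Finset.mem_filter.1 hy).2.le)
  | insert a s has ih =>
    intro c hc hA hK
    have hca : c < a := hA a (Finset.mem_insert_self _ _)
    have ha0 : 0 < a := hc.trans_lt hca
    have hgap : ∀ g ∈ K, c < w g → a ≤ w g := by
      intro g hg hcg
      rcases Finset.mem_insert.1 (hK g hg hcg) with h1 | h1
      · exact h1.ge
      · exact (has _ h1).le
    obtain ⟨ih1, ih2⟩ := ih a ha0.le has (fun g hg hag => by
      rcases Finset.mem_insert.1 (hK g hg (hca.trans hag)) with h1 | h1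
      · exact absurd h1 hag.ne'
      · exact h1)
    have has' : a ∉ s := fun h1 => lt_irrefl _ (has a h1)
    have e : FE p w K c = FL p w K a := by
      have : levelLE w c ⊓ K = levelLT w a ⊓ K := by
        ext x
        rw [Subgroup.mem_inf, Subgroup.mem_inf, mem_levelLE h hc, mem_levelLT h ha0]
        refine and_congr_left (fun hx => ⟨fun h1 => h1.trans_lt hca, fun h1 => ?_⟩)
        by_contra h2
        exact absurd (hgap x hx (not_le.1 h2)) (not_le.2 h1)
      rw [FE, FL, this]
    have part1 : p ^ (∑ β ∈ insert a s, rr p w K β) = (FE p w K c).relIndex K := by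
      rw [Finset.sum_insert has', pow_add, ih1, rr, ← relIndex_pow hp hQ, e,
        Subgroup.relIndex_mul_relIndex _ _ _ (FL_le_FE K a) (FE_le K a)]
    refine ⟨part1, ?_⟩
    set B := Y.filter (fun y => c < w y) with hB
    have hcard : ∑ β ∈ insert a s, rr p w K β ≤ B.card := by
      have h1 := relIndex_closure_le hp (FE_le (w := w) K c) (Phi_le_FE K c) B
        (fun y hy => hYK y (Finset.mem_filter.1 hy).1)
      have h2 : FE p w K c ⊔ Subgroup.closure (B : Set Q) = K := by
        apply le_antisymm
        · refine sup_le (FE_le K c) ((Subgroup.closure_le _).2 ?_)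
          intro y hy
          exact hYK y (Finset.mem_filter.1 hy).1
        · conv_lhs => rw [← hY]
          refine (Subgroup.closure_le _).2 ?_
          intro y hy
          by_cases hcy : c < w y
          · exact Subgroup.mem_sup_right (Subgroup.subset_closure
              (Finset.mem_coe.2 (Finset.mem_filter.2 ⟨hy, hcy⟩)))
          · exact Subgroup.mem_sup_left (Subgroup.mem_sup_left
              ⟨(mem_levelLE h hc).2 (not_lt.1 hcy), hYK y hy⟩)
      rw [h2, ← part1] at h1
      exact (Nat.pow_le_pow_iff_right hp.one_lt).1 h1
    have hcard' : ∑ β ∈ insert a s, (rr p w K β : ℝ) ≤ (B.card : ℝ) := by exact_mod_cast hcard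
    have l1 : ∑ β ∈ insert a s, (β - c) * (rr p w K β : ℝ) =
        (a - c) * ∑ β ∈ insert a s, (rr p w K β : ℝ) + ∑ β ∈ s, (β - a) * (rr p w K β : ℝ) := by
      rw [Finset.sum_insert has', Finset.sum_insert has', mul_add, Finset.mul_sum, add_assoc,
        ← Finset.sum_add_distrib]
      congr 1
      exact Finset.sum_congr rfl (fun _ _ => by ring)
    have l2 : ∑ y ∈ B, (w y - c) = (a - c) * (B.card : ℝ) + ∑ y ∈ B, (w y - a) := by
      rw [mul_comm, ← nsmul_eq_mul, ← Finset.sum_const, ← Finset.sum_add_distrib]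
      exact Finset.sum_congr rfl (fun _ _ => by ring)
    have l3 : ∑ y ∈ Y.filter (fun y => a < w y), (w y - a) = ∑ y ∈ B, (w y - a) := by
      apply Finset.sum_subset
      · intro y hy
        rw [Finset.mem_filter] at hy
        exact Finset.mem_filter.2 ⟨hy.1, hca.trans hy.2⟩
      · intro y hy hy'
        rw [hB, Finset.mem_filter] at hy
        rw [Finset.mem_filter, not_and, not_lt] at hy'
        have := hgap y (hYK y hy.1) hy.2
        have := hy' hy.1
        linarith
    rw [l1, l2, ← l3]
    have := mul_le_mul_of_nonneg_left hcard' (sub_nonneg.2 hca.le)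
    linarith

/-- The rank is at most the total weight of any generating set. -/
lemma rank_le [Finite Q] (hp : p.Prime) (hQ : ∃ n, Nat.card Q = p ^ n) (h : FVal p w)
    {K : Subgroup Q} {Y : Finset Q} (hY : Subgroup.closure (Y : Set Q) = K) (A : Finset ℝ)
    (hA : ∀ α ∈ A, 0 < α) (hA' : ∀ g, g ≠ 1 → w g ∈ A) :
    ∑ β ∈ A, β * (rr p w K β : ℝ) ≤ ∑ y ∈ Y, w y := by
  have h1 := (rank_aux hp hQ h hY A 0 le_rfl hA (fun g _ hg => hA' g (by
    rintro rfl
    rw [h.one] at hg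
    exact lt_irrefl _ hg))).2
  simp only [sub_zero] at h1
  exact h1.trans (Finset.sum_le_sum_of_subset_of_nonneg (Finset.filter_subset _ _)
    (fun y _ _ => h.nonneg y))

/-- iterated commutators -/
def cm (g x : Q) : ℕ → Q
  | 0 => x
  | i + 1 => (cm g x i)⁻¹ * g⁻¹ * (cm g x i) * g

lemma cm_le (h : FVal p w) (g x : Q) (i : ℕ) : w (cm g x i) ≤ w x * w g ^ i := by
  induction i with
  | zero => simp [cm]
  | succ i ih =>
    calc w (cm g x (i + 1)) ≤ w (cm g x i) * w g := h.comm_le _ _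
      _ ≤ w x * w g ^ i * w g := mul_le_mul_of_nonneg_right ih (h.nonneg g)
      _ = _ := by ring

lemma cm_conj {T : Subgroup Q} {g x : Q} (hT : ∀ i < p, cm g x i ∈ T) :
    ∀ k i : ℕ, i + k < p → (g ^ k)⁻¹ * cm g x i * g ^ k ∈ T := by
  intro k
  induction k with
  | zero => intro i hi; simpa using hT i hi
  | succ k ih =>
    intro i hi
    have h1 := T.mul_mem (ih i (by omega)) (ih (i + 1) (by omega))
    have e : (g ^ (k + 1))⁻¹ * cm g x i * g ^ (k + 1) =
      (g ^ k)⁻¹ * cm g x i * g ^ k * ((g ^ k)⁻¹ * cm g x (i + 1) * g ^ k) := by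
      rw [cm, pow_succ']
      group
    rw [e]
    exact h1

lemma cm_conj_zpow (hp : p.Prime) {T : Subgroup Q} {g x : Q} (hT : ∀ i < p, cm g x i ∈ T)
    (hg : g ^ p ∈ T) (i : ℤ) : g ^ i * x * (g ^ i)⁻¹ ∈ T := by
  have hp0 : (0 : ℤ) < p := by exact_mod_cast hp.pos
  obtain ⟨k, hk⟩ := Int.eq_ofNat_of_zero_le (Int.emod_nonneg (-i) hp0.ne')
  have hkp : k < p := by
    have := Int.emod_lt_of_pos (-i) hp0
    rw [hk] at this
    exact_mod_cast this
  have hi : i = p * (-(-i / p)) + -(k : ℤ) := by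
    have := Int.emod_add_mul_ediv (-i) p
    rw [hk] at this
    have e : (p : ℤ) * (-(-i / p)) = -(p * (-i / p)) := by ring
    rw [e]
    omega
  have h1 := cm_conj hT k 0 (by omega)
  have h2 := T.zpow_mem hg (-(-i / p))
  have h3 := T.mul_mem (T.mul_mem h2 h1) (T.inv_mem h2)
  have e : g ^ i * x * (g ^ i)⁻¹ = (g ^ p) ^ (-(-i / ↑p)) * ((g ^ k)⁻¹ * cm g x 0 * g ^ k) *
      ((g ^ p) ^ (-(-i / ↑p)))⁻¹ := by
    have e1 : g ^ i = (g ^ p) ^ (-(-i / ↑p)) * (g ^ k)⁻¹ := by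
      conv_lhs => rw [hi, zpow_add, zpow_mul, zpow_natCast, zpow_neg g, zpow_natCast]
    rw [e1, cm]
    group
  rw [e]
  exact h3

lemma schreier_gen (hp : p.Prime) {M K T : Subgroup Q} {g : Q} {X : Set Q} (hM : M ≤ K)
    (hgM : g ∉ M) (hK : Subgroup.closure (insert g X) = K) (hTM : T ≤ M)
    (hT : ∀ x ∈ X, ∀ i < p, cm g x i ∈ T) (hgT : g ^ p ∈ T) : T = M := by
  have key : ∀ y ∈ Subgroup.closure (insert g X), ∃ t ∈ T, ∃ i : ℤ, y = t * g ^ i := by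
    intro y hy
    induction hy using Subgroup.closure_induction_right with
    | one => exact ⟨1, T.one_mem, 0, by simp⟩
    | mul_right x hx y hy ih =>
      obtain ⟨t, ht, i, rfl⟩ := ih
      rcases hy with rfl | hy
      · exact ⟨t, ht, i + 1, by rw [zpow_add_one, mul_assoc]⟩
      · exact ⟨t * (g ^ i * y * (g ^ i)⁻¹), T.mul_mem ht (cm_conj_zpow hp (hT y hy) hgT i), i,
          by group⟩
    | mul_inv_cancel x hx y hy ih =>
      obtain ⟨t, ht, i, rfl⟩ := ih
      rcases hy with rfl | hy
      · exact ⟨t, ht, i - 1, by rw [zpow_sub_one, mul_assoc]⟩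
      · exact ⟨t * (g ^ i * y * (g ^ i)⁻¹)⁻¹,
          T.mul_mem ht (T.inv_mem (cm_conj_zpow hp (hT y hy) hgT i)), i, by group⟩
  refine le_antisymm hTM (fun m hm => ?_)
  obtain ⟨t, ht, i, rfl⟩ := key m (hK ▸ hM hm)
  have h1 : g ^ i ∈ M := (Subgroup.mul_mem_cancel_left M (hTM ht)).1 hm
  have hdvd : (p : ℤ) ∣ i := by
    by_contra hnd
    have hc : IsCoprime (p : ℤ) i := by
      rw [Int.isCoprime_iff_gcd_eq_one]
      exact (Nat.Prime.coprime_iff_not_dvd hp).2 (fun h2 => hnd (Int.natCast_dvd.2 h2))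
    obtain ⟨a, b, hab⟩ := hc
    apply hgM
    have : g = (g ^ p) ^ a * (g ^ i) ^ b := by
      rw [← zpow_natCast, ← zpow_mul, ← zpow_mul, ← zpow_add, mul_comm _ a, mul_comm _ b, hab,
        zpow_one]
    rw [this]
    exact M.mul_mem (M.zpow_mem (hTM hgT) a) (M.zpow_mem h1 b)
  obtain ⟨j, rfl⟩ := hdvd
  refine T.mul_mem ht ?_
  rw [zpow_mul, zpow_natCast]
  exact T.zpow_mem hgT j

lemma schreier_set (hp : p.Prime) (h : FVal p w) {M K : Subgroup Q} {g : Q} {X : Finset Q}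
    (hM : M ≤ K) (hn : (M.subgroupOf K).Normal) (hgp : g ^ p ∈ M)
    (hgM : g ∉ M) (hX : (X : Set Q) ⊆ M) (hK : Subgroup.closure (insert g (X : Set Q)) = K) :
    ∃ Y : Finset Q, Subgroup.closure (Y : Set Q) = M ∧
      ∑ y ∈ Y, w y ≤ (∑ x ∈ X, w x) * (∑ i ∈ Finset.range p, w g ^ i) + w g ^ p := by
  classical
  have hgK : g ∈ K := hK ▸ Subgroup.subset_closure (Set.mem_insert _ _)
  rw [Subgroup.normal_subgroupOf_iff hM] at hn
  have hcm : ∀ x ∈ X, ∀ i, cm g x i ∈ M := by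
    intro x hx i
    induction i with
    | zero => exact hX hx
    | succ i ih =>
      have h1 := hn _ _ ih (K.inv_mem hgK)
      rw [inv_inv] at h1
      have h2 := M.mul_mem (M.inv_mem ih) h1
      simpa [cm, mul_assoc] using h2
  let Z : Finset Q := (X ×ˢ Finset.range p).image (fun q => cm g q.1 q.2)
  refine ⟨insert (g ^ p) Z, ?_, ?_⟩
  · refine schreier_gen (p := p) hp hM hgM hK ?_ ?_ ?_
    · refine (Subgroup.closure_le _).2 ?_
      intro y hy
      rcases Finset.mem_insert.1 (Finset.mem_coe.1 hy) with rfl | hy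
      · exact hgp
      · obtain ⟨q, hq, rfl⟩ := Finset.mem_image.1 hy
        exact hcm _ (Finset.mem_product.1 hq).1 _
    · intro x hx i hi
      apply Subgroup.subset_closure
      refine Finset.mem_coe.2 (Finset.mem_insert_of_mem (Finset.mem_image.2 ⟨(x, i), ?_, rfl⟩))
      exact Finset.mem_product.2 ⟨hx, Finset.mem_range.2 hi⟩
    · exact Subgroup.subset_closure (Finset.mem_coe.2 (Finset.mem_insert_self _ _))
  · have h1 : ∑ y ∈ insert (g ^ p) Z, w y ≤ w (g ^ p) + ∑ y ∈ Z, w y := by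
      by_cases hz : g ^ p ∈ Z
      · rw [Finset.insert_eq_of_mem hz]
        linarith [h.nonneg (g ^ p)]
      · rw [Finset.sum_insert hz]
    have h2 : ∑ y ∈ Z, w y ≤ ∑ q ∈ X ×ˢ Finset.range p, w (cm g q.1 q.2) :=
      Finset.sum_image_le_of_nonneg (fun y _ => h.nonneg y)
    have h3 : ∑ q ∈ X ×ˢ Finset.range p, w (cm g q.1 q.2) ≤
        (∑ x ∈ X, w x) * (∑ i ∈ Finset.range p, w g ^ i) := by
      rw [Finset.sum_mul_sum, ← Finset.sum_product']
      exact Finset.sum_le_sum (fun q _ => cm_le h _ _ _)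
    linarith [h.pow_le g]

end levels
end WS

namespace WS
section main_finite
variable {Q : Type*} [Group Q] {p : ℕ} {w : Q → ℝ}

lemma gens_level [Finite Q] (hp : p.Prime) (hQ : ∃ n, Nat.card Q = p ^ n) (h : FVal p w)
    {M K : Subgroup Q} (hM : M ≤ K) (hMK : M.relIndex K = p) {g : Q} (hg : g ∈ K) (hgM : g ∉ M)
    (hmin : ∀ x ∈ K, x ∉ M → w g ≤ w x) {β : ℝ} (hβ : 0 < β) :
    ∃ X : Finset Q, (∀ x ∈ X, x ∈ M ∧ w x ≤ β) ∧
      levelLE w β ⊓ K ≤ FL p w K β ⊔ Subgroup.zpowers g ⊔ Subgroup.closure (X : Set Q) ∧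
      X.card + (if β = w g then 1 else 0) ≤ rr p w K β := by
  classical
  have hPM := Phi_le_index_p hp hQ hMK
  have hz : Subgroup.zpowers g ≤ K := by simpa using hg
  set S : Set Q := {x | x ∈ M ∧ w x ≤ β} with hS
  have hSK : S ⊆ K := fun x hx => hM hx.1
  have hSE : Subgroup.closure S ≤ FE p w K β := by
    refine (Subgroup.closure_le _).2 (fun x hx => Subgroup.mem_sup_left ⟨?_, hM hx.1⟩)
    exact (mem_levelLE h hβ.le).2 hx.2
  have hcov : levelLE w β ⊓ K ≤ Subgroup.zpowers g ⊔ Subgroup.closure S := by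
    rintro x ⟨hx1, hx2⟩
    have hx1 : w x ≤ β := (mem_levelLE h hβ.le).1 hx1
    by_cases hxM : x ∈ M
    · exact Subgroup.mem_sup_right (Subgroup.subset_closure ⟨hxM, hx1⟩)
    · have hgβ := (hmin x hx2 hxM).trans hx1
      obtain ⟨i, hi⟩ := decomp_index_p hp hQ hMK hg hgM hx2
      have h1 : x * g ^ i ∈ S :=
        ⟨hi, (h.mul_le _ _).trans (max_le hx1 ((zpow_le h g i).trans hgβ))⟩
      have e : x = x * g ^ i * g ^ (-i) := by group
      rw [e]
      exact Subgroup.mul_mem _ (Subgroup.mem_sup_right (Subgroup.subset_closure h1))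
        (Subgroup.mem_sup_left (Subgroup.zpow_mem _ (Subgroup.mem_zpowers g) _))
  by_cases hβg : β = w g
  · have hgL : g ∉ FL p w K β := by
      intro hgL
      refine hgM ((sup_le ?_ hPM : FL p w K β ≤ M) hgL)
      rintro x ⟨hx1, hx2⟩
      by_contra hxM
      have h1 := (mem_levelLT h hβ).1 hx1
      rw [hβg] at h1
      exact absurd (hmin x hx2 hxM) (not_le.2 h1)
    have hzE : Subgroup.zpowers g ≤ FE p w K β := by
      have : g ∈ FE p w K β := Subgroup.mem_sup_left ⟨(mem_levelLE h hβ.le).2 hβg.ge, hg⟩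
      simpa using this
    obtain ⟨X, hX1, hX2, hX3⟩ := greedy hp S hSK _ (FL p w K β ⊔ Subgroup.zpowers g)
      (sup_le (FL_le K β) hz) ((Phi_le_FL K β).trans le_sup_left) le_rfl
    refine ⟨X, fun x hx => hX1 hx, ?_, ?_⟩
    · rw [hX2, sup_assoc]
      exact hcov.trans le_sup_right
    · rw [if_pos hβg]
      have h1 := Subgroup.relIndex_mul_relIndex (FL p w K β) (FL p w K β ⊔ Subgroup.zpowers g)
        (FL p w K β ⊔ Subgroup.zpowers g ⊔ Subgroup.closure S) le_sup_left le_sup_left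
      rw [hX3, relIndex_zpowers_eq hp (FL_le K β) (Phi_le_FL K β) hg hgL, ← pow_succ'] at h1
      have h2 : (FL p w K β).relIndex (FL p w K β ⊔ Subgroup.zpowers g ⊔ Subgroup.closure S) ≤
          (FL p w K β).relIndex (FE p w K β) :=
        Subgroup.relIndex_le_of_le_right (sup_le (sup_le (FL_le_FE K β) hzE) hSE)
          (relIndex_ne_zero' _ _)
      rw [← h1, relIndex_pow hp hQ (FL p w K β)] at h2
      exact (Nat.pow_le_pow_iff_right hp.one_lt).1 h2
  · obtain ⟨X, hX1, hX2, hX3⟩ := greedy hp S hSK _ (FL p w K β)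
      (FL_le K β) (Phi_le_FL K β) le_rfl
    refine ⟨X, fun x hx => hX1 hx, ?_, ?_⟩
    · rw [sup_assoc, sup_comm (Subgroup.zpowers g), ← sup_assoc, hX2, sup_assoc,
        sup_comm (Subgroup.closure S)]
      exact hcov.trans le_sup_right
    · rw [if_neg hβg, add_zero]
      have h2 : (FL p w K β).relIndex (FL p w K β ⊔ Subgroup.closure S) ≤
          (FL p w K β).relIndex (FE p w K β) :=
        Subgroup.relIndex_le_of_le_right (sup_le (FL_le_FE K β) hSE) (relIndex_ne_zero' _ _)
      rw [hX3, relIndex_pow hp hQ (FL p w K β)] at h2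
      exact (Nat.pow_le_pow_iff_right hp.one_lt).1 h2

lemma sum_biUnion_le' {ι κ : Type*} [DecidableEq κ] (A : Finset ι) (X : ι → Finset κ) (f : κ → ℝ)
    (hf : ∀ x, 0 ≤ f x) : ∑ x ∈ A.biUnion X, f x ≤ ∑ a ∈ A, ∑ x ∈ X a, f x := by
  classical
  induction A using Finset.induction_on with
  | empty => simp
  | insert a s ha ih =>
    rw [Finset.biUnion_insert, Finset.sum_insert ha]
    have h1 := Finset.sum_union_inter (s₁ := X a) (s₂ := s.biUnion X) (f := f)
    have h2 : 0 ≤ ∑ x ∈ X a ∩ s.biUnion X, f x := Finset.sum_nonneg (fun x _ => hf x)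
    linarith

lemma exists_gens [Finite Q] (hp : p.Prime) (hQ : ∃ n, Nat.card Q = p ^ n) (h : FVal p w)
    {M K : Subgroup Q} (hM : M ≤ K) (hMK : M.relIndex K = p) {g : Q} (hg : g ∈ K) (hgM : g ∉ M)
    (hmin : ∀ x ∈ K, x ∉ M → w g ≤ w x) (A : Finset ℝ)
    (hA : ∀ α ∈ A, 0 < α) (hA' : ∀ g, g ≠ 1 → w g ∈ A) :
    ∃ X : Finset Q, (X : Set Q) ⊆ M ∧ Subgroup.closure (insert g (X : Set Q)) = K ∧
      ∑ x ∈ X, w x + w g ≤ ∑ β ∈ A, β * (rr p w K β : ℝ) := by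
  classical
  have hex : ∀ β : ℝ, ∃ X : Finset Q, β ∈ A → (∀ x ∈ X, x ∈ M ∧ w x ≤ β) ∧
      levelLE w β ⊓ K ≤ FL p w K β ⊔ Subgroup.zpowers g ⊔ Subgroup.closure (X : Set Q) ∧
      X.card + (if β = w g then 1 else 0) ≤ rr p w K β := by
    intro β
    by_cases hβ : β ∈ A
    · obtain ⟨X, hX⟩ := gens_level hp hQ h hM hMK hg hgM hmin (hA β hβ)
      exact ⟨X, fun _ => hX⟩
    · exact ⟨∅, fun h1 => absurd h1 hβ⟩
  choose X hX using hex
  have hg1 : g ≠ 1 := fun h1 => hgM (h1 ▸ M.one_mem)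
  have hXM : ((A.biUnion X : Finset Q) : Set Q) ⊆ M := by
    intro x hx
    obtain ⟨β, hβ, hx⟩ := Finset.mem_biUnion.1 (Finset.mem_coe.1 hx)
    exact ((hX β hβ).1 x hx).1
  refine ⟨A.biUnion X, hXM, ?_, ?_⟩
  · set T := Subgroup.closure (insert g ((A.biUnion X : Finset Q) : Set Q)) with hT
    have hgT : Subgroup.zpowers g ≤ T := by
      have : g ∈ T := Subgroup.subset_closure (Set.mem_insert _ _)
      simpa using this
    have hTK : T ≤ K := by
      refine (Subgroup.closure_le _).2 ?_
      rintro x (rfl | hx)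
      · exact hg
      · exact hM (hXM hx)
    apply frattini_gen hp hQ hTK
    by_contra hne
    obtain ⟨x0, hx0, hx0'⟩ := SetLike.not_le_iff_exists.1 hne
    obtain ⟨x, ⟨hxK, hxT⟩, hxmin⟩ := Set.exists_min_image {x | x ∈ K ∧ x ∉ T ⊔ Phi p K} w
      (Set.toFinite _) ⟨x0, hx0, hx0'⟩
    have hx1 : x ≠ 1 := fun h1 => hxT (h1 ▸ Subgroup.one_mem _)
    have hβ := hA' x hx1
    obtain ⟨-, h2, -⟩ := hX (w x) hβ
    have hβ0 := hA _ hβ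
    apply hxT
    have h3 : FL p w K (w x) ⊔ Subgroup.zpowers g ⊔ Subgroup.closure (X (w x) : Set Q) ≤
        T ⊔ Phi p K := by
      refine sup_le (sup_le (sup_le ?_ le_sup_right) (hgT.trans le_sup_left)) ?_
      · rintro y ⟨hy1, hy2⟩
        by_contra hy3
        exact absurd (hxmin y ⟨hy2, hy3⟩) (not_le.2 ((mem_levelLT h hβ0).1 hy1))
      · refine (Subgroup.closure_mono ?_).trans le_sup_left
        intro y hy
        exact Set.mem_insert_of_mem _ (Finset.mem_coe.2 (Finset.mem_biUnion.2 ⟨_, hβ, hy⟩))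
    exact h3 (h2 ⟨(mem_levelLE h hβ0.le).2 le_rfl, hxK⟩)
  · have h1 := sum_biUnion_le' A X w h.nonneg
    have h2 : ∑ β ∈ A, ∑ x ∈ X β, w x + w g ≤ ∑ β ∈ A, β * (rr p w K β : ℝ) := by
      have e : w g = ∑ β ∈ A, β * (if β = w g then (1 : ℝ) else 0) := by
        simp [hA' g hg1]
      conv_lhs => rw [e]
      rw [← Finset.sum_add_distrib]
      refine Finset.sum_le_sum (fun β hβ => ?_)
      obtain ⟨h3, -, h4⟩ := hX β hβ
      have h5 : ∑ x ∈ X β, w x ≤ (X β).card * β := by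
        rw [← nsmul_eq_mul]
        exact Finset.sum_le_card_nsmul _ _ _ (fun x hx => (h3 x hx).2)
      have h6 : ((X β).card : ℝ) + (if β = w g then (1 : ℝ) else 0) ≤ (rr p w K β : ℝ) := by
        exact_mod_cast h4
      have := mul_le_mul_of_nonneg_left h6 (hA β hβ).le
      linarith
    linarith

lemma relIndex_inf_index_p [Finite Q] (hp : p.Prime) (hQ : ∃ n, Nat.card Q = p ^ n)
    {M K : Subgroup Q} (hM : M ≤ K) (hMK : M.relIndex K = p) (R : Subgroup Q) :
    ((R ⊓ K ≤ M) → (R ⊓ M).relIndex (R ⊓ K) = 1) ∧ (¬ (R ⊓ K ≤ M) → (R ⊓ M).relIndex (R ⊓ K) = p) := by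
  have e : (R ⊓ M).relIndex (R ⊓ K) = M.relIndex (R ⊓ K) := by
    rw [← Subgroup.inf_relIndex_right M]
    congr 1
    rw [inf_left_comm, inf_eq_left.2 hM]
  rw [e]
  refine ⟨fun h1 => Subgroup.relIndex_eq_one.2 h1, fun h1 => ?_⟩
  have h2 : M.relIndex (R ⊓ K) ≤ M.relIndex K :=
    Subgroup.relIndex_le_of_le_right inf_le_right (relIndex_ne_zero' _ _)
  rw [← Subgroup.relIndex_eq_one] at h1
  rw [relIndex_pow hp hQ] at h1 h2 ⊢
  generalize Nat.log p (M.relIndex (R ⊓ K)) = k at *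
  rw [hMK] at h2
  have h3 : k ≤ 1 := by
    apply (Nat.pow_le_pow_iff_right hp.one_lt).1
    rwa [pow_one]
  have h4 : k ≠ 0 := by
    rintro rfl
    simp at h1
  have : k = 1 := by omega
  rw [this, pow_one]

lemma cval_step [Finite Q] (hp : p.Prime) (hQ : ∃ n, Nat.card Q = p ^ n) (h : FVal p w)
    {M K : Subgroup Q} (hM : M ≤ K) (hMK : M.relIndex K = p) {g : Q} (hg : g ∈ K) (hgM : g ∉ M)
    (hmin : ∀ x ∈ K, x ∉ M → w g ≤ w x) {α : ℝ} (hα : 0 < α) :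
    cval p w K α = cval p w M α + (if α = w g then 1 else 0) := by
  have hle := levelLT_le w α
  have m1 := Subgroup.relIndex_mul_relIndex (levelLT w α ⊓ M) (levelLT w α ⊓ K) (levelLE w α ⊓ K)
    (inf_le_inf_left _ hM) (inf_le_inf_right _ hle)
  have m2 := Subgroup.relIndex_mul_relIndex (levelLT w α ⊓ M) (levelLE w α ⊓ M) (levelLE w α ⊓ K)
    (inf_le_inf_right _ hle) (inf_le_inf_left _ hM)
  rw [← m2] at m1
  rw [relIndex_pow hp hQ (levelLT w α ⊓ K) (levelLE w α ⊓ K),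
    relIndex_pow hp hQ (levelLT w α ⊓ M) (levelLE w α ⊓ M)] at m1
  change _ * p ^ cval p w K α = p ^ cval p w M α * _ at m1
  obtain ⟨a1, a2⟩ := relIndex_inf_index_p hp hQ hM hMK (levelLT w α)
  obtain ⟨b1, b2⟩ := relIndex_inf_index_p hp hQ hM hMK (levelLE w α)
  have la : w g < α → ¬ (levelLT w α ⊓ K ≤ M) := fun h1 h2 =>
    hgM (h2 ⟨(mem_levelLT h hα).2 h1, hg⟩)
  have la' : α ≤ w g → levelLT w α ⊓ K ≤ M := by
    rintro h1 x ⟨hx1, hx2⟩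
    by_contra hx
    exact absurd (hmin x hx2 hx) (not_le.2 (((mem_levelLT h hα).1 hx1).trans_le h1))
  have lb : w g ≤ α → ¬ (levelLE w α ⊓ K ≤ M) := fun h1 h2 =>
    hgM (h2 ⟨(mem_levelLE h hα.le).2 h1, hg⟩)
  have lb' : α < w g → levelLE w α ⊓ K ≤ M := by
    rintro h1 x ⟨hx1, hx2⟩
    by_contra hx
    exact absurd (hmin x hx2 hx) (not_le.2 (((mem_levelLE h hα.le).1 hx1).trans_lt h1))
  have inj := Nat.pow_right_injective hp.two_le
  rcases lt_trichotomy α (w g) with h1 | h1 | h1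
  · rw [a1 (la' h1.le), b1 (lb' h1), one_mul, mul_one] at m1
    rw [if_neg h1.ne, add_zero]
    exact inj m1
  · rw [a1 (la' h1.le), b2 (lb h1.ge), one_mul, ← pow_succ] at m1
    rw [if_pos h1]
    exact inj m1
  · rw [a2 (la h1), b2 (lb h1.le), mul_comm] at m1
    rw [if_neg h1.ne', add_zero]
    exact inj (Nat.eq_of_mul_eq_mul_right hp.pos m1)

/-- the ratio appearing in the index -/
noncomputable def ratio (p : ℕ) (α : ℝ) : ℝ := (1 - α ^ p) / (1 - α)

lemma ratio_eq {α : ℝ} (hα : α < 1) : ratio p α = ∑ i ∈ Finset.range p, α ^ i := by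
  have h1 := geom_sum_mul_neg α p
  have h2 : (1 - α) ≠ 0 := by linarith
  rw [ratio, ← h1, mul_div_assoc, div_self h2, mul_one]

lemma one_le_ratio (hp : p.Prime) {α : ℝ} (h0 : 0 ≤ α) (hα : α < 1) : 1 ≤ ratio p α := by
  rw [ratio_eq hα]
  have := Finset.single_le_sum (f := fun i => α ^ i) (s := Finset.range p)
    (fun i _ => pow_nonneg h0 i) (Finset.mem_range.2 hp.pos)
  simpa using this

/-- absolute index product -/
noncomputable def II (p : ℕ) (w : Q → ℝ) (A : Finset ℝ) (K : Subgroup Q) : ℝ :=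
  ∏ α ∈ A, ratio p α ^ cval p w K α

/-- rank sum -/
noncomputable def RK (p : ℕ) (w : Q → ℝ) (A : Finset ℝ) (K : Subgroup Q) : ℝ :=
  ∑ α ∈ A, α * (rr p w K α : ℝ)

lemma II_pos (hp : p.Prime) {A : Finset ℝ} (hA : ∀ α ∈ A, 0 < α ∧ α < 1) (K : Subgroup Q) :
    0 < II p w A K :=
  Finset.prod_pos (fun α hα => pow_pos
    (lt_of_lt_of_le one_pos (one_le_ratio hp (hA α hα).1.le (hA α hα).2)) _)

lemma finite_step [Finite Q] (hp : p.Prime) (hQ : ∃ n, Nat.card Q = p ^ n) (h : FVal p w)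
    {M K : Subgroup Q} (hM : M ≤ K) (hMK : M.relIndex K = p) {A : Finset ℝ}
    (hA : ∀ α ∈ A, 0 < α ∧ α < 1) (hA' : ∀ g, g ≠ 1 → w g ∈ A) :
    II p w A M * (RK p w A M - 1) ≤ II p w A K * (RK p w A K - 1) := by
  have hne : ¬ K ≤ M := by
    rw [← Subgroup.relIndex_eq_one, hMK]
    exact hp.one_lt.ne'
  obtain ⟨x0, hx0, hx0'⟩ := SetLike.not_le_iff_exists.1 hne
  obtain ⟨g, ⟨hg, hgM⟩, hmin⟩ := Set.exists_min_image {x | x ∈ K ∧ x ∉ M} w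
      (Set.toFinite _) ⟨x0, hx0, hx0'⟩
  have hmin' : ∀ x ∈ K, x ∉ M → w g ≤ w x := fun x h1 h2 => hmin x ⟨h1, h2⟩
  have hg1 : g ≠ 1 := fun h1 => hgM (h1 ▸ M.one_mem)
  obtain ⟨X, hX1, hX2, hX3⟩ := exists_gens hp hQ h hM hMK hg hgM hmin' A (fun α hα => (hA α hα).1) hA'
  obtain ⟨Y, hY1, hY2⟩ := schreier_set hp h hM (normal_index_p hp hQ hMK)
    (Phi_le_index_p hp hQ hMK (pow_mem_Phi hg)) hgM hX1 hX2
  have h1 : RK p w A M ≤ _ := (rank_le hp hQ h hY1 A (fun α hα => (hA α hα).1) hA').trans hY2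
  change _ ≤ RK p w A K at hX3
  have e : II p w A K = II p w A M * ratio p (w g) := by
    have e1 : ratio p (w g) = ∏ α ∈ A, ratio p α ^ (if α = w g then 1 else 0) := by
      simp [pow_ite, hA' g hg1]
    rw [e1, II, II, ← Finset.prod_mul_distrib]
    refine Finset.prod_congr rfl (fun α hα => ?_)
    rw [cval_step hp hQ h hM hMK hg hgM hmin' (hA α hα).1, pow_add]
  rw [e, mul_assoc]
  refine mul_le_mul_of_nonneg_left ?_ (II_pos hp hA M).le
  rw [← ratio_eq (h.lt_one g)] at h1
  have hr := one_le_ratio hp (h.nonneg g) (h.lt_one g)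
  have h2 : ratio p (w g) * (1 - w g) = 1 - w g ^ p := by
    have : 1 - w g ≠ 0 := by linarith [h.lt_one g]
    rw [ratio, div_mul_cancel₀ _ this]
  nlinarith

theorem finite_main [Finite Q] (hp : p.Prime) (hQ : ∃ n, Nat.card Q = p ^ n) (h : FVal p w)
    {A : Finset ℝ} (hA : ∀ α ∈ A, 0 < α ∧ α < 1) (hA' : ∀ g, g ≠ 1 → w g ∈ A) (H : Subgroup Q) :
    ∀ (n : ℕ) (K : Subgroup Q), H ≤ K → Nat.card K ≤ n →
      II p w A H * (RK p w A H - 1) ≤ II p w A K * (RK p w A K - 1) ∧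
      ∀ α ∈ A, cval p w H α ≤ cval p w K α := by
  intro n
  induction n with
  | zero => intro K _ hn; exact absurd (Nat.le_zero.1 hn) Nat.card_pos.ne'
  | succ n ih =>
    intro K hHK hn
    rcases eq_or_lt_of_le hHK with rfl | hlt
    · exact ⟨le_rfl, fun _ _ => le_rfl⟩
    · obtain ⟨M, hHM, hM, hMK⟩ := exists_index_p hp hQ hlt
      have hcard := Subgroup.relIndex_mul_relIndex ⊥ M K bot_le hM
      rw [Subgroup.relIndex_bot_left, Subgroup.relIndex_bot_left, hMK] at hcard
      have h2 := hp.two_le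
      have h3 : 0 < Nat.card M := Nat.card_pos
      obtain ⟨i1, i2⟩ := ih M hHM (by nlinarith)
      refine ⟨i1.trans (finite_step hp hQ h hM hMK hA hA'), fun α hα => (i2 α hα).trans ?_⟩
      have hne : ¬ K ≤ M := by
        rw [← Subgroup.relIndex_eq_one, hMK]
        exact hp.one_lt.ne'
      obtain ⟨x0, hx0, hx0'⟩ := SetLike.not_le_iff_exists.1 hne
      obtain ⟨g, ⟨hg, hgM⟩, hmin⟩ := Set.exists_min_image {x | x ∈ K ∧ x ∉ M} w
          (Set.toFinite _) ⟨x0, hx0, hx0'⟩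
      rw [cval_step hp hQ h hM hMK hg hgM (fun x h1 h2 => hmin x ⟨h1, h2⟩) (hA α hα).1]
      exact Nat.le_add_right _ _

/-- Finite form with natural subtraction in the exponents. -/
theorem finite_main' [Finite Q] (hp : p.Prime) (hQ : ∃ n, Nat.card Q = p ^ n) (h : FVal p w)
    {A : Finset ℝ} (hA : ∀ α ∈ A, 0 < α ∧ α < 1) (hA' : ∀ g, g ≠ 1 → w g ∈ A) (H : Subgroup Q) :
    RK p w A H - 1 ≤ (∏ α ∈ A, ratio p α ^ (cval p w ⊤ α - cval p w H α)) * (RK p w A ⊤ - 1) := by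
  obtain ⟨h1, h2⟩ := finite_main hp hQ h hA hA' H _ ⊤ le_top le_rfl
  have e : II p w A ⊤ = II p w A H * ∏ α ∈ A, ratio p α ^ (cval p w ⊤ α - cval p w H α) := by
    rw [II, II, ← Finset.prod_mul_distrib]
    refine Finset.prod_congr rfl (fun α hα => ?_)
    rw [← pow_add, Nat.add_sub_cancel' (h2 α hα)]
  rw [e, mul_assoc] at h1
  exact le_of_mul_le_mul_left h1 (II_pos hp hA H)

end main_finite
end WS

namespace WS
section transfer
open Filter Topology

variable {Γ : Type*} [Group Γ] [TopologicalSpace Γ] [IsTopologicalGroup Γ] {p : ℕ}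

lemma fval_of_valuation [CompactSpace Γ] (W : GroupValuation p Γ) : FVal p W.toFun where
  nonneg := W.nonneg
  lt_one := W.lt_one
  one := (W.eq_zero_iff 1).2 rfl
  eq_one := fun g h => (W.eq_zero_iff g).1 h
  mul_le := W.mul_le
  inv_le := by
    intro g
    have h1 : ∀ n : ℕ, W.toFun (g ^ n) ≤ W.toFun g := by
      intro n
      induction n with
      | zero =>
        rw [pow_zero, (W.eq_zero_iff 1).2 rfl]
        exact W.nonneg g
      | succ n ih =>
        rw [pow_succ]
        exact (W.mul_le _ _).trans (max_le ih le_rfl)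
    have h2 : IsClosed {x | W.toFun x ≤ W.toFun g} :=
      isClosed_le W.continuous_toFun continuous_const
    have h3 : MapClusterPt g⁻¹ atTop (g ^ · : ℕ → Γ) := by
      simpa using mapClusterPt_self_zpow_atTop_pow g (-1)
    exact h2.mem_of_mapClusterPt h3 (Eventually.of_forall h1)
  comm_le := W.commutator_le
  pow_le := W.pow_le

lemma conj_le {w : Γ → ℝ} (h : FVal p w) (g x : Γ) : w (x * g * x⁻¹) ≤ w g := by
  have e : x * g * x⁻¹ = g * (g⁻¹ * (x⁻¹)⁻¹ * g * x⁻¹) := by group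
  rw [e]
  refine (h.mul_le _ _).trans (max_le le_rfl ((h.comm_le _ _).trans ?_))
  nlinarith [h.nonneg g, h.lt_one x⁻¹, h.nonneg x⁻¹]

lemma levelLT_normal {w : Γ → ℝ} (h : FVal p w) {ε : ℝ} (hε : 0 < ε) : (levelLT w ε).Normal :=
  ⟨fun n hn g => (mem_levelLT h hε).2 ((conj_le h n g).trans_lt ((mem_levelLT h hε).1 hn))⟩

/-- truncation -/
noncomputable def tr (w : Γ → ℝ) (ε : ℝ) (g : Γ) : ℝ := if w g < ε then 0 else w g

/-- the quotient valuation -/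
noncomputable def qw (w : Γ → ℝ) (ε : ℝ) (q : Γ ⧸ levelLT w ε) : ℝ := tr w ε q.out

lemma qw_mk {w : Γ → ℝ} (h : FVal p w) {ε : ℝ} (hε : 0 < ε) (g : Γ) :
    qw w ε (g : Γ ⧸ levelLT w ε) = tr w ε g := by
  obtain ⟨n, hn⟩ := QuotientGroup.mk_out_eq_mul (levelLT w ε) g
  have hn2 := (mem_levelLT h hε).1 n.2
  rw [qw, hn]
  have h1 := h.mul_le g n
  have h2 := h.mul_le (g * n) (n : Γ)⁻¹
  have h3 := h.inv_le n
  rw [mul_inv_cancel_right] at h2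
  unfold tr
  by_cases hg : w g < ε
  · rw [if_pos hg, if_pos (h1.trans_lt (max_lt hg hn2))]
  · rw [not_lt] at hg
    have h4 : w g ≤ w (g * n) := by
      rcases le_max_iff.1 h2 with h5 | h5
      · exact h5
      · linarith
    have h5 : w (g * n) ≤ w g := h1.trans (max_le le_rfl (by linarith))
    rw [if_neg (by linarith), if_neg (by linarith)]
    linarith

lemma fval_qw {w : Γ → ℝ} (h : FVal p w) (hp : p.Prime) {ε : ℝ} (hε : 0 < ε)
    [hN : (levelLT w ε).Normal] : FVal p (qw w ε) := by
  have nn : ∀ g, 0 ≤ tr w ε g := by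
    intro g
    unfold tr
    split_ifs
    · exact le_rfl
    · exact h.nonneg g
  have big : ∀ {g}, ε ≤ w g → tr w ε g = w g := fun hg => if_neg (not_lt.2 hg)
  have small : ∀ {g}, w g < ε → tr w ε g = 0 := fun hg => if_pos hg
  have mk : ∀ g : Γ, qw w ε (g : Γ ⧸ levelLT w ε) = tr w ε g := qw_mk h hε
  refine ⟨?_, ?_, ?_, ?_, ?_, ?_, ?_, ?_⟩
  · exact fun q => nn _
  · intro q
    rw [qw, tr]
    split_ifs
    · exact one_pos
    · exact h.lt_one _
  · rw [← QuotientGroup.mk_one, mk]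
    exact small (by rw [h.one]; exact hε)
  · intro q
    induction q using QuotientGroup.induction_on with | H g => ?_
    intro hg
    rw [mk] at hg
    rw [QuotientGroup.eq_one_iff, mem_levelLT h hε]
    by_contra hh
    rw [big (not_lt.1 hh)] at hg
    linarith
  · intro a b
    induction a using QuotientGroup.induction_on with | H f => ?_
    induction b using QuotientGroup.induction_on with | H g => ?_
    rw [← QuotientGroup.mk_mul, mk, mk, mk]
    by_cases hh : w (f * g) < ε
    · rw [small hh]
      exact le_max_of_le_left (nn f)
    · rw [not_lt] at hh
      rw [big hh]
      rcases le_max_iff.1 (h.mul_le f g) with h1 | h1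
      · exact le_max_of_le_left (by rw [big (hh.trans h1)]; exact h1)
      · exact le_max_of_le_right (by rw [big (hh.trans h1)]; exact h1)
  · intro a
    induction a using QuotientGroup.induction_on with | H g => ?_
    rw [← QuotientGroup.mk_inv, mk, mk]
    by_cases hh : w g⁻¹ < ε
    · rw [small hh]
      exact nn g
    · rw [not_lt] at hh
      rw [big hh, big (hh.trans (h.inv_le g))]
      exact h.inv_le g
  · intro a b
    induction a using QuotientGroup.induction_on with | H f => ?_
    induction b using QuotientGroup.induction_on with | H g => ?_
    rw [← QuotientGroup.mk_inv, ← QuotientGroup.mk_inv, ← QuotientGroup.mk_mul,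
      ← QuotientGroup.mk_mul, ← QuotientGroup.mk_mul, mk, mk, mk]
    by_cases hh : w (f⁻¹ * g⁻¹ * f * g) < ε
    · rw [small hh]
      exact mul_nonneg (nn f) (nn g)
    · rw [not_lt] at hh
      have h1 := h.comm_le f g
      have hf : w f * w g ≤ w f := by nlinarith [h.nonneg f, h.lt_one g]
      have hg : w f * w g ≤ w g := by nlinarith [h.nonneg g, h.lt_one f]
      rw [big hh, big (hh.trans (h1.trans hf)), big (hh.trans (h1.trans hg))]
      exact h1
  · intro a
    induction a using QuotientGroup.induction_on with | H g => ?_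
    rw [← QuotientGroup.mk_pow, mk, mk]
    by_cases hh : w (g ^ p) < ε
    · rw [small hh]
      exact pow_nonneg (nn g) p
    · rw [not_lt] at hh
      have h1 := h.pow_le g
      have h2 : w g ^ p ≤ w g := pow_le_of_le_one (h.nonneg g) (h.lt_one g).le hp.ne_zero
      rw [big hh, big (hh.trans (h1.trans h2))]
      exact h1

lemma relIndex_transfer {Δ : Type*} [Group Δ] (π : Γ →* Δ) {A B : Subgroup Γ} (hBA : B ≤ A)
    (hk : A ⊓ π.ker ≤ B) : (B.map π).relIndex (A.map π) = B.relIndex A := by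
  rw [← Subgroup.relIndex_comap, Subgroup.comap_map_eq, ← Subgroup.inf_relIndex_right]
  congr 1
  apply le_antisymm
  · rintro x ⟨hx1, hx2⟩
    obtain ⟨b, hb, k, hk', rfl⟩ := Subgroup.mem_sup_of_normal_right.1 hx1
    have hk2 : k ∈ A := (Subgroup.mul_mem_cancel_left A (hBA hb)).1 hx2
    exact B.mul_mem hb (hk ⟨hk2, hk'⟩)
  · exact le_inf le_sup_left hBA

lemma map_Phi {Δ : Type*} [Group Δ] (π : Γ →* Δ) (K : Subgroup Γ) :
    (Phi p K).map π = Phi p (K.map π) := by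
  rw [Phi, MonoidHom.map_closure, Phi]
  congr 1
  ext y
  constructor
  · rintro ⟨x, ⟨a, ha, b, hb, rfl⟩ | ⟨a, ha, rfl⟩, rfl⟩
    · exact Or.inl ⟨π a, ⟨a, ha, rfl⟩, π b, ⟨b, hb, rfl⟩, by simp⟩
    · exact Or.inr ⟨π a, ⟨a, ha, rfl⟩, by simp⟩
  · rintro (⟨_, ⟨a, ha, rfl⟩, _, ⟨b, hb, rfl⟩, rfl⟩ | ⟨_, ⟨a, ha, rfl⟩, rfl⟩)
    · exact ⟨_, Or.inl ⟨a, ha, b, hb, rfl⟩, by simp⟩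
    · exact ⟨_, Or.inr ⟨a, ha, rfl⟩, by simp⟩

lemma map_Frattini {Δ : Type*} [Group Δ] (π : Γ →* Δ) (ho : IsOpen (π.ker : Set Γ))
    (K : Subgroup Γ) : (FrattiniClosure p K).map π = Phi p (K.map π) := by
  rw [← map_Phi]
  apply le_antisymm
  · have h1 : FrattiniClosure p K ≤ Phi p K ⊔ π.ker := by
      refine Subgroup.topologicalClosure_minimal _ le_sup_left ?_
      exact Subgroup.isClosed_of_isOpen _ (Subgroup.isOpen_mono le_sup_right ho)
    refine (Subgroup.map_mono h1).trans ?_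
    rw [Subgroup.map_sup]
    refine sup_le le_rfl ?_
    rintro _ ⟨x, hx, rfl⟩
    rw [show π x = 1 from hx]
    exact Subgroup.one_mem _
  · exact Subgroup.map_mono (Subgroup.le_topologicalClosure _)

/-- the exponent in the frozen rank -/
noncomputable def frr (p : ℕ) (w : Γ → ℝ) (K : Subgroup Γ) (α : ℝ) : ℕ :=
  Nat.log p (((levelLT w α ⊓ K) ⊔ FrattiniClosure p K).relIndex
        ((levelLE w α ⊓ K) ⊔ FrattiniClosure p K))

section q
variable {w : Γ → ℝ} {ε : ℝ} 

lemma mk_mem_LE (h : FVal p w) (hp : p.Prime) (hε : 0 < ε)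
    [hN : (levelLT w ε).Normal] {α : ℝ} (hα : ε ≤ α) (g : Γ) :
    (g : Γ ⧸ levelLT w ε) ∈ levelLE (qw w ε) α ↔ g ∈ levelLE w α := by
  rw [mem_levelLE (fval_qw h hp hε) (hε.le.trans hα), mem_levelLE h (hε.le.trans hα), qw_mk h hε, tr]
  split_ifs with h1
  · exact ⟨fun _ => h1.le.trans hα, fun _ => hε.le.trans hα⟩
  · rfl

lemma mk_mem_LT (h : FVal p w) (hp : p.Prime) (hε : 0 < ε)
    [hN : (levelLT w ε).Normal] {α : ℝ} (hα : ε ≤ α) (g : Γ) :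
    (g : Γ ⧸ levelLT w ε) ∈ levelLT (qw w ε) α ↔ g ∈ levelLT w α := by
  rw [mem_levelLT (fval_qw h hp hε) (hε.trans_le hα), mem_levelLT h (hε.trans_le hα), qw_mk h hε, tr]
  split_ifs with h1
  · exact ⟨fun _ => h1.trans_le hα, fun _ => hε.trans_le hα⟩
  · rfl

lemma map_inf' {Δ : Type*} [Group Δ] (π : Γ →* Δ) (R K : Subgroup Γ) (R' : Subgroup Δ)
    (hR : ∀ g, π g ∈ R' ↔ g ∈ R) : (R ⊓ K).map π = R' ⊓ K.map π := by
  ext y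
  constructor
  · rintro ⟨x, ⟨h1, h2⟩, rfl⟩
    exact ⟨(hR x).2 h1, ⟨x, h2, rfl⟩⟩
  · rintro ⟨h1, ⟨x, h2, rfl⟩⟩
    exact ⟨x, ⟨(hR x).1 h1, h2⟩, rfl⟩

lemma ker_le (h : FVal p w) (hε : 0 < ε) [hN : (levelLT w ε).Normal] {α : ℝ} (hα : ε ≤ α) :
    (QuotientGroup.mk' (levelLT w ε)).ker ≤ levelLT w α := by
  rw [QuotientGroup.ker_mk']
  intro x hx
  exact (mem_levelLT h (hε.trans_le hα)).2 (((mem_levelLT h hε).1 hx).trans_le hα)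

lemma cval_transfer (h : FVal p w) (hp : p.Prime) (hε : 0 < ε)
    [hN : (levelLT w ε).Normal] {α : ℝ} (hα : ε ≤ α) (K : Subgroup Γ) :
    cval p (qw w ε) (K.map (QuotientGroup.mk' (levelLT w ε))) α = cval p w K α := by
  unfold cval
  rw [← map_inf' _ (levelLT w α) K _ (mk_mem_LT h hp hε hα),
    ← map_inf' _ (levelLE w α) K _ (mk_mem_LE h hp hε hα), relIndex_transfer]
  · exact inf_le_inf_right _ (levelLT_le w α)
  · exact le_inf (inf_le_right.trans (ker_le h hε hα)) (inf_le_left.trans inf_le_right)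

lemma rr_transfer (h : FVal p w) (hp : p.Prime) (hε : 0 < ε)
    [hN : (levelLT w ε).Normal] (ho : IsOpen (levelLT w ε : Set Γ)) {α : ℝ} (hα : ε ≤ α)
    {K : Subgroup Γ} (hK : IsClosed (K : Set Γ)) :
    rr p (qw w ε) (K.map (QuotientGroup.mk' (levelLT w ε))) α = frr p w K α := by
  have hF : FrattiniClosure p K ≤ K := Subgroup.topologicalClosure_minimal _ (Phi_le K) hK
  unfold rr frr FL FE
  rw [← map_inf' _ (levelLT w α) K _ (mk_mem_LT h hp hε hα),
    ← map_inf' _ (levelLE w α) K _ (mk_mem_LE h hp hε hα),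
    ← map_Frattini _ (by rw [QuotientGroup.ker_mk']; exact ho), ← Subgroup.map_sup,
    ← Subgroup.map_sup, relIndex_transfer]
  · exact sup_le_sup_right (inf_le_inf_right _ (levelLT_le w α)) _
  · exact (le_inf (inf_le_right.trans (ker_le h hε hα))
      (inf_le_left.trans (sup_le inf_le_right hF))).trans le_sup_left

end q

lemma key (hp : p.Prime) (hG : IsProPGroup p Γ) (W : GroupValuation p Γ) (H : Subgroup Γ)
    (hH : IsClosed (H : Set Γ)) (S : Finset (Set.Ioo (0 : ℝ) 1)) :
    ∃ A : Finset (Set.Ioo (0 : ℝ) 1), S ⊆ A ∧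
      ∑ α ∈ A, (α : ℝ) * (frr p W.toFun H α : ℝ) - 1 ≤
        (∏ α ∈ A, ratio p (α : ℝ) ^ (cval p W.toFun ⊤ (α : ℝ) - cval p W.toFun H (α : ℝ))) *
          (∑ α ∈ A, (α : ℝ) * (frr p W.toFun ⊤ α : ℝ) - 1) := by
  classical
  obtain ⟨hc, -, -, hind⟩ := hG
  have h := fval_of_valuation W
  have : Nonempty (Set.Ioo (0 : ℝ) 1) := ⟨⟨1 / 2, by norm_num, by norm_num⟩⟩
  have hSb : ∃ M : Set.Ioo (0 : ℝ) 1, ∀ x ∈ S, M ≤ x :=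
    Finset.exists_le (α := (Set.Ioo (0 : ℝ) 1)ᵒᵈ) S
  obtain ⟨⟨ε, hε, hε1⟩, hS⟩ := hSb
  set w := W.toFun with hw
  have hN := levelLT_normal h hε
  have ho : IsOpen (levelLT w ε : Set Γ) := by
    have : (levelLT w ε : Set Γ) = {g | w g < ε} := by
      ext g
      exact mem_levelLT h hε
    rw [this]
    exact isOpen_lt W.continuous_toFun continuous_const
  obtain ⟨k, hk⟩ := hind _ hN ho
  have hcard : Nat.card (Γ ⧸ levelLT w ε) = p ^ k := hk
  have hfin : Finite (Γ ⧸ levelLT w ε) :=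
    Nat.finite_of_card_ne_zero (by rw [hcard]; exact pow_ne_zero _ hp.ne_zero)
  have hq := fval_qw h hp hε
  have := Fintype.ofFinite (Γ ⧸ levelLT w ε)
  let A : Finset ℝ := S.image (fun x : Set.Ioo (0 : ℝ) 1 => (x : ℝ)) ∪
    (Finset.univ.image (qw w ε)).filter (fun x => x ≠ 0)
  have hA1 : ∀ α ∈ A, ε ≤ α ∧ α < 1 := by
    intro α hα
    rcases Finset.mem_union.1 hα with h1 | h1
    · obtain ⟨x, hx, rfl⟩ := Finset.mem_image.1 h1
      exact ⟨hS x hx, x.2.2⟩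
    · obtain ⟨h2, h3⟩ := Finset.mem_filter.1 h1
      obtain ⟨q, -, rfl⟩ := Finset.mem_image.1 h2
      refine ⟨?_, hq.lt_one q⟩
      rw [qw, tr] at h3 ⊢
      split_ifs at h3 ⊢ with h4
      · exact absurd rfl h3
      · exact not_lt.1 h4
  have hA2 : ∀ α ∈ A, 0 < α ∧ α < 1 := fun α hα => ⟨hε.trans_le (hA1 α hα).1, (hA1 α hα).2⟩
  have hA3 : ∀ q, q ≠ 1 → qw w ε q ∈ A := by
    intro q hq1
    refine Finset.mem_union_right _ (Finset.mem_filter.2 ⟨Finset.mem_image_of_mem _ (Finset.mem_univ _), ?_⟩)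
    exact fun h0 => hq1 (hq.eq_one q h0)
  have main := finite_main' hp ⟨k, hcard⟩ hq hA2 hA3 (H.map (QuotientGroup.mk' (levelLT w ε)))
  have htop : (⊤ : Subgroup (Γ ⧸ levelLT w ε)) =
      (⊤ : Subgroup Γ).map (QuotientGroup.mk' (levelLT w ε)) :=
    (Subgroup.map_top_of_surjective _ (QuotientGroup.mk'_surjective _)).symm
  have hmem : ∀ α ∈ A, α ∈ Set.Ioo (0 : ℝ) 1 := hA2
  rw [htop] at main
  refine ⟨A.subtype (fun x => x ∈ Set.Ioo (0 : ℝ) 1), ?_, ?_⟩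
  · intro x hx
    exact Finset.mem_subtype.2 (Finset.mem_union_left _ (Finset.mem_image_of_mem (fun x : Set.Ioo (0 : ℝ) 1 => (x : ℝ)) hx))
  · rw [Finset.sum_subtype_of_mem (fun α : ℝ => α * (frr p w H α : ℝ)) hmem,
      Finset.sum_subtype_of_mem (fun α : ℝ => α * (frr p w ⊤ α : ℝ)) hmem,
      Finset.prod_subtype_of_mem (fun α : ℝ => ratio p α ^ (cval p w ⊤ α - cval p w H α)) hmem]
    have e : ∀ K : Subgroup Γ, IsClosed (K : Set Γ) →
        RK p (qw w ε) A (K.map (QuotientGroup.mk' (levelLT w ε))) =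
          ∑ α ∈ A, α * (frr p w K α : ℝ) := by
      intro K hK
      refine Finset.sum_congr rfl (fun α hα => ?_)
      rw [rr_transfer h hp hε ho (hA1 α hα).1 hK]
    rw [e H hH, e ⊤ isClosed_univ] at main
    refine main.trans_eq ?_
    congr 1
    refine Finset.prod_congr rfl (fun α hα => ?_)
    rw [cval_transfer h hp hε (hA1 α hα).1, cval_transfer h hp hε (hA1 α hα).1]

end transfer
end WS

namespace WS
section final
open Filter Topology

lemma prod_lim {ι : Type*} (φ : ι → ℝ≥0∞) (h : ∀ i, 1 ≤ φ i) :
    Tendsto (fun A : Finset ι => ∏ i ∈ A, φ i) atTop (𝓝 (∏' i, φ i)) ∧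
      ∀ A : Finset ι, ∏ i ∈ A, φ i ≤ ∏' i, φ i := by
  have hm : Monotone (fun A : Finset ι => ∏ i ∈ A, φ i) := by
    intro A B hAB
    exact Finset.prod_le_prod_of_subset_of_one_le' hAB (fun i _ _ => h i)
  have ht := tendsto_atTop_iSup hm
  have hP : HasProd φ (⨆ A : Finset ι, ∏ i ∈ A, φ i) := ht
  rw [hP.tprod_eq]
  exact ⟨ht, fun A => le_iSup (fun A : Finset ι => ∏ i ∈ A, φ i) A⟩

end final
end WS

/-- Weighted Schreier index formula (inequality form). -/
theorem weighted_schreier_inequality (p : ℕ) (hp : p.Prime)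
    (G : Type*) [Group G] [TopologicalSpace G] [IsTopologicalGroup G]
    (hG : IsProPGroup p G) (W : GroupValuation p G)
    (H : Subgroup G) (hH : IsClosed (H : Set G))
    (hidx : WIndex p W.toFun H ≠ ⊤) (hrk : WRank p W.toFun (⊤ : Subgroup G) ≠ ⊤) :
    WRank p W.toFun H ≠ ⊤ ∧
      (WRank p W.toFun H).toReal - 1 ≤
        (WIndex p W.toFun H).toReal * ((WRank p W.toFun (⊤ : Subgroup G)).toReal - 1) := by
  classical
  have key := WS.key hp hG W H hH
  set w := W.toFun with hw
  let f : Subgroup G → Set.Ioo (0 : ℝ) 1 → ℝ≥0∞ := fun K α =>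
    ENNReal.ofReal (α : ℝ) * (WS.frr p w K α : ℝ≥0∞)
  let φ : Set.Ioo (0 : ℝ) 1 → ℝ≥0∞ := fun α =>
    ENNReal.ofReal (WS.ratio p (α : ℝ)) ^ (cval p w ⊤ (α : ℝ) - cval p w H (α : ℝ))
  have hR : ∀ K, WRank p w K = ∑' α, f K α := fun K => rfl
  have hI : WIndex p w H = ∏' α, φ α := rfl
  have hr : ∀ α : Set.Ioo (0 : ℝ) 1, 1 ≤ WS.ratio p (α : ℝ) := fun α =>
    WS.one_le_ratio hp α.2.1.le α.2.2
  have hφ : ∀ α, 1 ≤ φ α := fun α =>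
    one_le_pow₀ (by rw [ENNReal.one_le_ofReal]; exact hr α)
  obtain ⟨hlim, hple⟩ := WS.prod_lim φ hφ
  rw [← hI] at hlim hple
  have hf : ∀ K α, f K α ≠ ⊤ := fun K α =>
    ENNReal.mul_ne_top ENNReal.ofReal_ne_top (ENNReal.natCast_ne_top _)
  have ef : ∀ K (A : Finset (Set.Ioo (0 : ℝ) 1)), (∑ α ∈ A, f K α).toReal =
      ∑ α ∈ A, (α : ℝ) * (WS.frr p w K α : ℝ) := by
    intro K A
    rw [ENNReal.toReal_sum (fun α _ => hf K α)]
    refine Finset.sum_congr rfl (fun α _ => ?_)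
    simp only [f]
    rw [ENNReal.toReal_mul, ENNReal.toReal_ofReal α.2.1.le, ENNReal.toReal_natCast]
  have eφ : ∀ A : Finset (Set.Ioo (0 : ℝ) 1), (∏ α ∈ A, φ α).toReal =
      ∏ α ∈ A, WS.ratio p (α : ℝ) ^ (cval p w ⊤ (α : ℝ) - cval p w H (α : ℝ)) := by
    intro A
    rw [ENNReal.toReal_prod]
    refine Finset.prod_congr rfl (fun α _ => ?_)
    simp only [φ]
    rw [ENNReal.toReal_pow, ENNReal.toReal_ofReal (zero_le_one.trans (hr α))]
  have key' : ∀ S : Finset (Set.Ioo (0 : ℝ) 1), ∃ A, S ⊆ A ∧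
      (∑ α ∈ A, f H α).toReal - 1 ≤
        (∏ α ∈ A, φ α).toReal * ((∑ α ∈ A, f ⊤ α).toReal - 1) := by
    intro S
    obtain ⟨A, hA, h⟩ := key S
    exact ⟨A, hA, by rw [ef, ef, eφ]; exact h⟩
  have hfin : WRank p w H ≠ ⊤ := by
    refine ne_top_of_le_ne_top (b := ENNReal.ofReal
      (1 + (WIndex p w H).toReal * (WRank p w ⊤).toReal)) ENNReal.ofReal_ne_top ?_
    rw [hR, ENNReal.tsum_eq_iSup_sum]
    refine iSup_le (fun S => ?_)
    obtain ⟨A, hA, h⟩ := key' S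
    refine (Finset.sum_le_sum_of_subset hA).trans ?_
    refine ENNReal.le_ofReal_iff_toReal_le (ENNReal.sum_ne_top.2 (fun α _ => hf H α))
      (by positivity) |>.2 ?_
    have h1 : (∏ α ∈ A, φ α).toReal ≤ (WIndex p w H).toReal :=
      ENNReal.toReal_mono hidx (hple A)
    have h2 : (∑ α ∈ A, f ⊤ α).toReal ≤ (WRank p w ⊤).toReal :=
      ENNReal.toReal_mono hrk (ENNReal.sum_le_tsum A)
    have h3 : (∏ α ∈ A, φ α).toReal * (∑ α ∈ A, f ⊤ α).toReal ≤
        (WIndex p w H).toReal * (WRank p w ⊤).toReal :=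
      mul_le_mul h1 h2 ENNReal.toReal_nonneg ENNReal.toReal_nonneg
    have h4 : 0 ≤ (∏ α ∈ A, φ α).toReal := ENNReal.toReal_nonneg
    linarith
  refine ⟨hfin, ?_⟩
  have tR : ∀ K, WRank p w K ≠ ⊤ → Filter.Tendsto
      (fun A : Finset (Set.Ioo (0 : ℝ) 1) => (∑ α ∈ A, f K α).toReal) Filter.atTop
      (nhds (WRank p w K).toReal) := by
    intro K hK
    have h1 : HasSum (f K) (WRank p w K) := ENNReal.summable.hasSum
    exact (ENNReal.tendsto_toReal hK).comp h1
  have tI := (ENNReal.tendsto_toReal hidx).comp hlim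
  refine le_of_tendsto_of_tendsto_of_frequently ((tR H hfin).sub_const 1)
    (tI.mul ((tR ⊤ hrk).sub_const 1)) ?_
  rw [Filter.frequently_atTop]
  intro S
  obtain ⟨A, hA, h⟩ := key' S
  exact ⟨A, hA, h⟩
end
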